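/- arXiv:1007.1165 — 7 statements merged into one kernel-verified Lean document; each statement's English description precedes it below -/
import Mathlib

section
/- Under hypotheses (E1) and (E2), the operators Φ(b_i(m)) on ℂ[y] satisfy, for all 1 ≤ i,j ≤ n and all m,n ∈ ℤ^{N+1}, the toroidal Heisenberg relation [Φ(b_i(m)), Φ(b_j(n))] = −A_{ij} ( Σ_{p=0}^N m_p κ_{−m−n,p} ) · id_{ℂ[y]}, where A_{ij} is the finite type A_n Cartan matrix (A_{ii}=2, A_{ij}=−1 if |i−j|=1, A_{ij}=0 otherwise). In particular, Φ defines a representation on ℂ[y] of the toroidal Heisenberg algebra with generators b_i(m) and central elements K_{m,p}, where K_{m,p} acts as the scalar −κ_{−m,p} (and Σ_{p=0}^N m_p(−κ_{−m,p}) = 0 by (E1)). -/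
noncomputable section

namespace Stmt3

/-- Multi-indices `m ∈ ℤ^{N+1}`. -/
abbrev MM (N : ℕ) := Fin (N + 1) → ℤ

/-- Index type for the polynomial variables `y_i(k)`, `1 ≤ i ≤ n`, `k > 0`. -/
def YIdx (n N : ℕ) (pos : MM N → Prop) :=
  {i : ℕ // 1 ≤ i ∧ i ≤ n} × {k : MM N // pos k}

/-- The polynomial ring `ℂ[y]`. -/
abbrev Py (n N : ℕ) (pos : MM N → Prop) := MvPolynomial (YIdx n N pos) ℂ

open Classical in
/-- `θ(m) = 1` if `m > 0` and `0` otherwise. -/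
def theta {N : ℕ} (pos : MM N → Prop) (m : MM N) : ℂ := if pos m then 1 else 0

open Classical in
/-- `∂/∂y_i(s)`, with the convention that it is `0` unless `1 ≤ i ≤ n` and `s > 0`. -/
def ydot (n N : ℕ) (pos : MM N → Prop) (i : ℕ) (s : MM N) :
    Py n N pos → Py n N pos := fun w =>
  if h : (1 ≤ i ∧ i ≤ n) ∧ pos s then
    MvPolynomial.pderiv ((⟨i, h.1⟩, ⟨s, h.2⟩) : YIdx n N pos) w
  else 0

/-- `Σ_{p=0}^N m_p κ_{-m+s,p}`. -/
def cnum {N : ℕ} (kappa : MM N → Fin (N + 1) → ℂ) (m s : MM N) : ℂ :=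
  ∑ p : Fin (N + 1), (m p : ℂ) * kappa (-m + s) p

open Classical in
/-- The operator `Φ(b_i(m))` on `ℂ[y]` (for `1 ≤ i ≤ n`). -/
def Phi (n N : ℕ) (pos : MM N → Prop) (kappa : MM N → Fin (N + 1) → ℂ)
    (lam : ℕ → ℂ) (i : ℕ) (m : MM N) : Py n N pos → Py n N pos := fun w =>
  theta pos (-m) • (∑ᶠ s : MM N, cnum kappa m s •
      (ydot n N pos (i - 1) s w - ydot n N pos i s w))
  + theta pos m • (∑ᶠ s : MM N, cnum kappa m s •
      (ydot n N pos (i - 1) s w - (2 : ℂ) • ydot n N pos i s w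
        + ydot n N pos (i + 1) s w))
  + (if h : (1 ≤ i ∧ i ≤ n) ∧ pos (-m) then
      (MvPolynomial.X ((⟨i, h.1⟩, ⟨-m, h.2⟩) : YIdx n N pos) : Py n N pos) * w
    else 0)
  - (if m = 0 then lam i else 0) • w

/-- The commutator of two operators. -/
def comm {V : Type*} [AddCommGroup V] (f g : V → V) : V → V :=
  fun w => f (g w) - g (f w)

/-- The finite type `A_n` Cartan matrix (indices `1 ≤ i, j ≤ n`). -/
def AFin (i j : ℕ) : ℂ :=
  if i = j then 2 else if i + 1 = j ∨ j + 1 = i then -1 else 0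

section Operators

variable {n N : ℕ} {pos : MM N → Prop}

/-- The index of the variable `y_a(s)`. -/
def yIdx (a : ℕ) (s : MM N) (h : (1 ≤ a ∧ a ≤ n) ∧ pos s) : YIdx n N pos :=
  (⟨a, h.1⟩, ⟨s, h.2⟩)

theorem ydot_of_mem {a : ℕ} {s : MM N} (h : (1 ≤ a ∧ a ≤ n) ∧ pos s) (w : Py n N pos) :
    ydot n N pos a s w = MvPolynomial.pderiv (yIdx a s h) w :=
  dif_pos h

theorem ydot_of_not_mem {a : ℕ} {s : MM N} (h : ¬((1 ≤ a ∧ a ≤ n) ∧ pos s)) (w : Py n N pos) :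
    ydot n N pos a s w = 0 :=
  dif_neg h

open Classical in
/-- `∂/∂y_a(s)` as a derivation of `ℂ[y]`. -/
def ydotDer (n N : ℕ) (pos : MM N → Prop) (a : ℕ) (s : MM N) :
    Derivation ℂ (Py n N pos) (Py n N pos) :=
  if h : (1 ≤ a ∧ a ≤ n) ∧ pos s then MvPolynomial.pderiv (yIdx a s h) else 0

theorem ydot_eq_ydotDer (a : ℕ) (s : MM N) (w : Py n N pos) :
    ydot n N pos a s w = ydotDer n N pos a s w := by
  by_cases h : (1 ≤ a ∧ a ≤ n) ∧ pos s
  · rw [ydot_of_mem h, ydotDer, dif_pos h]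
  · rw [ydot_of_not_mem h, ydotDer, dif_neg h, Derivation.zero_apply]

open Classical in
theorem ydotDer_X (a : ℕ) (s : MM N) (v : YIdx n N pos) :
    ydotDer n N pos a s (MvPolynomial.X v) = if v.1.1 = a ∧ v.2.1 = s then 1 else 0 := by
  by_cases h : (1 ≤ a ∧ a ≤ n) ∧ pos s
  · rw [ydotDer, dif_pos h, MvPolynomial.pderiv_X, Pi.single_apply]
    exact if_congr (Prod.ext_iff.trans (and_congr Subtype.ext_iff Subtype.ext_iff)) rfl rfl
  · rw [ydotDer, dif_neg h, Derivation.zero_apply, if_neg]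
    rintro ⟨rfl, rfl⟩
    exact h ⟨v.1.2, v.2.2⟩

theorem finite_support_smul_ydot (a : ℕ) (c : MM N → ℂ) (w : Py n N pos) :
    (Function.support fun s => c s • ydot n N pos a s w).Finite := by
  classical
  refine (w.vars.image fun v => v.2.1).finite_toSet.subset fun s hs => ?_
  have hs' : ydot n N pos a s w ≠ 0 := fun h => hs (by simp only [h, smul_zero])
  by_cases h : (1 ≤ a ∧ a ≤ n) ∧ pos s
  · refine Finset.mem_coe.2 (Finset.mem_image.2 ⟨yIdx a s h, ?_, rfl⟩)
    by_contra hv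
    exact hs' ((ydot_of_mem h w).trans (MvPolynomial.pderiv_eq_zero_of_notMem_vars hv))
  · exact absurd (ydot_of_not_mem h w) hs'

open Classical in
/-- The derivation `∑_{s>0} c(s) ∂/∂y_a(s)` of `ℂ[y]`. -/
def sumDer (n N : ℕ) (pos : MM N → Prop) (a : ℕ) (c : MM N → ℂ) :
    Derivation ℂ (Py n N pos) (Py n N pos) :=
  MvPolynomial.mkDerivation ℂ fun v =>
    if v.1.1 = a then MvPolynomial.C (c v.2.1) else 0

open Classical in
theorem sumDer_X (a : ℕ) (c : MM N → ℂ) (v : YIdx n N pos) :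
    sumDer n N pos a c (MvPolynomial.X v) =
      MvPolynomial.C (if v.1.1 = a then c v.2.1 else 0) := by
  rw [sumDer, MvPolynomial.mkDerivation_X]
  split_ifs <;> simp

theorem finsum_smul_ydot (a : ℕ) (c : MM N → ℂ) (w : Py n N pos) :
    ∑ᶠ s, c s • ydot n N pos a s w = sumDer n N pos a c w := by
  classical
  induction w using MvPolynomial.induction_on with
  | C r => simp [ydot_eq_ydotDer]
  | add p q hp hq =>
    rw [map_add, ← hp, ← hq, ← finsum_add_distrib (finite_support_smul_ydot a c p)
      (finite_support_smul_ydot a c q)]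
    simp [ydot_eq_ydotDer]
  | mul_X p v hp =>
    have hX : ∑ᶠ s, c s • ydot n N pos a s (MvPolynomial.X v) =
        sumDer n N pos a c (MvPolynomial.X v) := by
      rw [finsum_eq_single _ v.2.1, sumDer_X, ydot_eq_ydotDer, ydotDer_X]
      · split_ifs <;> simp_all [MvPolynomial.smul_eq_C_mul]
      · intro s hs
        rw [ydot_eq_ydotDer, ydotDer_X, if_neg fun h => hs h.2.symm, smul_zero]
    rw [Derivation.leibniz, ← hp, ← hX, smul_eq_mul, smul_eq_mul,
      mul_finsum, mul_finsum, ← finsum_add_distrib]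
    · refine finsum_congr fun s => ?_
      simp only [ydot_eq_ydotDer, Derivation.leibniz, smul_add, smul_eq_mul, mul_smul_comm]
    · exact (finite_support_smul_ydot a c (MvPolynomial.X v)).subset fun s hs h =>
        hs ((congrArg _ h).trans (mul_zero _))
    · exact (finite_support_smul_ydot a c p).subset fun s hs h =>
        hs ((congrArg _ h).trans (mul_zero _))

theorem finsum_smul_ydot_sub (a b : ℕ) (c : MM N → ℂ) (w : Py n N pos) :
    ∑ᶠ s, c s • (ydot n N pos a s w - ydot n N pos b s w) =
      sumDer n N pos a c w - sumDer n N pos b c w := by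
  simp only [← finsum_smul_ydot, smul_sub]
  exact finsum_sub_distrib (finite_support_smul_ydot a c w) (finite_support_smul_ydot b c w)

theorem finsum_smul_ydot_second_difference (a b d : ℕ) (c : MM N → ℂ) (w : Py n N pos) :
    ∑ᶠ s, c s • (ydot n N pos a s w - (2 : ℂ) • ydot n N pos b s w + ydot n N pos d s w) =
      sumDer n N pos a c w - (2 : ℂ) • sumDer n N pos b c w + sumDer n N pos d c w := by
  have ha := finite_support_smul_ydot a c w
  have hb := finite_support_smul_ydot b c w
  have hd := finite_support_smul_ydot d c w
  have hb' : (Function.support fun s => (2 : ℂ) • c s • ydot n N pos b s w).Finite :=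
    hb.subset fun s hs h => hs (by simp only [h, smul_zero])
  simp only [← finsum_smul_ydot, smul_sub, smul_add, smul_comm _ (2 : ℂ)]
  rw [finsum_add_distrib ((ha.union hb').subset (Function.support_sub _ _)) hd,
    finsum_sub_distrib ha hb', smul_finsum' _ hb]

/-- The derivation part of `Φ(b_i(m))`. -/
def phiDer (n N : ℕ) (pos : MM N → Prop) (kappa : MM N → Fin (N + 1) → ℂ) (i : ℕ) (m : MM N) :
    Derivation ℂ (Py n N pos) (Py n N pos) :=
  theta pos (-m) • (sumDer n N pos (i - 1) (cnum kappa m) - sumDer n N pos i (cnum kappa m)) +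
  theta pos m • (sumDer n N pos (i - 1) (cnum kappa m)
    - (2 : ℂ) • sumDer n N pos i (cnum kappa m) + sumDer n N pos (i + 1) (cnum kappa m))

open Classical in
/-- The multiplication part of `Φ(b_i(m))`. -/
def phiMul (n N : ℕ) (pos : MM N → Prop) (i : ℕ) (m : MM N) : Py n N pos :=
  if h : (1 ≤ i ∧ i ≤ n) ∧ pos (-m) then MvPolynomial.X (yIdx i (-m) h) else 0

open Classical in
theorem Phi_apply (kappa : MM N → Fin (N + 1) → ℂ) (lam : ℕ → ℂ) (i : ℕ) (m : MM N)
    (w : Py n N pos) :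
    Phi n N pos kappa lam i m w = phiDer n N pos kappa i m w + phiMul n N pos i m * w
      - (if m = 0 then lam i else 0) • w := by
  unfold Phi phiDer phiMul
  rw [finsum_smul_ydot_sub, finsum_smul_ydot_second_difference]
  simp only [Derivation.add_apply, Derivation.smul_apply, Derivation.sub_apply]
  split_ifs <;> simp [yIdx]

open Classical in
/-- The value of `phiDer` on the variable `v`. -/
theorem phiDer_X (kappa : MM N → Fin (N + 1) → ℂ) (i : ℕ) (m : MM N) (v : YIdx n N pos) :
    phiDer n N pos kappa i m (MvPolynomial.X v) = MvPolynomial.C (cnum kappa m v.2.1 *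
      (theta pos (-m) * ((if v.1.1 = i - 1 then 1 else 0) - (if v.1.1 = i then 1 else 0)) +
        theta pos m * ((if v.1.1 = i - 1 then 1 else 0) - 2 * (if v.1.1 = i then 1 else 0)
          + (if v.1.1 = i + 1 then 1 else 0)))) := by
  have h (a : ℕ) : sumDer n N pos a (cnum kappa m) (MvPolynomial.X v) =
      MvPolynomial.C (cnum kappa m v.2.1 * (if v.1.1 = a then 1 else 0)) := by
    rw [sumDer_X, mul_ite, mul_one, mul_zero]
  unfold phiDer
  simp only [Derivation.add_apply, Derivation.smul_apply, Derivation.sub_apply, h,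
    MvPolynomial.smul_eq_C_mul, ← map_mul, ← map_sub, ← map_add]
  congr 1
  ring

/-- Derivations of a polynomial ring with constant coefficients commute. -/
theorem derivation_comm_of_X_const {σ : Type*} {f g : σ → ℂ}
    {D E : Derivation ℂ (MvPolynomial σ ℂ) (MvPolynomial σ ℂ)}
    (hD : ∀ v, D (MvPolynomial.X v) = MvPolynomial.C (f v))
    (hE : ∀ v, E (MvPolynomial.X v) = MvPolynomial.C (g v)) (w : MvPolynomial σ ℂ) :
    D (E w) = E (D w) := by
  have h : ⁅D, E⁆ = 0 := by
    refine MvPolynomial.derivation_ext fun v => ?_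
    simp [Derivation.commutator_apply, hD, hE]
  rw [← sub_eq_zero, ← Derivation.commutator_apply, h, Derivation.zero_apply]

theorem comm_Phi_apply (kappa : MM N → Fin (N + 1) → ℂ) (lam : ℕ → ℂ) (i j : ℕ) (m k : MM N)
    (w : Py n N pos) :
    comm (Phi n N pos kappa lam i m) (Phi n N pos kappa lam j k) w =
      (phiDer n N pos kappa i m (phiMul n N pos j k)
        - phiDer n N pos kappa j k (phiMul n N pos i m)) * w := by
  have h := derivation_comm_of_X_const (phiDer_X (n := n) (pos := pos) kappa i m)
    (phiDer_X kappa j k) w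
  simp only [comm, Phi_apply, map_add, map_sub, Derivation.leibniz, smul_eq_mul, h, MvPolynomial.smul_eq_C_mul]
  simp only [MvPolynomial.derivation_C]
  ring

open Classical in
/-- The value of the derivation part of one operator on the multiplication part of another. -/
theorem phiDer_phiMul (kappa : MM N → Fin (N + 1) → ℂ) {i j : ℕ} (hi : 1 ≤ i)
    (hj : 1 ≤ j) (hjn : j ≤ n) (m k : MM N) :
    phiDer n N pos kappa i m (phiMul n N pos j k) = MvPolynomial.C
      (theta pos (-k) * (∑ p : Fin (N + 1), (m p : ℂ) * kappa (-m - k) p) *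
        (theta pos (-m) * ((if j + 1 = i then 1 else 0) - (if i = j then 1 else 0))
          - theta pos m * AFin i j)) := by
  have h1 : (j = i - 1) ↔ j + 1 = i := by omega
  have h2 : (j = i) ↔ i = j := eq_comm
  have h3 : (j = i + 1) ↔ i + 1 = j := eq_comm
  have hA : AFin i j = -((if j + 1 = i then 1 else 0) - 2 * (if i = j then 1 else 0)
      + (if i + 1 = j then 1 else 0)) := by
    unfold AFin
    split_ifs <;> first | omega | norm_num
  by_cases hk : pos (-k)
  · rw [phiMul, dif_pos ⟨⟨hj, hjn⟩, hk⟩, phiDer_X, hA]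
    simp only [yIdx, h1, h2, h3, cnum, ← sub_eq_add_neg]
    simp only [theta, if_pos hk]
    congr 1
    ring
  · rw [phiMul, dif_neg fun h => hk h.2, map_zero, theta, if_neg hk]
    simp

end Operators

/-- Under the hypotheses (E1), (E2), the operators `Φ(b_i(m))` satisfy the
toroidal Heisenberg relation
`[Φ(b_i(m)), Φ(b_j(n))] = -A_{ij} (Σ_{p=0}^N m_p κ_{-m-n,p}) · id` for
`1 ≤ i, j ≤ n`, and the central elements `K_{m,p}` act as `-κ_{-m,p}`, with
`Σ_{p=0}^N m_p (-κ_{-m,p}) = 0`. -/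
theorem stmt3 (n N : ℕ) (hn : 2 ≤ n) (hN : 1 ≤ N)
    (pos : MM N → Prop)
    (hadd : ∀ a b : MM N, pos a → pos b → pos (a + b))
    (htri : ∀ a : MM N, pos a ∨ a = 0 ∨ pos (-a))
    (hzero : ¬ pos (0 : MM N))
    (hdisj : ∀ a : MM N, pos a → ¬ pos (-a))
    (kappa : MM N → Fin (N + 1) → ℂ) (lam : ℕ → ℂ)
    (hE1 : ∀ m : MM N, ∑ p : Fin (N + 1), (m p : ℂ) * kappa m p = 0)
    (hE2 : ∀ m k : MM N, pos m → pos k →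
      ∑ p : Fin (N + 1), (m p : ℂ) * kappa (-m - k) p = 0) :
    (∀ i j : ℕ, 1 ≤ i → i ≤ n → 1 ≤ j → j ≤ n → ∀ m mm : MM N,
      comm (Phi n N pos kappa lam i m) (Phi n N pos kappa lam j mm)
        = (-(AFin i j) * ∑ p : Fin (N + 1), (m p : ℂ) * kappa (-m - mm) p)
            • (id : Py n N pos → Py n N pos)) ∧
    (∀ m : MM N, ∑ p : Fin (N + 1), (m p : ℂ) * (-(kappa (-m) p)) = 0) := by
  have hswap (m k : MM N) : ∑ p : Fin (N + 1), (k p : ℂ) * kappa (-k - m) p =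
      -∑ p : Fin (N + 1), (m p : ℂ) * kappa (-m - k) p := by
    have h := hE1 (-m - k)
    have hmk : -k - m = -m - k := by abel
    rw [hmk, ← add_eq_zero_iff_eq_neg, ← Finset.sum_add_distrib, ← neg_eq_zero,
      ← Finset.sum_neg_distrib, ← h]
    refine Finset.sum_congr rfl fun p _ => ?_
    simp only [Pi.sub_apply, Pi.neg_apply]
    push_cast
    ring
  have hsum (m k : MM N) (h : m = 0 ∨ k = 0) :
      ∑ p : Fin (N + 1), (m p : ℂ) * kappa (-m - k) p = 0 := by
    rcases h with rfl | rfl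
    · simp
    · simpa using hswap 0 m
  refine ⟨fun i j hi hin hj hjn m k => funext fun w => ?_, fun m => ?_⟩
  · have hA : AFin j i = AFin i j := by
      unfold AFin
      split_ifs <;> first | rfl | omega
    have hA' : AFin i j = 2 * (if i = j then 1 else 0) - (if j + 1 = i then 1 else 0)
        - (if i + 1 = j then 1 else 0) := by
      unfold AFin
      split_ifs <;> first | omega | norm_num
    rw [comm_Phi_apply, phiDer_phiMul kappa hi hj hjn, phiDer_phiMul kappa hj hi hin, ← map_sub,
      ← MvPolynomial.smul_eq_C_mul, Pi.smul_apply, id, hswap m k, hA]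
    congr 1
    simp only [theta, @eq_comm _ j i]
    by_cases h0 : m = 0 ∨ k = 0
    · simp [hsum m k h0]
    obtain ⟨hm0, hk0⟩ := not_or.1 h0
    have hm := htri m
    have hk := htri k
    simp only [hm0, hk0, false_or] at hm hk
    rcases hm with hm | hm <;> rcases hk with hk | hk
    · simp [hE2 m k hm hk]
    · have h1 := hdisj m hm
      have h2 := hdisj (-k) hk
      rw [neg_neg] at h2
      simp only [if_pos, if_neg, hm, hk, h1, h2, not_false_eq_true]
      ring
    · have h1 := hdisj k hk
      have h2 := hdisj (-m) hm
      rw [neg_neg] at h2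
      simp only [if_pos, if_neg, hm, hk, h1, h2, not_false_eq_true]
      ring
    · have h1 := hdisj (-m) hm
      have h2 := hdisj (-k) hk
      rw [neg_neg] at h1 h2
      simp only [if_pos, if_neg, hm, hk, h1, h2, not_false_eq_true, hA']
      ring
  · rw [← hE1 (-m)]
    exact Finset.sum_congr rfl fun p _ => by simp

end Stmt3
end
end

section
/- Under hypotheses (E1) and (E2), define additionally Φ(b_0(m)) := −Σ_{i=1}^n Φ(b_i(m)). Then the Heisenberg relation extends to the full affine index set: for all 0 ≤ i,j ≤ n and all m,n ∈ ℤ^{N+1}, [Φ(b_i(m)), Φ(b_j(n))] = −Â_{ij} ( Σ_{p=0}^N m_p κ_{−m−n,p} ) · id_{ℂ[y]}, where Â is the affine Cartan matrix of type A_n^{(1)} (Â_{ii}=2, Â_{ij}=−1 if i−j ≡ ±1 (mod n+1), Â_{ij}=0 otherwise). -/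
noncomputable section

namespace Stmt4

/-- Multi-indices `m ∈ ℤ^{N+1}`. -/
abbrev MM (N : ℕ) := Fin (N + 1) → ℤ

/-- Index type for the polynomial variables `y_i(k)`, `1 ≤ i ≤ n`, `k > 0`. -/
def YIdx (n N : ℕ) (pos : MM N → Prop) :=
  {i : ℕ // 1 ≤ i ∧ i ≤ n} × {k : MM N // pos k}

/-- The polynomial ring `ℂ[y]`. -/
abbrev Py (n N : ℕ) (pos : MM N → Prop) := MvPolynomial (YIdx n N pos) ℂ

open Classical in
/-- `θ(m) = 1` if `m > 0` and `0` otherwise. -/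
def theta {N : ℕ} (pos : MM N → Prop) (m : MM N) : ℂ := if pos m then 1 else 0

open Classical in
/-- `∂/∂y_i(s)`, with the convention that it is `0` unless `1 ≤ i ≤ n` and `s > 0`. -/
def ydot (n N : ℕ) (pos : MM N → Prop) (i : ℕ) (s : MM N) :
    Py n N pos → Py n N pos := fun w =>
  if h : (1 ≤ i ∧ i ≤ n) ∧ pos s then
    MvPolynomial.pderiv ((⟨i, h.1⟩, ⟨s, h.2⟩) : YIdx n N pos) w
  else 0

/-- `Σ_{p=0}^N m_p κ_{-m+s,p}`. -/
def cnum {N : ℕ} (kappa : MM N → Fin (N + 1) → ℂ) (m s : MM N) : ℂ :=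
  ∑ p : Fin (N + 1), (m p : ℂ) * kappa (-m + s) p

open Classical in
/-- The operator `Φ(b_i(m))` on `ℂ[y]` (for `1 ≤ i ≤ n`). -/
def Phi (n N : ℕ) (pos : MM N → Prop) (kappa : MM N → Fin (N + 1) → ℂ)
    (lam : ℕ → ℂ) (i : ℕ) (m : MM N) : Py n N pos → Py n N pos := fun w =>
  theta pos (-m) • (∑ᶠ s : MM N, cnum kappa m s •
      (ydot n N pos (i - 1) s w - ydot n N pos i s w))
  + theta pos m • (∑ᶠ s : MM N, cnum kappa m s •
      (ydot n N pos (i - 1) s w - (2 : ℂ) • ydot n N pos i s w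
        + ydot n N pos (i + 1) s w))
  + (if h : (1 ≤ i ∧ i ≤ n) ∧ pos (-m) then
      (MvPolynomial.X ((⟨i, h.1⟩, ⟨-m, h.2⟩) : YIdx n N pos) : Py n N pos) * w
    else 0)
  - (if m = 0 then lam i else 0) • w

/-- The commutator of two operators. -/
def comm {V : Type*} [AddCommGroup V] (f g : V → V) : V → V :=
  fun w => f (g w) - g (f w)

/-- The affine Cartan matrix of type `A_n^{(1)}` (indices `0 ≤ i, j ≤ n`):
`Â_{ii} = 2`, `Â_{ij} = -1` if `i - j ≡ ±1 (mod n+1)`, and `0` otherwise. -/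
def Acar (n i j : ℕ) : ℂ :=
  if i = j then 2
  else if (i + 1) % (n + 1) = j % (n + 1) ∨ (j + 1) % (n + 1) = i % (n + 1) then -1
  else 0

/-- `Φ(b_0(m)) := -Σ_{i=1}^n Φ(b_i(m))`, and `Φ(b_i(m))` for `1 ≤ i ≤ n`. -/
def PhiHat (n N : ℕ) (pos : MM N → Prop) (kappa : MM N → Fin (N + 1) → ℂ)
    (lam : ℕ → ℂ) (i : ℕ) (m : MM N) : Py n N pos → Py n N pos :=
  if i = 0 then -(∑ r ∈ Finset.Icc 1 n, Phi n N pos kappa lam r m)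
  else Phi n N pos kappa lam i m

section Helpers

variable {n N : ℕ} {pos : MM N → Prop} {kappa : MM N → Fin (N + 1) → ℂ} {lam : ℕ → ℂ}

/-- The index of the variable `y_i(s)`. -/
def yIdx (i : ℕ) (s : MM N) (h : (1 ≤ i ∧ i ≤ n) ∧ pos s) : YIdx n N pos :=
  (⟨i, h.1⟩, ⟨s, h.2⟩)

open Classical in
/-- `∂/∂y_i(s)` as a derivation. -/
def yDeriv (n N : ℕ) (pos : MM N → Prop) (i : ℕ) (s : MM N) :
    Derivation ℂ (Py n N pos) (Py n N pos) :=
  if h : (1 ≤ i ∧ i ≤ n) ∧ pos s then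
    MvPolynomial.pderiv (yIdx i s h)
  else 0

lemma ydot_eq_yDeriv (i : ℕ) (s : MM N) (w : Py n N pos) :
    ydot n N pos i s w = yDeriv n N pos i s w := by
  by_cases h : (1 ≤ i ∧ i ≤ n) ∧ pos s
  · rw [yDeriv, dif_pos h]
    exact dif_pos h
  · rw [yDeriv, dif_neg h]
    exact dif_neg h

lemma yDeriv_X (i : ℕ) (s : MM N) (v : YIdx n N pos) :
    yDeriv n N pos i s (MvPolynomial.X v) = if v.1.1 = i ∧ v.2.1 = s then 1 else 0 := by
  classical
  by_cases h : (1 ≤ i ∧ i ≤ n) ∧ pos s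
  · have hv : (v.1.1 = i ∧ v.2.1 = s) ↔ yIdx i s h = v := by
      refine ⟨fun e => Prod.ext (Subtype.ext e.1.symm) (Subtype.ext e.2.symm), ?_⟩
      rintro rfl
      exact ⟨rfl, rfl⟩
    simp only [hv]
    rw [yDeriv, dif_pos h, MvPolynomial.pderiv_X, Pi.single_apply]
    simp only [eq_comm]
  · rw [yDeriv, dif_neg h, if_neg, Derivation.zero_apply]
    rintro ⟨rfl, rfl⟩
    exact h ⟨v.1.2, v.2.2⟩

lemma yDeriv_eq_zero_of_notMem (i : ℕ) {s : MM N} {w : Py n N pos}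
    (hs : ∀ v ∈ w.vars, v.2.1 ≠ s) : yDeriv n N pos i s w = 0 := by
  have := MvPolynomial.derivation_eq_of_forall_mem_vars (D₁ := yDeriv n N pos i s) (D₂ := 0)
    (f := w) fun v hv => by simp [yDeriv_X, hs v hv]
  simpa using this

/-- A locally finite sum of constant-coefficient derivations is again a derivation, determined
by its values on the variables. -/
lemma finsum_smul_yDeriv (c : MM N → ℂ) (a b d : ℂ) (i j k : ℕ) (w : Py n N pos) :
    ∑ᶠ s : MM N, c s • (a • yDeriv n N pos i s w + b • yDeriv n N pos j s w
        + d • yDeriv n N pos k s w)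
      = MvPolynomial.mkDerivation ℂ (fun v : YIdx n N pos => (MvPolynomial.C (c v.2.1 *
        ((if v.1.1 = i then a else 0) + (if v.1.1 = j then b else 0)
          + (if v.1.1 = k then d else 0))) : Py n N pos)) w := by
  classical
  set S : Finset (MM N) := w.vars.image fun v => v.2.1 with hS
  rw [finsum_eq_sum_of_support_subset (s := S)]
  · let E : Derivation ℂ (Py n N pos) (Py n N pos) := ∑ s ∈ S, c s • (a • yDeriv n N pos i s
      + b • yDeriv n N pos j s + d • yDeriv n N pos k s)
    have hE : ∀ u, E u = ∑ s ∈ S, c s • (a • yDeriv n N pos i s u + b • yDeriv n N pos j s u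
        + d • yDeriv n N pos k s u) := fun u => by
      have := congrFun (map_sum (Derivation.coeFnAddMonoidHom
        (R := ℂ) (A := Py n N pos) (M := Py n N pos)) (fun s => c s • (a • yDeriv n N pos i s
          + b • yDeriv n N pos j s + d • yDeriv n N pos k s)) S) u
      rw [Finset.sum_apply] at this
      exact this
    rw [← hE]
    refine MvPolynomial.derivation_eq_of_forall_mem_vars fun v hv => ?_
    have hvS : v.2.1 ∈ S := Finset.mem_image_of_mem _ hv
    rw [hE, MvPolynomial.mkDerivation_X, Finset.sum_eq_single_of_mem _ hvS]
    · simp only [yDeriv_X, and_true, MvPolynomial.smul_eq_C_mul, map_mul, map_add]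
      split_ifs <;> simp
    · intro s _ hs
      simp [yDeriv_X, hs.symm]
  · intro s hs
    by_contra hsS
    have h0 : ∀ v ∈ w.vars, v.2.1 ≠ s := fun v hv e =>
      hsS (by rw [← e]; exact Finset.mem_coe.2 (Finset.mem_image_of_mem _ hv))
    exact hs (by simp [yDeriv_eq_zero_of_notMem _ h0])

/-- The coefficient of `cnum kappa m s • ∂/∂y_j(s)` in `Φ(b_i(m))`. -/
def derivCoeff (pos : MM N → Prop) (i : ℕ) (m : MM N) (j : ℕ) : ℂ :=
  theta pos (-m) * ((if j = i - 1 then 1 else 0) + (if j = i then -1 else 0))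
  + theta pos m * ((if j = i - 1 then 1 else 0) + (if j = i then -2 else 0)
    + (if j = i + 1 then 1 else 0))

/-- The derivation part of `Φ(b_i(m))`. -/
def phiDeriv (n : ℕ) (pos : MM N → Prop) (kappa : MM N → Fin (N + 1) → ℂ) (i : ℕ) (m : MM N) :
    Derivation ℂ (Py n N pos) (Py n N pos) :=
  MvPolynomial.mkDerivation ℂ fun v =>
    MvPolynomial.C (cnum kappa m v.2.1 * derivCoeff pos i m v.1.1)

open Classical in
/-- The multiplication part of `Φ(b_i(m))`. -/
def phiMul (n : ℕ) (pos : MM N → Prop) (lam : ℕ → ℂ) (i : ℕ) (m : MM N) : Py n N pos :=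
  (if h : (1 ≤ i ∧ i ≤ n) ∧ pos (-m) then
      MvPolynomial.X (yIdx i (-m) h) else 0)
    - MvPolynomial.C (if m = 0 then lam i else 0)

lemma Phi_apply (i : ℕ) (m : MM N) (w : Py n N pos) :
    Phi n N pos kappa lam i m w
      = phiDeriv n pos kappa i m w + phiMul n pos lam i m * w := by
  classical
  have h1 := finsum_smul_yDeriv (cnum kappa m) 1 (-1) 0 (i - 1) i 0 w
  have h2 := finsum_smul_yDeriv (cnum kappa m) 1 (-2) 1 (i - 1) i (i + 1) w
  simp only [one_smul, neg_smul, zero_smul, add_zero, ← sub_eq_add_neg, ite_self] at h1 h2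
  have h0 : Phi n N pos kappa lam i m w
      = theta pos (-m) • (∑ᶠ s : MM N, cnum kappa m s •
          (ydot n N pos (i - 1) s w - ydot n N pos i s w))
        + theta pos m • (∑ᶠ s : MM N, cnum kappa m s •
          (ydot n N pos (i - 1) s w - (2 : ℂ) • ydot n N pos i s w
            + ydot n N pos (i + 1) s w))
        + (if h : (1 ≤ i ∧ i ≤ n) ∧ pos (-m) then MvPolynomial.X (yIdx i (-m) h) * w else 0)
        - (if m = 0 then lam i else 0) • w := rfl
  rw [h0]
  unfold phiMul
  simp only [ydot_eq_yDeriv, h1, h2]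
  have h3 : phiDeriv n pos kappa i m w = theta pos (-m) • MvPolynomial.mkDerivation ℂ
      (fun v : YIdx n N pos => (MvPolynomial.C (cnum kappa m v.2.1 *
        ((if v.1.1 = i - 1 then 1 else 0) + (if v.1.1 = i then -1 else 0))) : Py n N pos)) w
      + theta pos m • MvPolynomial.mkDerivation ℂ
      (fun v : YIdx n N pos => (MvPolynomial.C (cnum kappa m v.2.1 *
        ((if v.1.1 = i - 1 then 1 else 0) + (if v.1.1 = i then -2 else 0)
          + (if v.1.1 = i + 1 then 1 else 0))) : Py n N pos)) w := by
    rw [← Derivation.smul_apply, ← Derivation.smul_apply, ← Derivation.add_apply]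
    congr 1
    refine MvPolynomial.derivation_ext fun v => ?_
    simp only [phiDeriv, derivCoeff, Derivation.add_apply, Derivation.smul_apply,
      MvPolynomial.mkDerivation_X, MvPolynomial.smul_eq_C_mul, ← MvPolynomial.C_mul,
      ← MvPolynomial.C_add]
    congr 1
    ring
  rw [h3, MvPolynomial.smul_eq_C_mul (p := w)]
  split_ifs <;> ring

/-- `Φ(b_i(m))` as a linear endomorphism. -/
def phiEnd (n : ℕ) (pos : MM N → Prop) (kappa : MM N → Fin (N + 1) → ℂ) (lam : ℕ → ℂ)
    (i : ℕ) (m : MM N) : Module.End ℂ (Py n N pos) :=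
  (phiDeriv n pos kappa i m : Py n N pos →ₗ[ℂ] Py n N pos)
    + LinearMap.mulLeft ℂ (phiMul n pos lam i m)

lemma coe_phiEnd (i : ℕ) (m : MM N) :
    ⇑(phiEnd n pos kappa lam i m) = Phi n N pos kappa lam i m := by
  ext1 w
  rw [Phi_apply]
  rfl

lemma phiDeriv_comm (i j : ℕ) (m k : MM N) (w : Py n N pos) :
    phiDeriv n pos kappa i m (phiDeriv n pos kappa j k w)
      = phiDeriv n pos kappa j k (phiDeriv n pos kappa i m w) := by
  have h : ⁅phiDeriv n pos kappa i m, phiDeriv n pos kappa j k⁆ = 0 := by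
    refine MvPolynomial.derivation_ext fun v => ?_
    rw [Derivation.commutator_apply]
    simp [phiDeriv, MvPolynomial.mkDerivation_X]
  have := congrArg (fun D => D w) h
  rw [Derivation.commutator_apply] at this
  exact sub_eq_zero.1 this

lemma phiDeriv_phiMul (i : ℕ) {j : ℕ} (hj : 1 ≤ j ∧ j ≤ n) (m k : MM N) :
    phiDeriv n pos kappa i m (phiMul n pos lam j k)
      = MvPolynomial.C (theta pos (-k) * cnum kappa m (-k) * derivCoeff pos i m j) := by
  rw [phiMul, map_sub, phiDeriv, MvPolynomial.derivation_C, sub_zero, theta]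
  by_cases h : pos (-k)
  · rw [dif_pos ⟨hj, h⟩, MvPolynomial.mkDerivation_X, if_pos h, one_mul]
    rfl
  · rw [dif_neg fun e => h e.2, map_zero, if_neg h, zero_mul, zero_mul, map_zero]

lemma Acar_eq (hn : 2 ≤ n) {i j : ℕ} (hi : i ≤ n) (hj : j ≤ n) :
    Acar n i j = (if i = j then 2 else 0) - (if i = (if j = n then 0 else j + 1) then 1 else 0)
      - (if i = (if j = 0 then n else j - 1) then 1 else 0) := by
  have key : ∀ a ≤ n, (a + 1) % (n + 1) = if a = n then 0 else a + 1 := fun a ha => by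
    split_ifs with h
    · simp [h]
    · exact Nat.mod_eq_of_lt (by omega)
  have hi' : i % (n + 1) = i := Nat.mod_eq_of_lt (by omega)
  have hj' : j % (n + 1) = j := Nat.mod_eq_of_lt (by omega)
  unfold Acar
  rw [key i hi, key j hj, hi', hj']
  split_ifs <;> first | omega | norm_num

lemma Acar_symm (i j : ℕ) : Acar n i j = Acar n j i := by
  unfold Acar
  simp only [eq_comm (a := i), or_comm]

lemma sum_Acar (hn : 2 ≤ n) {j : ℕ} (hj : j ≤ n) :
    ∑ r ∈ Finset.Icc 1 n, Acar n r j = -Acar n 0 j := by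
  have h0 : ∑ r ∈ Finset.range (n + 1), Acar n r j = 0 := by
    rw [Finset.sum_congr rfl fun r hr =>
      Acar_eq hn (Nat.lt_succ_iff.1 (Finset.mem_range.1 hr)) hj]
    rw [Finset.sum_sub_distrib, Finset.sum_sub_distrib]
    simp only [Finset.sum_ite_eq', Finset.mem_range]
    split_ifs <;> first | omega | norm_num
  rw [Finset.range_eq_Ico, Finset.sum_eq_sum_Ico_succ_bot (by omega)] at h0
  exact eq_neg_of_add_eq_zero_right h0

lemma cnum_neg (m k : MM N) :
    cnum kappa m (-k) = ∑ p : Fin (N + 1), (m p : ℂ) * kappa (-m - k) p := by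
  simp [cnum, sub_eq_add_neg]

lemma cnum_neg_swap (hE1 : ∀ m : MM N, ∑ p : Fin (N + 1), (m p : ℂ) * kappa m p = 0)
    (m k : MM N) : cnum kappa k (-m) = -cnum kappa m (-k) := by
  have h := hE1 (-m - k)
  have e : -k - m = -m - k := by abel
  rw [cnum_neg, cnum_neg, e, eq_neg_iff_add_eq_zero, ← neg_eq_zero, ← Finset.sum_add_distrib,
    ← Finset.sum_neg_distrib, ← h]
  refine Finset.sum_congr rfl fun p _ => ?_
  simp only [Pi.sub_apply, Pi.neg_apply]
  push_cast
  ring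

lemma Acar_eq_of_pos (hn : 2 ≤ n) {i j : ℕ} (hi : 1 ≤ i ∧ i ≤ n) (hj : 1 ≤ j ∧ j ≤ n) :
    Acar n i j = (if i = j then 2 else 0) - (if i = j + 1 then 1 else 0)
      - (if j = i + 1 then 1 else 0) := by
  rw [Acar_eq hn hi.2 hj.2]
  congr 2
  · split_ifs <;> first | omega | rfl
  · exact propext (by split_ifs <;> omega)

lemma derivCoeff_of_pos (hn : 2 ≤ n) {i j : ℕ} (hi : 1 ≤ i ∧ i ≤ n) (hj : 1 ≤ j ∧ j ≤ n)
    {m : MM N} (hm : pos m) (hm' : ¬ pos (-m)) : derivCoeff pos i m j = -Acar n i j := by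
  rw [derivCoeff, theta, theta, if_neg hm', if_pos hm, Acar_eq_of_pos hn hi hj]
  split_ifs <;> first | omega | norm_num

lemma derivCoeff_of_neg {i j : ℕ} (hj : 1 ≤ j)
    {m : MM N} (hm : pos (-m)) (hm' : ¬ pos m) :
    derivCoeff pos i m j = (if i = j + 1 then 1 else 0) - (if i = j then 1 else 0) := by
  rw [derivCoeff, theta, theta, if_neg hm', if_pos hm]
  split_ifs <;> first | omega | norm_num

lemma lie_coeff_eq (hn : 2 ≤ n)
    (htri : ∀ a : MM N, pos a ∨ a = 0 ∨ pos (-a))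
    (hdisj : ∀ a : MM N, pos a → ¬ pos (-a))
    (hE1 : ∀ m : MM N, ∑ p : Fin (N + 1), (m p : ℂ) * kappa m p = 0)
    (hE2 : ∀ m k : MM N, pos m → pos k →
      ∑ p : Fin (N + 1), (m p : ℂ) * kappa (-m - k) p = 0)
    {i j : ℕ} (hi : 1 ≤ i ∧ i ≤ n) (hj : 1 ≤ j ∧ j ≤ n) (m k : MM N) :
    theta pos (-k) * cnum kappa m (-k) * derivCoeff pos i m j
      - theta pos (-m) * cnum kappa k (-m) * derivCoeff pos j k i
      = -Acar n i j * cnum kappa m (-k) := by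
  have hz : ∀ a, cnum kappa 0 a = 0 := by simp [cnum]
  rw [cnum_neg_swap hE1 m k]
  rcases htri m with hm | rfl | hm
  · have hm' := hdisj m hm
    rcases htri k with hk | rfl | hk
    · rw [cnum_neg m k, hE2 m k hm hk]
      ring
    · have h := cnum_neg_swap hE1 m 0
      rw [hz] at h
      rw [zero_eq_neg.1 h]
      ring
    · have hk' : ¬ pos k := fun h => hdisj k h hk
      rw [derivCoeff_of_pos hn hi hj hm hm', theta, theta, if_pos hk, if_neg hm']
      ring
  · rw [hz]
    ring
  · have hm' : ¬ pos m := fun h => hdisj m h hm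
    rcases htri k with hk | rfl | hk
    · have hk' := hdisj k hk
      rw [derivCoeff_of_pos hn hj hi hk hk', theta, theta, if_pos hm, if_neg hk', Acar_symm]
      ring
    · have h := cnum_neg_swap hE1 m 0
      rw [hz] at h
      rw [zero_eq_neg.1 h]
      ring
    · have hk' : ¬ pos k := fun h => hdisj k h hk
      rw [derivCoeff_of_neg hj.1 hm hm', derivCoeff_of_neg hi.1 hk hk', theta, theta, if_pos hm,
        if_pos hk, Acar_eq_of_pos hn hi hj]
      split_ifs <;> first | omega | ring

lemma lie_phiEnd (hn : 2 ≤ n)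
    (htri : ∀ a : MM N, pos a ∨ a = 0 ∨ pos (-a))
    (hdisj : ∀ a : MM N, pos a → ¬ pos (-a))
    (hE1 : ∀ m : MM N, ∑ p : Fin (N + 1), (m p : ℂ) * kappa m p = 0)
    (hE2 : ∀ m k : MM N, pos m → pos k →
      ∑ p : Fin (N + 1), (m p : ℂ) * kappa (-m - k) p = 0)
    {i j : ℕ} (hi : 1 ≤ i ∧ i ≤ n) (hj : 1 ≤ j ∧ j ≤ n) (m k : MM N) :
    ⁅phiEnd n pos kappa lam i m, phiEnd n pos kappa lam j k⁆
      = (-Acar n i j * cnum kappa m (-k)) • (1 : Module.End ℂ (Py n N pos)) := by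
  refine LinearMap.ext fun w => ?_
  have h1 := phiDeriv_phiMul (pos := pos) (kappa := kappa) (lam := lam) i hj m k
  have h2 := phiDeriv_phiMul (pos := pos) (kappa := kappa) (lam := lam) j hi k m
  have h3 := phiDeriv_comm (kappa := kappa) i j m k w
  rw [← lie_coeff_eq hn htri hdisj hE1 hE2 hi hj m k, Ring.lie_def]
  simp only [phiEnd, LinearMap.sub_apply, Module.End.mul_apply, LinearMap.add_apply,
    LinearMap.mulLeft_apply, Derivation.coeFn_coe, map_add, Derivation.leibniz, smul_eq_mul,
    LinearMap.smul_apply, Module.End.one_apply, h1, h2, h3, MvPolynomial.smul_eq_C_mul,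
    MvPolynomial.C_sub]
  ring

/-- `PhiHat` as a linear endomorphism. -/
def phiHatEnd (n : ℕ) (pos : MM N → Prop) (kappa : MM N → Fin (N + 1) → ℂ) (lam : ℕ → ℂ)
    (i : ℕ) (m : MM N) : Module.End ℂ (Py n N pos) :=
  if i = 0 then -∑ r ∈ Finset.Icc 1 n, phiEnd n pos kappa lam r m
  else phiEnd n pos kappa lam i m

lemma coe_phiHatEnd (i : ℕ) (m : MM N) :
    ⇑(phiHatEnd n pos kappa lam i m) = PhiHat n N pos kappa lam i m := by
  unfold phiHatEnd PhiHat
  split_ifs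
  · ext1 w
    simp [coe_phiEnd, LinearMap.sum_apply]
  · exact coe_phiEnd i m

/-- A commutator whose values on the nonzero indices are given by the affine Cartan matrix
is given by that matrix on all indices, once index `0` is set to minus the sum of the others. -/
lemma lie_eq_of_eq_neg_sum {L : Type*} [Ring L] [Module ℂ L] (hn : 2 ≤ n) (f g : ℕ → L)
    (z : L) (hf : f 0 = -∑ r ∈ Finset.Icc 1 n, f r) (hg : g 0 = -∑ r ∈ Finset.Icc 1 n, g r)
    (h : ∀ i j, (1 ≤ i ∧ i ≤ n) → (1 ≤ j ∧ j ≤ n) → ⁅f i, g j⁆ = Acar n i j • z)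
    {i j : ℕ} (hi : i ≤ n) (hj : j ≤ n) : ⁅f i, g j⁆ = Acar n i j • z := by
  have lie_neg_sum : ∀ x : L, ⁅x, -∑ r ∈ Finset.Icc 1 n, g r⁆
      = -∑ r ∈ Finset.Icc 1 n, ⁅x, g r⁆ := fun x => by
    simp only [Ring.lie_def, Finset.sum_sub_distrib, Finset.mul_sum, Finset.sum_mul, mul_neg,
      neg_mul]
    abel
  have neg_sum_lie : ∀ x : L, ⁅-∑ r ∈ Finset.Icc 1 n, f r, x⁆
      = -∑ r ∈ Finset.Icc 1 n, ⁅f r, x⁆ := fun x => by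
    simp only [Ring.lie_def, Finset.sum_sub_distrib, Finset.mul_sum, Finset.sum_mul, mul_neg,
      neg_mul]
    abel
  have hstep : ∀ i, (1 ≤ i ∧ i ≤ n) → ∀ j ≤ n, ⁅f i, g j⁆ = Acar n i j • z := by
    intro i hi j hj
    rcases Nat.eq_zero_or_pos j with rfl | hj0
    · rw [hg, lie_neg_sum, Finset.sum_congr rfl fun r hr =>
        h i r hi (Finset.mem_Icc.1 hr), ← Finset.sum_smul,
        Finset.sum_congr rfl fun r _ => Acar_symm i r, sum_Acar hn hi.2, Acar_symm, neg_smul,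
        neg_neg]
    · exact h i j hi ⟨hj0, hj⟩
  rcases Nat.eq_zero_or_pos i with rfl | hi0
  · rw [hf, neg_sum_lie, Finset.sum_congr rfl fun r hr =>
      hstep r (Finset.mem_Icc.1 hr) j hj, ← Finset.sum_smul, sum_Acar hn hj, neg_smul, neg_neg]
  · exact hstep i ⟨hi0, hi⟩ j hj

end Helpers

/-- Under the hypotheses (E1), (E2), with `Φ(b_0(m)) := -Σ_{i=1}^n Φ(b_i(m))`,
the Heisenberg relation extends to the full affine index set: for all
`0 ≤ i, j ≤ n`,
`[Φ(b_i(m)), Φ(b_j(n))] = -Â_{ij} (Σ_{p=0}^N m_p κ_{-m-n,p}) · id`. -/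
theorem stmt4 (n N : ℕ) (hn : 2 ≤ n) (hN : 1 ≤ N)
    (pos : MM N → Prop)
    (hadd : ∀ a b : MM N, pos a → pos b → pos (a + b))
    (htri : ∀ a : MM N, pos a ∨ a = 0 ∨ pos (-a))
    (hzero : ¬ pos (0 : MM N))
    (hdisj : ∀ a : MM N, pos a → ¬ pos (-a))
    (kappa : MM N → Fin (N + 1) → ℂ) (lam : ℕ → ℂ)
    (hE1 : ∀ m : MM N, ∑ p : Fin (N + 1), (m p : ℂ) * kappa m p = 0)
    (hE2 : ∀ m k : MM N, pos m → pos k →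
      ∑ p : Fin (N + 1), (m p : ℂ) * kappa (-m - k) p = 0) :
    ∀ i j : ℕ, i ≤ n → j ≤ n → ∀ m mm : MM N,
      comm (PhiHat n N pos kappa lam i m) (PhiHat n N pos kappa lam j mm)
        = (-(Acar n i j) * ∑ p : Fin (N + 1), (m p : ℂ) * kappa (-m - mm) p)
            • (id : Py n N pos → Py n N pos) := by
  intro i j hi hj m k
  have hsum : ∀ a : MM N, phiHatEnd n pos kappa lam 0 a
      = -∑ r ∈ Finset.Icc 1 n, phiHatEnd n pos kappa lam r a := fun a => by
    rw [phiHatEnd, if_pos rfl]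
    refine congrArg _ (Finset.sum_congr rfl fun r hr => ?_)
    rw [phiHatEnd, if_neg (Nat.one_le_iff_ne_zero.1 (Finset.mem_Icc.1 hr).1)]
  have key := lie_eq_of_eq_neg_sum hn (phiHatEnd n pos kappa lam · m)
    (phiHatEnd n pos kappa lam · k)
    ((-cnum kappa m (-k)) • (1 : Module.End ℂ (Py n N pos))) (hsum m) (hsum k)
    (fun a b ha hb => by
      simp only [phiHatEnd, if_neg (Nat.one_le_iff_ne_zero.1 ha.1),
        if_neg (Nat.one_le_iff_ne_zero.1 hb.1)]
      rw [lie_phiEnd hn htri hdisj hE1 hE2 ha hb, smul_smul, mul_neg, neg_mul]) hi hj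
  rw [smul_smul, mul_neg, ← neg_mul, cnum_neg] at key
  rw [← coe_phiHatEnd, ← coe_phiHatEnd]
  exact congrArg DFunLike.coe key

end Stmt4
end
end

section
/- For all indices 1 ≤ a < b ≤ n+1 and 1 ≤ j < s ≤ n, and all u, v ∈ ℤ^{N+1}, the modes of the normally ordered products satisfy [(a_{ab} a*_{ab})_u, (a_{j,s+1} a*_{j,s})_v] = δ_{aj} (δ_{bs} − δ_{b,s+1}) (a_{j,s+1} a*_{j,s})_{u+v} as operators on ℂ[x]. -/
noncomputable section

namespace Stmt6

/-- Multi-indices `m ∈ ℤ^{N+1}`. -/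
abbrev MM (N : ℕ) := Fin (N + 1) → ℤ

/-- Index type for the polynomial variables `x_{ij}(m)`, `1 ≤ i < j ≤ n+1`,
`m ∈ ℤ^{N+1}`. -/
def XIdx (n N : ℕ) := {ij : ℕ × ℕ // 1 ≤ ij.1 ∧ ij.1 < ij.2 ∧ ij.2 ≤ n + 1} × MM N

/-- The polynomial ring `ℂ[x]`. -/
abbrev Px (n N : ℕ) := MvPolynomial (XIdx n N) ℂ

/-- `a_{ij,m}`: multiplication by `-x_{ij}(m)` (and `0` for out-of-range indices). -/
def aop (n N : ℕ) (i j : ℕ) (m : MM N) : Px n N → Px n N := fun w =>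
  if h : 1 ≤ i ∧ i < j ∧ j ≤ n + 1 then
    -(MvPolynomial.X ((⟨(i, j), h⟩, m) : XIdx n N) : Px n N) * w
  else 0

/-- `a*_{ij,m}`: the partial derivative `∂/∂x_{ij}(-m)` (and `0` for out-of-range
indices). -/
def astar (n N : ℕ) (i j : ℕ) (m : MM N) : Px n N → Px n N := fun w =>
  if h : 1 ≤ i ∧ i < j ∧ j ≤ n + 1 then
    MvPolynomial.pderiv ((⟨(i, j), h⟩, -m) : XIdx n N) w
  else 0

/-- `(κ·D a*_{ij})_v := Σ_{q ∈ ℤ^{N+1}} Σ_{p=0}^N κ_{q-v,p}(-q_p) a*_{ij,q}`,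
a pointwise locally finite sum of operators. -/
def kD (n N : ℕ) (kappa : MM N → Fin (N + 1) → ℂ) (i j : ℕ) (v : MM N) :
    Px n N → Px n N := fun w =>
  ∑ᶠ q : MM N,
    (∑ p : Fin (N + 1), kappa (q - v) p * (-(q p : ℂ))) • astar n N i j q w

/-- The `m`-th mode of the product of two families of operators:
`(XY)_m := Σ_{k+l=m} X_k Y_l` (pointwise locally finite sum). -/
def fmul (n N : ℕ) (X Y : MM N → Px n N → Px n N) : MM N → Px n N → Px n N :=
  fun m w => ∑ᶠ k : MM N, X k (Y (m - k) w)

/-- The commutator of two operators. -/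
def comm {V : Type*} [AddCommGroup V] (f g : V → V) : V → V :=
  fun w => f (g w) - g (f w)

/-- Pairs `(i, j)` with `1 ≤ i < j ≤ n + 1`. -/
abbrev PIdx (n : ℕ) := {ij : ℕ × ℕ // 1 ≤ ij.1 ∧ ij.1 < ij.2 ∧ ij.2 ≤ n + 1}

/-- The index of the variable `x_p(m)`. -/
def xidx {n N : ℕ} (p : PIdx n) (m : MM N) : XIdx n N := (p, m)

/-- The variable `x_p(m)`. -/
abbrev xvar {n N : ℕ} (p : PIdx n) (m : MM N) : Px n N := MvPolynomial.X (xidx p m)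

open Classical in
/-- The derivation of `ℂ[x]` sending `x_q(t)` to `-x_p(t + m)` and every other variable to `0`. -/
def shiftDer {n N : ℕ} (p q : PIdx n) (m : MM N) : Derivation ℂ (Px n N) (Px n N) :=
  MvPolynomial.mkDerivation ℂ fun r : XIdx n N =>
    if r.1 = q then -xvar p (r.2 + m) else 0

open Classical in
theorem shiftDer_xvar {n N : ℕ} (p q r : PIdx n) (m t : MM N) :
    shiftDer p q m (xvar r t) = if r = q then -xvar p (t + m) else 0 :=
  MvPolynomial.mkDerivation_X _ _ _

theorem finite_support_mul_pderiv {n N : ℕ} (p q : PIdx n) (m : MM N) (w : Px n N) :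
    (Function.support fun k : MM N =>
      -xvar p k * MvPolynomial.pderiv (xidx q (-(m - k))) w).Finite := by
  classical
  have hinj : Function.Injective fun k : MM N => xidx q (-(m - k)) := by
    intro k l h
    have h2 : -(m - k) = -(m - l) := congrArg Prod.snd h
    simpa using h2
  refine (w.vars.finite_toSet.preimage hinj.injOn).subset fun k hk => ?_
  by_contra hmem
  have h0 : MvPolynomial.pderiv (xidx q (-(m - k))) w = 0 :=
    MvPolynomial.pderiv_eq_zero_of_notMem_vars hmem
  exact hk (by simp only [h0, mul_zero])

theorem finsum_mul_pderiv {n N : ℕ} (p q : PIdx n) (m : MM N) (w : Px n N) :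
    ∑ᶠ k : MM N, -xvar p k * MvPolynomial.pderiv (xidx q (-(m - k))) w
      = shiftDer p q m w := by
  classical
  induction w using MvPolynomial.induction_on with
  | C c => simp [shiftDer]
  | add f g hf hg =>
    rw [map_add, ← hf, ← hg, ← finsum_add_distrib (finite_support_mul_pderiv p q m f)
      (finite_support_mul_pderiv p q m g)]
    simp only [map_add, mul_add]
  | mul_X f r hf =>
    obtain ⟨r, t⟩ := r
    have hX : ∑ᶠ k : MM N, -xvar p k * MvPolynomial.pderiv (xidx q (-(m - k))) (xvar r t)
        = shiftDer p q m (xvar r t) := by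
      rw [shiftDer_xvar, finsum_eq_single _ (t + m)]
      · have hk : -(m - (t + m)) = t := by abel
        rw [hk]
        split_ifs with h
        · subst h
          rw [MvPolynomial.pderiv_X_self, mul_one]
        · rw [MvPolynomial.pderiv_X_of_ne, mul_zero]
          exact fun e => h (congrArg Prod.fst e)
      · intro k hk
        rw [MvPolynomial.pderiv_X_of_ne, mul_zero]
        intro e
        apply hk
        have e2 : t = -(m - k) := congrArg Prod.snd e
        rw [e2]
        abel
    change _ = shiftDer p q m (f * xvar r t)
    rw [Derivation.leibniz, ← hf, ← hX, smul_eq_mul, smul_eq_mul,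
      mul_finsum' _ _ (finite_support_mul_pderiv p q m _),
      mul_finsum' _ _ (finite_support_mul_pderiv p q m _), ← finsum_add_distrib]
    · refine finsum_congr fun k => ?_
      change -xvar p k * MvPolynomial.pderiv (xidx q (-(m - k))) (f * xvar r t) = _
      rw [Derivation.leibniz, smul_eq_mul, smul_eq_mul]
      ring
    · exact (finite_support_mul_pderiv p q m _).subset
        (Function.support_subset_iff'.2 fun k hk => by rw [Function.notMem_support.1 hk, mul_zero])
    · exact (finite_support_mul_pderiv p q m _).subset
        (Function.support_subset_iff'.2 fun k hk => by rw [Function.notMem_support.1 hk, mul_zero])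

theorem aop_eq {n N : ℕ} (p : PIdx n) (m : MM N) (w : Px n N) :
    aop n N p.1.1 p.1.2 m w = -xvar p m * w :=
  dif_pos p.2

theorem astar_eq {n N : ℕ} (q : PIdx n) (m : MM N) (w : Px n N) :
    astar n N q.1.1 q.1.2 m w = MvPolynomial.pderiv (xidx q (-m)) w :=
  dif_pos q.2

theorem fmul_aop_astar {n N : ℕ} (p q : PIdx n) (m : MM N) :
    fmul n N (aop n N p.1.1 p.1.2) (astar n N q.1.1 q.1.2) m = shiftDer p q m := by
  funext w
  rw [← finsum_mul_pderiv]
  refine finsum_congr fun k => ?_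
  rw [astar_eq, aop_eq]

open Classical in
theorem lie_shiftDer {n N : ℕ} (r p q : PIdx n) (hpq : p ≠ q) (u v : MM N) :
    ⁅shiftDer r r u, shiftDer p q v⁆
      = ((if r = q then (1 : ℂ) else 0) - (if r = p then (1 : ℂ) else 0))
          • shiftDer p q (u + v) := by
  refine MvPolynomial.derivation_ext fun i => ?_
  obtain ⟨i, t⟩ := i
  change ⁅shiftDer r r u, shiftDer p q v⁆ (xvar i t) =
    ((if r = q then (1 : ℂ) else 0) - (if r = p then (1 : ℂ) else 0))
      • shiftDer p q (u + v) (xvar i t)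
  have h1 : t + v + u = t + (u + v) := by abel
  have h2 : t + u + v = t + (u + v) := by abel
  rw [Derivation.commutator_apply]
  simp only [shiftDer_xvar]
  have hqp := hpq.symm
  by_cases hiq : i = q <;> by_cases hir : i = r <;> by_cases hrp : r = p <;>
    subst_vars <;> simp_all [shiftDer_xvar, eq_comm]

/-- For all `1 ≤ a < b ≤ n+1`, `1 ≤ j < s ≤ n` and `u, v ∈ ℤ^{N+1}`,
`[(a_{ab} a*_{ab})_u, (a_{j,s+1} a*_{j,s})_v]
  = δ_{aj} (δ_{bs} - δ_{b,s+1}) (a_{j,s+1} a*_{j,s})_{u+v}` on `ℂ[x]`. -/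
theorem stmt6 (n N : ℕ) (hn : 2 ≤ n) (hN : 1 ≤ N)
    (a b j s : ℕ) (ha : 1 ≤ a) (hab : a < b) (hb : b ≤ n + 1)
    (hj : 1 ≤ j) (hjs : j < s) (hs : s ≤ n) (u v : MM N) :
    comm (fmul n N (aop n N a b) (astar n N a b) u)
        (fmul n N (aop n N j (s + 1)) (astar n N j s) v)
      = (((if a = j then (1 : ℂ) else 0) *
            ((if b = s then (1 : ℂ) else 0) - (if b = s + 1 then (1 : ℂ) else 0)))
          • fmul n N (aop n N j (s + 1)) (astar n N j s) (u + v)) := by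
  have hp : 1 ≤ j ∧ j < s + 1 ∧ s + 1 ≤ n + 1 := by omega
  have hq : 1 ≤ j ∧ j < s ∧ s ≤ n + 1 := by omega
  let r : PIdx n := ⟨(a, b), ha, hab, hb⟩
  let p : PIdx n := ⟨(j, s + 1), hp⟩
  let q : PIdx n := ⟨(j, s), hq⟩
  have hpq : p ≠ q := by simp [p, q]
  have hA := fmul_aop_astar r r u
  have hE := fmul_aop_astar p q v
  have hF := fmul_aop_astar p q (u + v)
  simp only [r, p, q] at hA hE hF
  rw [hA, hE, hF]
  funext w
  have h := DFunLike.congr_fun (lie_shiftDer r p q hpq u v) w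
  rw [Derivation.commutator_apply] at h
  refine h.trans ?_
  change (_ : ℂ) • shiftDer p q (u + v) w = (_ : ℂ) • shiftDer p q (u + v) w
  congr 1
  simp only [r, p, q, Subtype.mk.injEq, Prod.mk.injEq]
  by_cases haj : a = j <;> simp [haj]

end Stmt6
end
end

section
/- For all 1 ≤ i < j ≤ n+1, 1 ≤ a < b ≤ n+1 and all u, v ∈ ℤ^{N+1}, [(a_{ij} a*_{ij})_u, (κ·D a*_{ab})_v] = δ_{ia} δ_{jb} ( (κ·D a*_{ij})_{u+v} + Σ_{p=0}^N u_p Σ_{r∈ℤ^{N+1}} κ_{r−u−v,p} a*_{ij,r} ) as operators on ℂ[x]. -/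
noncomputable section

namespace Stmt7

/-- Multi-indices `m ∈ ℤ^{N+1}`. -/
abbrev MM (N : ℕ) := Fin (N + 1) → ℤ

/-- Index type for the polynomial variables `x_{ij}(m)`, `1 ≤ i < j ≤ n+1`,
`m ∈ ℤ^{N+1}`. -/
def XIdx (n N : ℕ) := {ij : ℕ × ℕ // 1 ≤ ij.1 ∧ ij.1 < ij.2 ∧ ij.2 ≤ n + 1} × MM N

/-- The polynomial ring `ℂ[x]`. -/
abbrev Px (n N : ℕ) := MvPolynomial (XIdx n N) ℂ

/-- `a_{ij,m}`: multiplication by `-x_{ij}(m)` (and `0` for out-of-range indices). -/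
def aop (n N : ℕ) (i j : ℕ) (m : MM N) : Px n N → Px n N := fun w =>
  if h : 1 ≤ i ∧ i < j ∧ j ≤ n + 1 then
    -(MvPolynomial.X ((⟨(i, j), h⟩, m) : XIdx n N) : Px n N) * w
  else 0

/-- `a*_{ij,m}`: the partial derivative `∂/∂x_{ij}(-m)` (and `0` for out-of-range
indices). -/
def astar (n N : ℕ) (i j : ℕ) (m : MM N) : Px n N → Px n N := fun w =>
  if h : 1 ≤ i ∧ i < j ∧ j ≤ n + 1 then
    MvPolynomial.pderiv ((⟨(i, j), h⟩, -m) : XIdx n N) w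
  else 0

/-- `(κ·D a*_{ij})_v := Σ_{q ∈ ℤ^{N+1}} Σ_{p=0}^N κ_{q-v,p}(-q_p) a*_{ij,q}`,
a pointwise locally finite sum of operators. -/
def kD (n N : ℕ) (kappa : MM N → Fin (N + 1) → ℂ) (i j : ℕ) (v : MM N) :
    Px n N → Px n N := fun w =>
  ∑ᶠ q : MM N,
    (∑ p : Fin (N + 1), kappa (q - v) p * (-(q p : ℂ))) • astar n N i j q w

/-- The `m`-th mode of the product of two families of operators:
`(XY)_m := Σ_{k+l=m} X_k Y_l` (pointwise locally finite sum). -/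
def fmul (n N : ℕ) (X Y : MM N → Px n N → Px n N) : MM N → Px n N → Px n N :=
  fun m w => ∑ᶠ k : MM N, X k (Y (m - k) w)

/-- The commutator of two operators. -/
def comm {V : Type*} [AddCommGroup V] (f g : V → V) : V → V :=
  fun w => f (g w) - g (f w)

open MvPolynomial

theorem derivation_sum_apply {R A M ι : Type*} [CommSemiring R] [CommSemiring A]
    [AddCommMonoid M] [Algebra R A] [Module A M] [Module R M] (s : Finset ι)
    (D : ι → Derivation R A M) (w : A) : (∑ i ∈ s, D i) w = ∑ i ∈ s, D i w := by
  have h := congrFun (map_sum (Derivation.coeFnAddMonoidHom (R := R) (A := A) (M := M)) D s) w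
  rw [Finset.sum_apply] at h
  exact h

/-- A derivation of `R[x]` given by its values on the variables is the sum of these values times the
partial derivatives. -/
theorem mkDerivation_eq_finsum {σ R : Type*} [CommRing R] (f : σ → MvPolynomial σ R)
    (w : MvPolynomial σ R) : mkDerivation R f w = ∑ᶠ s, f s * pderiv s w := by
  classical
  have hD : mkDerivation R f w = (∑ s ∈ w.vars, f s • pderiv (R := R) s) w := by
    refine derivation_eq_of_forall_mem_vars fun t ht => ?_
    simp [derivation_sum_apply, pderiv_X, Pi.single_apply, ht, mkDerivation_X]
  rw [hD, finsum_eq_sum_of_support_subset (s := w.vars)]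
  · simp [derivation_sum_apply]
  · intro s hs
    by_contra h
    exact hs (by simp [pderiv_eq_zero_of_notMem_vars (by simpa using h)])

/-- The pairs `(i, j)` with `1 ≤ i < j ≤ n+1`. -/
abbrev Root (n : ℕ) := {ij : ℕ × ℕ // 1 ≤ ij.1 ∧ ij.1 < ij.2 ∧ ij.2 ≤ n + 1}

/-- The index of the variable `x_{ij}(m)`. -/
def XIdx.mk {n N : ℕ} (ij : Root n) (m : MM N) : XIdx n N := (ij, m)

/-- The pair `(i, j)` of the variable `x_{ij}(m)`. -/
def XIdx.root {n N : ℕ} (s : XIdx n N) : Root n := Prod.fst s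

/-- The multi-index `m` of the variable `x_{ij}(m)`. -/
def XIdx.mode {n N : ℕ} (s : XIdx n N) : MM N := Prod.snd s

@[simp] theorem XIdx.root_mk {n N : ℕ} (ij : Root n) (m : MM N) : (XIdx.mk ij m).root = ij := rfl

@[simp] theorem XIdx.mode_mk {n N : ℕ} (ij : Root n) (m : MM N) : (XIdx.mk ij m).mode = m := rfl

theorem XIdx.mk_root_mode {n N : ℕ} (s : XIdx n N) : XIdx.mk s.root s.mode = s := rfl

theorem XIdx.mk_injective {n N : ℕ} (ij : Root n) :
    Function.Injective (XIdx.mk ij : MM N → XIdx n N) :=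
  fun _ _ h => congrArg XIdx.mode h

theorem XIdx.mem_range_mk {n N : ℕ} (ij : Root n) (s : XIdx n N) :
    s ∈ Set.range (XIdx.mk ij : MM N → XIdx n N) ↔ s.root = ij :=
  ⟨fun ⟨_, h⟩ => h ▸ rfl, fun h => ⟨s.mode, h ▸ s.mk_root_mode⟩⟩

theorem aop_apply {n N i j : ℕ} (h : 1 ≤ i ∧ i < j ∧ j ≤ n + 1) (m : MM N) (w : Px n N) :
    aop n N i j m w = -X (XIdx.mk ⟨(i, j), h⟩ m) * w :=
  dif_pos h

theorem astar_apply {n N i j : ℕ} (h : 1 ≤ i ∧ i < j ∧ j ≤ n + 1) (m : MM N) (w : Px n N) :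
    astar n N i j m w = pderiv (XIdx.mk ⟨(i, j), h⟩ (-m)) w :=
  dif_pos h

/-- The vector field `Σ_m c(m) ∂/∂x_{ij}(m)` as a derivation of `ℂ[x]`. -/
def vectorField {n N : ℕ} (ij : Root n) (c : MM N → Px n N) :
    Derivation ℂ (Px n N) (Px n N) :=
  mkDerivation ℂ fun s : XIdx n N => if s.root = ij then c s.mode else 0

theorem vectorField_X {n N : ℕ} (ij : Root n) (c : MM N → Px n N) (s : XIdx n N) :
    vectorField ij c (X s) = if s.root = ij then c s.mode else 0 :=
  mkDerivation_X _ _ _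

theorem vectorField_eq_finsum {n N : ℕ} (ij : Root n) (c : MM N → Px n N) (e : MM N ≃ MM N)
    (w : Px n N) :
    vectorField ij c w = ∑ᶠ k, c (e k) * pderiv (XIdx.mk ij (e k)) w := by
  rw [finsum_comp_equiv e (f := fun m => c m * pderiv (XIdx.mk ij m) w), vectorField,
    mkDerivation_eq_finsum]
  have hr := finsum_mem_range (f := fun s : XIdx n N => c s.mode * pderiv s w)
    (XIdx.mk_injective ij)
  simp only [XIdx.mode_mk] at hr
  rw [← hr]
  refine finsum_congr fun s => ?_
  simp only [XIdx.mem_range_mk]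
  by_cases hs : s.root = ij <;> simp [hs]

theorem kD_eq_vectorField {n N : ℕ} (kappa : MM N → Fin (N + 1) → ℂ) {i j : ℕ}
    (h : 1 ≤ i ∧ i < j ∧ j ≤ n + 1) (v : MM N) (w : Px n N) :
    kD n N kappa i j v w =
      vectorField ⟨(i, j), h⟩ (fun m => C (∑ p, kappa (-m - v) p * (m p : ℂ))) w := by
  rw [vectorField_eq_finsum _ _ (Equiv.neg _)]
  refine finsum_congr fun q => ?_
  rw [astar_apply h, smul_eq_C_mul]
  simp only [Equiv.neg_apply, neg_neg, Pi.neg_apply, Int.cast_neg]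

theorem fmul_eq_vectorField {n N i j : ℕ} (h : 1 ≤ i ∧ i < j ∧ j ≤ n + 1) (u : MM N)
    (w : Px n N) :
    fmul n N (aop n N i j) (astar n N i j) u w =
      vectorField ⟨(i, j), h⟩ (fun m => -X (XIdx.mk ⟨(i, j), h⟩ (m + u))) w := by
  rw [vectorField_eq_finsum _ _ (Equiv.subRight u)]
  refine finsum_congr fun q => ?_
  rw [astar_apply h, aop_apply h]
  simp only [Equiv.subRight_apply, neg_sub, sub_add_cancel]

theorem finsum_smul_astar_eq_vectorField {n N i j : ℕ} (h : 1 ≤ i ∧ i < j ∧ j ≤ n + 1)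
    (c : MM N → ℂ) (w : Px n N) :
    ∑ᶠ r, c r • astar n N i j r w = vectorField ⟨(i, j), h⟩ (fun m => C (c (-m))) w := by
  rw [vectorField_eq_finsum _ _ (Equiv.neg _)]
  refine finsum_congr fun q => ?_
  rw [astar_apply h, smul_eq_C_mul]
  simp only [Equiv.neg_apply, neg_neg]

/-- The commutator of the vector fields of `(a_{ij} a*_{ij})_u` and `(κ·D a*_{ab})_v`. -/
theorem lie_vectorField {n N : ℕ} (kappa : MM N → Fin (N + 1) → ℂ) (ij ab : Root n)
    (u v : MM N) :
    ⁅vectorField ij (fun m => -X (XIdx.mk ij (m + u))),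
        vectorField ab (fun m => C (∑ p, kappa (-m - v) p * (m p : ℂ)))⁆ =
      (if ij = ab then (1 : ℂ) else 0) •
        (vectorField ij (fun m => C (∑ p, kappa (-m - (u + v)) p * (m p : ℂ))) +
          ∑ p, (u p : ℂ) • vectorField ij (fun m => C (kappa (-m - u - v) p))) := by
  refine derivation_ext fun s => ?_
  have hc : vectorField ij (fun m => -X (XIdx.mk ij (m + u)))
      (vectorField ab (fun m => C (∑ p, kappa (-m - v) p * (m p : ℂ))) (X s)) = 0 := by
    rw [vectorField_X]
    split_ifs
    · exact derivation_C _ _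
    · exact map_zero _
  rw [Derivation.commutator_apply, hc]
  simp only [Derivation.smul_apply, Derivation.add_apply, derivation_sum_apply, vectorField_X]
  by_cases hs : s.root = ij
  · simp only [hs, if_true, map_neg, vectorField_X, XIdx.root_mk, XIdx.mode_mk]
    by_cases hab : ij = ab
    · simp only [hab, if_true, zero_sub, neg_neg, one_smul, smul_eq_C_mul, ← C_mul, ← map_sum, ← C_add,
        ← Finset.sum_add_distrib]
      congr 1
      refine Finset.sum_congr rfl fun p _ => ?_
      rw [show -(s.mode + u) - v = -s.mode - u - v by abel,
        show -s.mode - (u + v) = -s.mode - u - v by abel]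
      simp only [Pi.add_apply, Int.cast_add]
      ring
    · simp [hab]
  · simp [hs]

/-- For all `1 ≤ i < j ≤ n+1`, `1 ≤ a < b ≤ n+1` and `u, v ∈ ℤ^{N+1}`,
`[(a_{ij} a*_{ij})_u, (κ·D a*_{ab})_v]
  = δ_{ia} δ_{jb} ((κ·D a*_{ij})_{u+v} + Σ_{p=0}^N u_p Σ_{r} κ_{r-u-v,p} a*_{ij,r})`
on `ℂ[x]`. -/
theorem stmt7 (n N : ℕ) (hn : 2 ≤ n) (hN : 1 ≤ N)
    (kappa : MM N → Fin (N + 1) → ℂ)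
    (i j a b : ℕ) (hi : 1 ≤ i) (hij : i < j) (hj : j ≤ n + 1)
    (ha : 1 ≤ a) (hab : a < b) (hb : b ≤ n + 1) (u v : MM N) :
    comm (fmul n N (aop n N i j) (astar n N i j) u) (kD n N kappa a b v)
      = (if i = a ∧ j = b then (1 : ℂ) else 0) •
          (kD n N kappa i j (u + v)
            + fun w => ∑ p : Fin (N + 1),
                (u p : ℂ) • ∑ᶠ r : MM N, kappa (r - u - v) p • astar n N i j r w) := by
  have h : 1 ≤ i ∧ i < j ∧ j ≤ n + 1 := ⟨hi, hij, hj⟩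
  have h' : 1 ≤ a ∧ a < b ∧ b ≤ n + 1 := ⟨ha, hab, hb⟩
  funext w
  have hw := DFunLike.congr_fun (lie_vectorField kappa ⟨(i, j), h⟩ ⟨(a, b), h'⟩ u v) w
  simp only [Derivation.commutator_apply, Derivation.smul_apply, Derivation.add_apply,
    derivation_sum_apply, Subtype.mk.injEq, Prod.mk.injEq] at hw
  simp only [comm, Pi.smul_apply, Pi.add_apply, fmul_eq_vectorField h,
    kD_eq_vectorField kappa h, kD_eq_vectorField kappa h', finsum_smul_astar_eq_vectorField h]
  exact hw

end Stmt7
end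
end

section
/- For all 1 ≤ i < j ≤ n+1 and all u, v ∈ ℤ^{N+1}, the modes of the normally ordered product a_{ij} a*_{ij} commute: [(a_{ij} a*_{ij})_u, (a_{ij} a*_{ij})_v] = 0 as operators on ℂ[x]. -/
noncomputable section

namespace Stmt8

/-- Multi-indices `m ∈ ℤ^{N+1}`. -/
abbrev MM (N : ℕ) := Fin (N + 1) → ℤ

/-- Index type for the polynomial variables `x_{ij}(m)`, `1 ≤ i < j ≤ n+1`,
`m ∈ ℤ^{N+1}`. -/
def XIdx (n N : ℕ) := {ij : ℕ × ℕ // 1 ≤ ij.1 ∧ ij.1 < ij.2 ∧ ij.2 ≤ n + 1} × MM N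

/-- The polynomial ring `ℂ[x]`. -/
abbrev Px (n N : ℕ) := MvPolynomial (XIdx n N) ℂ

/-- `a_{ij,m}`: multiplication by `-x_{ij}(m)` (and `0` for out-of-range indices). -/
def aop (n N : ℕ) (i j : ℕ) (m : MM N) : Px n N → Px n N := fun w =>
  if h : 1 ≤ i ∧ i < j ∧ j ≤ n + 1 then
    -(MvPolynomial.X ((⟨(i, j), h⟩, m) : XIdx n N) : Px n N) * w
  else 0

/-- `a*_{ij,m}`: the partial derivative `∂/∂x_{ij}(-m)` (and `0` for out-of-range
indices). -/
def astar (n N : ℕ) (i j : ℕ) (m : MM N) : Px n N → Px n N := fun w =>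
  if h : 1 ≤ i ∧ i < j ∧ j ≤ n + 1 then
    MvPolynomial.pderiv ((⟨(i, j), h⟩, -m) : XIdx n N) w
  else 0

/-- `(κ·D a*_{ij})_v := Σ_{q ∈ ℤ^{N+1}} Σ_{p=0}^N κ_{q-v,p}(-q_p) a*_{ij,q}`,
a pointwise locally finite sum of operators. -/
def kD (n N : ℕ) (kappa : MM N → Fin (N + 1) → ℂ) (i j : ℕ) (v : MM N) :
    Px n N → Px n N := fun w =>
  ∑ᶠ q : MM N,
    (∑ p : Fin (N + 1), kappa (q - v) p * (-(q p : ℂ))) • astar n N i j q w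

/-- The `m`-th mode of the product of two families of operators:
`(XY)_m := Σ_{k+l=m} X_k Y_l` (pointwise locally finite sum). -/
def fmul (n N : ℕ) (X Y : MM N → Px n N → Px n N) : MM N → Px n N → Px n N :=
  fun m w => ∑ᶠ k : MM N, X k (Y (m - k) w)

/-- The commutator of two operators. -/
def comm {V : Type*} [AddCommGroup V] (f g : V → V) : V → V :=
  fun w => f (g w) - g (f w)

/-- The colours `(i, j)`, `1 ≤ i < j ≤ n + 1`, of the variables of `ℂ[x]`. -/
abbrev Colour (n : ℕ) := {ij : ℕ × ℕ // 1 ≤ ij.1 ∧ ij.1 < ij.2 ∧ ij.2 ≤ n + 1}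

namespace XIdx

variable {n N : ℕ}

/-- The index of the variable `x_e(m)`. -/
def mk (e : Colour n) (m : MM N) : XIdx n N := (e, m)

/-- The colour of a variable. -/
def colour (s : XIdx n N) : Colour n := s.1

/-- The mode of a variable. -/
def mode (s : XIdx n N) : MM N := s.2

@[simp] lemma colour_mk (e : Colour n) (m : MM N) : (mk e m).colour = e := rfl

@[simp] lemma mode_mk (e : Colour n) (m : MM N) : (mk e m).mode = m := rfl

@[simp] lemma mk_colour_mode (s : XIdx n N) : mk s.colour s.mode = s := rfl

end XIdx

open scoped Classical in
/-- The derivation of `ℂ[x]` sending `x_e(m)` to `-x_e(m + u)` and the variables of all other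
colours to `0`. -/
def shiftDerivation (n N : ℕ) (e : Colour n) (u : MM N) : Derivation ℂ (Px n N) (Px n N) :=
  MvPolynomial.mkDerivation ℂ fun s : XIdx n N =>
    if s.colour = e then -(MvPolynomial.X (XIdx.mk e (s.mode + u)) : Px n N) else 0

open scoped Classical in
lemma shiftDerivation_X (n N : ℕ) (e : Colour n) (u : MM N) (s : XIdx n N) :
    shiftDerivation n N e u (MvPolynomial.X s) =
      if s.colour = e then -(MvPolynomial.X (XIdx.mk e (s.mode + u)) : Px n N) else 0 :=
  MvPolynomial.mkDerivation_X ..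

lemma aop_apply (n N i j : ℕ) (h : 1 ≤ i ∧ i < j ∧ j ≤ n + 1) (m : MM N) (w : Px n N) :
    aop n N i j m w = -MvPolynomial.X (XIdx.mk ⟨(i, j), h⟩ m) * w :=
  dif_pos h

lemma astar_apply (n N i j : ℕ) (h : 1 ≤ i ∧ i < j ∧ j ≤ n + 1) (m : MM N) (w : Px n N) :
    astar n N i j m w = MvPolynomial.pderiv (XIdx.mk ⟨(i, j), h⟩ (-m)) w :=
  dif_pos h

lemma fmul_aop_astar (n N i j : ℕ) (h : 1 ≤ i ∧ i < j ∧ j ≤ n + 1) (u : MM N) :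
    fmul n N (aop n N i j) (astar n N i j) u = shiftDerivation n N ⟨(i, j), h⟩ u := by
  classical
  funext w
  set e : Colour n := ⟨(i, j), h⟩
  let S : Finset (MM N) := w.vars.image fun s => s.mode + u
  let D : Derivation ℂ (Px n N) (Px n N) :=
    ∑ k ∈ S, (-MvPolynomial.X (XIdx.mk e k) : Px n N) •
      (MvPolynomial.pderiv (XIdx.mk e (k - u)) : Derivation ℂ (Px n N) (Px n N))
  have hterm (k : MM N) : aop n N i j k (astar n N i j (u - k) w) =
      -MvPolynomial.X (XIdx.mk e k) * MvPolynomial.pderiv (XIdx.mk e (k - u)) w := by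
    rw [aop_apply n N i j h, astar_apply n N i j h, neg_sub]
  have hD (p : Px n N) : D p =
      ∑ k ∈ S, -MvPolynomial.X (XIdx.mk e k) * MvPolynomial.pderiv (XIdx.mk e (k - u)) p := by
    simp only [D, ← Derivation.coeFnAddMonoidHom_apply, map_sum, Finset.sum_apply]
    rfl
  have hsum : fmul n N (aop n N i j) (astar n N i j) u w = D w := by
    simp only [fmul, hterm, hD]
    refine finsum_eq_sum_of_support_subset _ fun k hk => ?_
    have hmem : XIdx.mk e (k - u) ∈ w.vars := by
      by_contra hnot
      exact hk (by simp [MvPolynomial.pderiv_eq_zero_of_notMem_vars hnot])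
    exact Finset.mem_coe.2 (Finset.mem_image.2 ⟨_, hmem, sub_add_cancel k u⟩)
  rw [hsum]
  refine MvPolynomial.derivation_eq_of_forall_mem_vars fun s hs => ?_
  have hsS : s.mode + u ∈ S := Finset.mem_image_of_mem (fun s => s.mode + u) hs
  rw [hD, shiftDerivation_X, Finset.sum_eq_single_of_mem _ hsS]
  · rw [add_sub_cancel_right]
    split_ifs with he
    · rw [← he, XIdx.mk_colour_mode, MvPolynomial.pderiv_X_self, mul_one]
    · rw [MvPolynomial.pderiv_X_of_ne, mul_zero]
      exact fun hse => he (congrArg XIdx.colour hse)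
  · intro k _ hk
    have hse : s ≠ XIdx.mk e (k - u) := by
      rintro rfl
      exact hk (sub_add_cancel k u).symm
    rw [MvPolynomial.pderiv_X_of_ne hse, mul_zero]

lemma lie_shiftDerivation (n N : ℕ) (e : Colour n) (u v : MM N) :
    ⁅shiftDerivation n N e u, shiftDerivation n N e v⁆ = 0 := by
  classical
  refine MvPolynomial.derivation_ext fun s => ?_
  rw [Derivation.commutator_apply, shiftDerivation_X, shiftDerivation_X]
  split_ifs with he
  · simp [shiftDerivation_X, add_right_comm]
  · simp

/-- For all `1 ≤ i < j ≤ n+1` and `u, v ∈ ℤ^{N+1}`, the modes of the normally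
ordered product `a_{ij} a*_{ij}` commute:
`[(a_{ij} a*_{ij})_u, (a_{ij} a*_{ij})_v] = 0` on `ℂ[x]`. -/
theorem stmt8 (n N : ℕ) (hn : 2 ≤ n) (hN : 1 ≤ N)
    (i j : ℕ) (hi : 1 ≤ i) (hij : i < j) (hj : j ≤ n + 1) (u v : MM N) :
    comm (fmul n N (aop n N i j) (astar n N i j) u)
        (fmul n N (aop n N i j) (astar n N i j) v) = 0 := by
  rw [fmul_aop_astar n N i j ⟨hi, hij, hj⟩, fmul_aop_astar n N i j ⟨hi, hij, hj⟩]
  funext w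
  have hw := DFunLike.congr_fun (lie_shiftDerivation n N ⟨(i, j), hi, hij, hj⟩ u v) w
  rwa [Derivation.commutator_apply] at hw

end Stmt8
end
end

section
/- For all 0 ≤ i,j ≤ n and all m, n ∈ ℤ^{N+1}, the operators ρ(H_i)_m on V satisfy [ρ(H_i)_m, ρ(H_j)_n] = −Â_{ij} ( Σ_{l=0}^N m_l κ_{−m−n,l} ) · id_V. -/
noncomputable section

namespace Stmt10

/-- Multi-indices `m ∈ ℤ^{N+1}`. -/
abbrev MM (N : ℕ) := Fin (N + 1) → ℤ

/-- Index type for the polynomial variables `x_{ij}(m)`, `1 ≤ i < j ≤ n+1`. -/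
def XIdx (n N : ℕ) := {ij : ℕ × ℕ // 1 ≤ ij.1 ∧ ij.1 < ij.2 ∧ ij.2 ≤ n + 1} × MM N

/-- Index type for the polynomial variables `y_i(k)`, `1 ≤ i ≤ n`, `k > 0`. -/
def YIdx (n N : ℕ) (pos : MM N → Prop) :=
  {i : ℕ // 1 ≤ i ∧ i ≤ n} × {k : MM N // pos k}

/-- The Fock space `V = ℂ[x] ⊗ ℂ[y]`, realized as the polynomial ring in the
two (disjoint) families of variables. -/
abbrev Fock (n N : ℕ) (pos : MM N → Prop) :=
  MvPolynomial (XIdx n N ⊕ YIdx n N pos) ℂ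

/-- `a_{ij,m}`: multiplication by `-x_{ij}(m)` (and `0` for out-of-range indices). -/
def aop (n N : ℕ) (pos : MM N → Prop) (i j : ℕ) (m : MM N) :
    Fock n N pos → Fock n N pos := fun w =>
  if h : 1 ≤ i ∧ i < j ∧ j ≤ n + 1 then
    -(MvPolynomial.X (Sum.inl ((⟨(i, j), h⟩, m) : XIdx n N)) : Fock n N pos) * w
  else 0

/-- `a*_{ij,m}`: the partial derivative `∂/∂x_{ij}(-m)` (and `0` for
out-of-range indices). -/
def astar (n N : ℕ) (pos : MM N → Prop) (i j : ℕ) (m : MM N) :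
    Fock n N pos → Fock n N pos := fun w =>
  if h : 1 ≤ i ∧ i < j ∧ j ≤ n + 1 then
    MvPolynomial.pderiv (Sum.inl ((⟨(i, j), h⟩, -m) : XIdx n N)) w
  else 0

/-- `(κ·D a*_{ij})_v := Σ_{q ∈ ℤ^{N+1}} Σ_{p=0}^N κ_{q-v,p}(-q_p) a*_{ij,q}`,
a pointwise locally finite sum of operators. -/
def kD (n N : ℕ) (pos : MM N → Prop) (kappa : MM N → Fin (N + 1) → ℂ)
    (i j : ℕ) (v : MM N) : Fock n N pos → Fock n N pos := fun w =>
  ∑ᶠ q : MM N,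
    (∑ p : Fin (N + 1), kappa (q - v) p * (-(q p : ℂ))) • astar n N pos i j q w

open Classical in
/-- `θ(m) = 1` if `m > 0` and `0` otherwise. -/
def theta {N : ℕ} (pos : MM N → Prop) (m : MM N) : ℂ := if pos m then 1 else 0

open Classical in
/-- `∂/∂y_i(s)`, with the convention that it is `0` unless `1 ≤ i ≤ n` and `s > 0`. -/
def ydot (n N : ℕ) (pos : MM N → Prop) (i : ℕ) (s : MM N) :
    Fock n N pos → Fock n N pos := fun w =>
  if h : (1 ≤ i ∧ i ≤ n) ∧ pos s then
    MvPolynomial.pderiv (Sum.inr ((⟨i, h.1⟩, ⟨s, h.2⟩) : YIdx n N pos)) w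
  else 0

/-- `Σ_{p=0}^N m_p κ_{-m+s,p}`. -/
def cnum {N : ℕ} (kappa : MM N → Fin (N + 1) → ℂ) (m s : MM N) : ℂ :=
  ∑ p : Fin (N + 1), (m p : ℂ) * kappa (-m + s) p

open Classical in
/-- The operator `Φ(b_i(m))` (for `1 ≤ i ≤ n`), acting on `V`. -/
def Phi (n N : ℕ) (pos : MM N → Prop) (kappa : MM N → Fin (N + 1) → ℂ)
    (lam : ℕ → ℂ) (i : ℕ) (m : MM N) : Fock n N pos → Fock n N pos := fun w =>
  theta pos (-m) • (∑ᶠ s : MM N, cnum kappa m s •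
      (ydot n N pos (i - 1) s w - ydot n N pos i s w))
  + theta pos m • (∑ᶠ s : MM N, cnum kappa m s •
      (ydot n N pos (i - 1) s w - (2 : ℂ) • ydot n N pos i s w
        + ydot n N pos (i + 1) s w))
  + (if h : (1 ≤ i ∧ i ≤ n) ∧ pos (-m) then
      (MvPolynomial.X (Sum.inr ((⟨i, h.1⟩, ⟨-m, h.2⟩) : YIdx n N pos)) :
          Fock n N pos) * w
    else 0)
  - (if m = 0 then lam i else 0) • w

/-- `Φ(b_0(m)) := -Σ_{i=1}^n Φ(b_i(m))`, and `Φ(b_i(m))` for `1 ≤ i ≤ n`. -/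
def PhiHat (n N : ℕ) (pos : MM N → Prop) (kappa : MM N → Fin (N + 1) → ℂ)
    (lam : ℕ → ℂ) (i : ℕ) (m : MM N) : Fock n N pos → Fock n N pos :=
  if i = 0 then -(∑ r ∈ Finset.Icc 1 n, Phi n N pos kappa lam r m)
  else Phi n N pos kappa lam i m

/-- The `m`-th mode of the product of two families of operators:
`(XY)_m := Σ_{k+l=m} X_k Y_l` (pointwise locally finite sum). -/
def fmul (n N : ℕ) (pos : MM N → Prop)
    (X Y : MM N → Fock n N pos → Fock n N pos) :
    MM N → Fock n N pos → Fock n N pos :=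
  fun m w => ∑ᶠ k : MM N, X k (Y (m - k) w)

/-- Modewise product of a finite list of families of operators; the empty
product is the identity family (the delta family supported at `0`). -/
def fprod (n N : ℕ) (pos : MM N → Prop) :
    List (MM N → Fock n N pos → Fock n N pos) →
      MM N → Fock n N pos → Fock n N pos
  | [] => fun m w => if m = 0 then w else 0
  | X :: L => fmul n N pos X (fprod n N pos L)

/-- The affine Cartan matrix of type `A_n^{(1)}` (indices `0 ≤ i, j ≤ n`), as an
integer matrix. -/
def AcarZ (n i j : ℕ) : ℤ :=
  if i = j then 2
  else if (i + 1) % (n + 1) = j % (n + 1) ∨ (j + 1) % (n + 1) = i % (n + 1) then -1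
  else 0

/-- The affine Cartan matrix of type `A_n^{(1)}`, with complex entries. -/
def Acar (n i j : ℕ) : ℂ := (AcarZ n i j : ℂ)

/-- `ρ(F_r)_m` for `1 ≤ r ≤ n`. -/
def rhoF (n N : ℕ) (pos : MM N → Prop) (r : ℕ) (m : MM N) :
    Fock n N pos → Fock n N pos :=
  aop n N pos r (r + 1) m
    - ∑ j ∈ Finset.Ico 1 r, fmul n N pos (aop n N pos j (r + 1)) (astar n N pos j r) m

/-- `ρ(H_r)_m` for `1 ≤ r ≤ n`. -/
def rhoHn (n N : ℕ) (pos : MM N → Prop) (kappa : MM N → Fin (N + 1) → ℂ)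
    (lam : ℕ → ℂ) (r : ℕ) (m : MM N) : Fock n N pos → Fock n N pos :=
  (2 : ℂ) • fmul n N pos (aop n N pos r (r + 1)) (astar n N pos r (r + 1)) m
  + ∑ i ∈ Finset.Ico 1 r,
      (fmul n N pos (aop n N pos i (r + 1)) (astar n N pos i (r + 1)) m
        - fmul n N pos (aop n N pos i r) (astar n N pos i r) m)
  + ∑ j ∈ Finset.Icc (r + 2) (n + 1),
      (fmul n N pos (aop n N pos r j) (astar n N pos r j) m
        - fmul n N pos (aop n N pos (r + 1) j) (astar n N pos (r + 1) j) m)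
  + Phi n N pos kappa lam r m

/-- `ρ(H_r)_m` for `0 ≤ r ≤ n`, with `ρ(H_0)_m := -Σ_{r=1}^n ρ(H_r)_m`. -/
def rhoH (n N : ℕ) (pos : MM N → Prop) (kappa : MM N → Fin (N + 1) → ℂ)
    (lam : ℕ → ℂ) (r : ℕ) (m : MM N) : Fock n N pos → Fock n N pos :=
  if r = 0 then -(∑ s ∈ Finset.Icc 1 n, rhoHn n N pos kappa lam s m)
  else rhoHn n N pos kappa lam r m

/-- `ρ(E_r)_m` for `1 ≤ r ≤ n`. -/
def rhoEn (n N : ℕ) (pos : MM N → Prop) (kappa : MM N → Fin (N + 1) → ℂ)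
    (lam : ℕ → ℂ) (r : ℕ) (m : MM N) : Fock n N pos → Fock n N pos :=
  fmul n N pos (aop n N pos r (r + 1))
      (fmul n N pos (astar n N pos r (r + 1)) (astar n N pos r (r + 1))) m
  - ∑ j ∈ Finset.Icc (r + 2) (n + 1),
      fmul n N pos (aop n N pos (r + 1) j) (astar n N pos r j) m
  + ∑ j ∈ Finset.Ico 1 r,
      fmul n N pos (aop n N pos j r) (astar n N pos j (r + 1)) m
  + ∑ j ∈ Finset.Icc (r + 2) (n + 1),
      (fmul n N pos (fmul n N pos (aop n N pos r j) (astar n N pos r j))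
          (astar n N pos r (r + 1)) m
        - fmul n N pos (fmul n N pos (aop n N pos (r + 1) j) (astar n N pos (r + 1) j))
            (astar n N pos r (r + 1)) m)
  + fmul n N pos (astar n N pos r (r + 1)) (Phi n N pos kappa lam r) m
  + kD n N pos kappa r (r + 1) m

/-- `ρ(E_r)_m` for `0 ≤ r ≤ n`, with `ρ(E_0)_m := -a_{1,n+1;m}`. -/
def rhoE (n N : ℕ) (pos : MM N → Prop) (kappa : MM N → Fin (N + 1) → ℂ)
    (lam : ℕ → ℂ) (r : ℕ) (m : MM N) : Fock n N pos → Fock n N pos :=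
  if r = 0 then -(aop n N pos 1 (n + 1) m) else rhoEn n N pos kappa lam r m

/-- The strictly increasing sequence `1 = q_1 < q_2 < ⋯ < q_i` encoded by a
subset `s ⊆ {2,…,n+1}`, as the sorted list `1 :: sort s`. -/
def ql (s : Finset ℕ) : List ℕ := 1 :: s.sort (· ≤ ·)

/-- The last entry `q_i` of the sequence encoded by `s`. -/
def qend (s : Finset ℕ) : ℕ := ((ql s).getLast?).getD 0

/-- The second-to-last entry `q_{i-1}` of the sequence encoded by `s`
(`0` if the sequence has length `1`, so that the condition `q_{i-1} ≤ r` is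
vacuous in that case). -/
def qpen (s : Finset ℕ) : ℕ := (((ql s).dropLast).getLast?).getD 0

/-- The list of adjacent pairs `(q_l, q_{l+1})` of a list. -/
def qpairs (l : List ℕ) : List (ℕ × ℕ) := l.zip l.tail

/-- `ρ(F_0)_m`. -/
def rhoF0 (n N : ℕ) (pos : MM N → Prop) (kappa : MM N → Fin (N + 1) → ℂ)
    (lam : ℕ → ℂ) (m : MM N) : Fock n N pos → Fock n N pos :=
  -(∑ r ∈ Finset.Icc 1 (n + 1), ∑ j ∈ Finset.Icc 1 (n + 1),
      ∑ s ∈ (Finset.Icc 2 (n + 1)).powerset,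
        if r < j ∧ qend s = j ∧ qpen s ≤ r then
          fprod n N pos
            (aop n N pos r j ::
              ((qpairs (ql s)).map fun p => astar n N pos p.1 p.2)
                ++ [astar n N pos r (n + 1)]) m
        else 0)
  - (∑ r ∈ Finset.Icc 1 n, ∑ s ∈ (Finset.Icc 2 (n + 1)).powerset,
      if qend s ≤ r then
        fprod n N pos
          (((qpairs (ql s ++ [n + 1])).map fun p => astar n N pos p.1 p.2)
            ++ [Phi n N pos kappa lam r]) m
      else 0)
  - (∑ r ∈ Finset.Icc 1 n, ∑ s ∈ (Finset.Icc 2 (n + 1)).powerset,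
      if qend s = r then
        fprod n N pos
          (((qpairs (ql s)).map fun p => astar n N pos p.1 p.2)
            ++ [kD n N pos kappa r (n + 1)]) m
      else 0)

/-- `ρ(F_r)_m` for `0 ≤ r ≤ n`. -/
def rhoFa (n N : ℕ) (pos : MM N → Prop) (kappa : MM N → Fin (N + 1) → ℂ)
    (lam : ℕ → ℂ) (r : ℕ) (m : MM N) : Fock n N pos → Fock n N pos :=
  if r = 0 then rhoF0 n N pos kappa lam m else rhoF n N pos r m

/-- The commutator of two operators. -/
def comm {V : Type*} [AddCommGroup V] (f g : V → V) : V → V :=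
  fun w => f (g w) - g (f w)

theorem derivation_sum_apply {σ ι : Type*}
    (D : ι → Derivation ℂ (MvPolynomial σ ℂ) (MvPolynomial σ ℂ)) (s : Finset ι)
    (w : MvPolynomial σ ℂ) : (∑ k ∈ s, D k) w = ∑ k ∈ s, D k w := by
  rw [← Derivation.coeFnAddMonoidHom_apply, map_sum, Finset.sum_apply]
  rfl

/-- A locally finite family of derivations of a polynomial ring is locally finite as soon as it
is so on the variables. -/
theorem finite_support_derivation {σ ι : Type*}
    (D : ι → Derivation ℂ (MvPolynomial σ ℂ) (MvPolynomial σ ℂ))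
    (h : ∀ v, (Function.support fun k => D k (MvPolynomial.X v)).Finite)
    (w : MvPolynomial σ ℂ) : (Function.support fun k => D k w).Finite := by
  refine (w.vars.finite_toSet.biUnion fun v _ => h v).subset fun k hk => ?_
  by_contra hk'
  simp only [Set.mem_iUnion, not_exists, Function.mem_support, not_not] at hk'
  refine hk ?_
  have := MvPolynomial.derivation_eq_of_forall_mem_vars (D₁ := D k) (D₂ := 0) (f := w)
    fun v hv => by simpa using hk' v hv
  simpa using this

/-- The sum of a locally finite family of derivations is determined by its values on the
variables. -/
theorem finsum_derivation_apply {σ ι : Type*}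
    (D : ι → Derivation ℂ (MvPolynomial σ ℂ) (MvPolynomial σ ℂ))
    (E : Derivation ℂ (MvPolynomial σ ℂ) (MvPolynomial σ ℂ))
    (h : ∀ v, (Function.support fun k => D k (MvPolynomial.X v)).Finite)
    (hE : ∀ v, ∑ᶠ k, D k (MvPolynomial.X v) = E (MvPolynomial.X v))
    (w : MvPolynomial σ ℂ) : ∑ᶠ k, D k w = E w := by
  classical
  set s : Finset ι := (finite_support_derivation D h w).toFinset ∪
    w.vars.biUnion fun v => (h v).toFinset with hs
  have key : (∑ k ∈ s, D k) w = E w := by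
    refine MvPolynomial.derivation_eq_of_forall_mem_vars fun v hv => ?_
    rw [← hE v, finsum_eq_sum_of_support_subset (s := s), derivation_sum_apply]
    intro k hk
    simp only [hs, Finset.coe_union, Finset.coe_biUnion, Set.Finite.coe_toFinset]
    exact Or.inr (Set.mem_biUnion hv hk)
  rw [← key, finsum_eq_sum_of_support_subset (s := s), derivation_sum_apply]
  intro k hk
  simp only [hs, Finset.coe_union, Set.Finite.coe_toFinset]
  exact Or.inl hk

/-- The index of the variable `x_{ij}(p)`. -/
def xIdx {n : ℕ} (N : ℕ) (ij : {ij : ℕ × ℕ // 1 ≤ ij.1 ∧ ij.1 < ij.2 ∧ ij.2 ≤ n + 1})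
    (p : MM N) : XIdx n N := (ij, p)

/-- The index of the variable `y_i(s)`. -/
def yIdx {n N : ℕ} {pos : MM N → Prop} (i : {i : ℕ // 1 ≤ i ∧ i ≤ n})
    (s : {s : MM N // pos s}) : YIdx n N pos := (i, s)

@[simp] theorem xIdx_fst {n N : ℕ} (ij : {ij : ℕ × ℕ // 1 ≤ ij.1 ∧ ij.1 < ij.2 ∧ ij.2 ≤ n + 1})
    (p : MM N) : (xIdx N ij p).1 = ij := rfl

@[simp] theorem xIdx_snd {n N : ℕ} (ij : {ij : ℕ × ℕ // 1 ≤ ij.1 ∧ ij.1 < ij.2 ∧ ij.2 ≤ n + 1})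
    (p : MM N) : (xIdx N ij p).2 = p := rfl

@[simp] theorem yIdx_fst {n N : ℕ} {pos : MM N → Prop} (i : {i : ℕ // 1 ≤ i ∧ i ≤ n})
    (s : {s : MM N // pos s}) : (yIdx i s).1 = i := rfl

@[simp] theorem yIdx_snd {n N : ℕ} {pos : MM N → Prop} (i : {i : ℕ // 1 ≤ i ∧ i ≤ n})
    (s : {s : MM N // pos s}) : (yIdx i s).2 = s := rfl

/-- The derivation `x_{ij}(p) ↦ e_{ij} x_{ij}(p + m)`, `y_i(s) ↦ 0`. -/
def shiftDer (n N : ℕ) (pos : MM N → Prop) (m : MM N) :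
    (ℕ × ℕ → ℂ) →ₗ[ℂ] Derivation ℂ (Fock n N pos) (Fock n N pos) where
  toFun e := MvPolynomial.mkDerivation ℂ (Sum.elim
    (fun q => e q.1.1 •
      (MvPolynomial.X (Sum.inl (xIdx N q.1 (q.2 + m))) : Fock n N pos)) fun _ => 0)
  map_add' e e' := by
    refine MvPolynomial.derivation_ext ?_
    rintro (q | y) <;> simp [MvPolynomial.mkDerivation_X, add_smul]
  map_smul' t e := by
    refine MvPolynomial.derivation_ext ?_
    rintro (q | y) <;> simp [MvPolynomial.mkDerivation_X, mul_smul]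

/-- The derivation `x_{ij}(p) ↦ 0`, `y_i(s) ↦ c_i(s)`. -/
def constDer (n N : ℕ) (pos : MM N → Prop) (c : ℕ → MM N → ℂ) :
    Derivation ℂ (Fock n N pos) (Fock n N pos) :=
  MvPolynomial.mkDerivation ℂ (Sum.elim (fun _ => 0) fun y => MvPolynomial.C (c y.1 y.2))

section

variable {n N : ℕ} {pos : MM N → Prop}

@[simp] theorem shiftDer_inl (m : MM N) (e : ℕ × ℕ → ℂ) (q : XIdx n N) :
    shiftDer n N pos m e (MvPolynomial.X (Sum.inl q)) =
      e q.1.1 • (MvPolynomial.X (Sum.inl (xIdx N q.1 (q.2 + m))) : Fock n N pos) := by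
  simp [shiftDer, MvPolynomial.mkDerivation_X]

@[simp] theorem shiftDer_inr (m : MM N) (e : ℕ × ℕ → ℂ) (y : YIdx n N pos) :
    shiftDer n N pos m e (MvPolynomial.X (Sum.inr y)) = 0 := by
  simp [shiftDer, MvPolynomial.mkDerivation_X]

@[simp] theorem constDer_inl (c : ℕ → MM N → ℂ) (q : XIdx n N) :
    constDer n N pos c (MvPolynomial.X (Sum.inl q)) = 0 := by
  simp [constDer, MvPolynomial.mkDerivation_X]

@[simp] theorem constDer_inr (c : ℕ → MM N → ℂ) (y : YIdx n N pos) :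
    constDer n N pos c (MvPolynomial.X (Sum.inr y)) = MvPolynomial.C (c y.1 y.2) := by
  simp [constDer, MvPolynomial.mkDerivation_X]

theorem shiftDer_add_constDer_comm (m m' : MM N) (e e' : ℕ × ℕ → ℂ) (c c' : ℕ → MM N → ℂ)
    (w : Fock n N pos) :
    (shiftDer n N pos m e + constDer n N pos c) ((shiftDer n N pos m' e' + constDer n N pos c') w)
      = (shiftDer n N pos m' e' + constDer n N pos c')
          ((shiftDer n N pos m e + constDer n N pos c) w) := by
  have h : ⁅shiftDer n N pos m e + constDer n N pos c,
      shiftDer n N pos m' e' + constDer n N pos c'⁆ = 0 := by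
    refine MvPolynomial.derivation_ext ?_
    rintro (q | y)
    · simp [Derivation.commutator_apply, smul_smul, mul_comm, add_right_comm]
    · simp [Derivation.commutator_apply]
  have := congrArg (fun D => D w) h
  simpa [Derivation.commutator_apply, sub_eq_zero] using this

/-- The operator `(a_{ij} a*_{ij})_m` is minus the shift by `m` of the variables `x_{ij}`. -/
theorem fmul_aop_astar (i j : ℕ) (m : MM N) (w : Fock n N pos) :
    fmul n N pos (aop n N pos i j) (astar n N pos i j) m w =
      shiftDer n N pos m (Pi.single (i, j) (-1)) w := by
  classical
  unfold fmul
  by_cases h : 1 ≤ i ∧ i < j ∧ j ≤ n + 1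
  · let D : MM N → Derivation ℂ (Fock n N pos) (Fock n N pos) := fun k =>
      (-(MvPolynomial.X (Sum.inl (xIdx N ⟨(i, j), h⟩ k)) : Fock n N pos)) •
        MvPolynomial.pderiv (Sum.inl (xIdx N ⟨(i, j), h⟩ (-(m - k))))
    have hD : ∀ k w, aop n N pos i j k (astar n N pos i j (m - k) w) = D k w := fun k w => by
      have h₁ : astar n N pos i j (m - k) w =
          MvPolynomial.pderiv (Sum.inl (xIdx N ⟨(i, j), h⟩ (-(m - k)))) w := dif_pos h
      rw [h₁]
      exact dif_pos h
    have hinr : ∀ k y, D k (MvPolynomial.X (Sum.inr y)) = 0 := fun k y => by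
      simp [D, MvPolynomial.pderiv_X]
    have hinl : ∀ k q, k ≠ q.2 + m → D k (MvPolynomial.X (Sum.inl q)) = 0 := fun k q hk => by
      have : (Sum.inl q : XIdx n N ⊕ YIdx n N pos) ≠
          Sum.inl (xIdx N ⟨(i, j), h⟩ (-(m - k))) := by
        rintro h'
        refine hk ?_
        rw [Sum.inl.inj h']
        simp
      simp only [D, Derivation.smul_apply, MvPolynomial.pderiv_X_of_ne this, smul_zero]
    simp only [hD]
    refine finsum_derivation_apply D _ ?_ ?_ w
    · rintro (q | y)
      · refine (Set.finite_singleton (q.2 + m)).subset fun k hk => ?_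
        by_contra hk'
        exact hk (hinl k q hk')
      · simp [hinr]
    · rintro (q | y)
      · rw [finsum_eq_single _ (q.2 + m) fun k hk => hinl k _ hk, shiftDer_inl]
        by_cases hq : q.1.1 = (i, j)
        · obtain ⟨p, rfl⟩ : ∃ p, q = xIdx N ⟨(i, j), h⟩ p :=
            ⟨q.2, Prod.ext (Subtype.ext hq) rfl⟩
          simp [D]
        · have : (Sum.inl q : XIdx n N ⊕ YIdx n N pos) ≠
              Sum.inl (xIdx N ⟨(i, j), h⟩ (-(m - (q.2 + m)))) := by
            intro h'
            rw [Sum.inl.inj h'] at hq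
            exact hq rfl
          simp only [D, Derivation.smul_apply, MvPolynomial.pderiv_X_of_ne this,
            Pi.single_eq_of_ne hq, smul_zero, zero_smul]
      · simp [hinr]
  · have h0 : shiftDer n N pos m (Pi.single (i, j) (-1)) = 0 := by
      refine MvPolynomial.derivation_ext ?_
      rintro (q | y)
      · have : q.1.1 ≠ (i, j) := by
          intro hq
          refine h ?_
          have := q.1.2
          rwa [hq] at this
        simp [Pi.single_eq_of_ne this]
      · simp
    simp [aop, h, h0]

open Classical in
/-- The derivation underlying `ydot`. -/
def ydotDer (n N : ℕ) (pos : MM N → Prop) (i : ℕ) (s : MM N) :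
    Derivation ℂ (Fock n N pos) (Fock n N pos) :=
  if h : (1 ≤ i ∧ i ≤ n) ∧ pos s then
    MvPolynomial.pderiv (Sum.inr (yIdx ⟨i, h.1⟩ ⟨s, h.2⟩))
  else 0

theorem ydot_eq (i : ℕ) (s : MM N) (w : Fock n N pos) :
    ydot n N pos i s w = ydotDer n N pos i s w := by
  by_cases h : (1 ≤ i ∧ i ≤ n) ∧ pos s
  · rw [ydotDer, dif_pos h]
    exact dif_pos h
  · simp [ydot, ydotDer, h]

@[simp] theorem ydotDer_inl (i : ℕ) (s : MM N) (q : XIdx n N) :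
    ydotDer n N pos i s (MvPolynomial.X (Sum.inl q)) = 0 := by
  classical
  unfold ydotDer
  split_ifs <;> simp [MvPolynomial.pderiv_X]

theorem ydotDer_inr (i : ℕ) (s : MM N) (y : YIdx n N pos) :
    ydotDer n N pos i s (MvPolynomial.X (Sum.inr y)) =
      MvPolynomial.C (if y.1.1 = i ∧ y.2.1 = s then 1 else 0) := by
  classical
  unfold ydotDer
  by_cases h' : y.1.1 = i ∧ y.2.1 = s
  · have h : (1 ≤ i ∧ i ≤ n) ∧ pos s := ⟨h'.1 ▸ y.1.2, h'.2 ▸ y.2.2⟩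
    obtain rfl : y = yIdx ⟨i, h.1⟩ ⟨s, h.2⟩ := Prod.ext (Subtype.ext h'.1) (Subtype.ext h'.2)
    rw [dif_pos h, if_pos h', MvPolynomial.pderiv_X_self, map_one]
  · rw [if_neg h', map_zero]
    split_ifs with h
    · refine MvPolynomial.pderiv_X_of_ne fun e => h' ?_
      rw [Sum.inr.inj e]
      exact ⟨rfl, rfl⟩
    · rfl

theorem finsum_ydot (c : MM N → ℂ) (r : ℕ) (b₁ b₂ b₃ : ℂ) (w : Fock n N pos) :
    ∑ᶠ s : MM N, c s • (b₁ • ydot n N pos (r - 1) s w + b₂ • ydot n N pos r s w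
        + b₃ • ydot n N pos (r + 1) s w) =
      constDer n N pos (fun i s => c s * (b₁ * (if i = r - 1 then 1 else 0)
        + b₂ * (if i = r then 1 else 0) + b₃ * (if i = r + 1 then 1 else 0))) w := by
  classical
  let D : MM N → Derivation ℂ (Fock n N pos) (Fock n N pos) := fun s =>
    c s • (b₁ • ydotDer n N pos (r - 1) s + b₂ • ydotDer n N pos r s
      + b₃ • ydotDer n N pos (r + 1) s)
  have hinl : ∀ s q, D s (MvPolynomial.X (Sum.inl q)) = 0 := fun s q => by simp [D]
  have hinr : ∀ (y : YIdx n N pos) s, s ≠ y.2.1 → D s (MvPolynomial.X (Sum.inr y)) = 0 :=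
    fun y s hs => by simp [D, ydotDer_inr, hs.symm]
  have hD : ∀ s w, c s • (b₁ • ydot n N pos (r - 1) s w + b₂ • ydot n N pos r s w
        + b₃ • ydot n N pos (r + 1) s w) = D s w := fun s w => by simp [D, ydot_eq]
  simp only [hD]
  refine finsum_derivation_apply D _ ?_ ?_ w
  · rintro (q | y)
    · simp [hinl]
    · refine (Set.finite_singleton y.2.1).subset fun s hs => ?_
      by_contra hs'
      exact hs (hinr y s hs')
  · rintro (q | y)
    · simp [hinl]
    · rw [finsum_eq_single _ y.2.1 fun s hs => hinr y s hs, constDer_inr]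
      simp only [D, Derivation.smul_apply, Derivation.add_apply, ydotDer_inr, and_true,
        MvPolynomial.smul_eq_C_mul, ← map_mul, ← map_add]

/-- The value on `y_i(s)` of the derivation part of `Φ(b_r(m))`. -/
def phiCoeff {N : ℕ} (pos : MM N → Prop) (kappa : MM N → Fin (N + 1) → ℂ) (r : ℕ) (m : MM N)
    (i : ℕ) (s : MM N) : ℂ :=
  cnum kappa m s *
    (theta pos (-m) * ((if i = r - 1 then 1 else 0) - (if i = r then 1 else 0))
      + theta pos m * ((if i = r - 1 then 1 else 0) - 2 * (if i = r then 1 else 0)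
        + (if i = r + 1 then 1 else 0)))

open Classical in
/-- The multiplication part of `Φ(b_r(m))`. -/
def phiMul (n N : ℕ) (pos : MM N → Prop) (lam : ℕ → ℂ) (r : ℕ) (m : MM N) : Fock n N pos :=
  (if h : (1 ≤ r ∧ r ≤ n) ∧ pos (-m) then
      MvPolynomial.X (Sum.inr (yIdx ⟨r, h.1⟩ ⟨-m, h.2⟩)) else 0)
    - MvPolynomial.C (if m = 0 then lam r else 0)

theorem Phi_apply (kappa : MM N → Fin (N + 1) → ℂ) (lam : ℕ → ℂ) (r : ℕ) (m : MM N)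
    (w : Fock n N pos) :
    Phi n N pos kappa lam r m w =
      constDer n N pos (phiCoeff pos kappa r m) w + phiMul n N pos lam r m * w := by
  have h₁ := finsum_ydot (n := n) (pos := pos) (cnum kappa m) r 1 (-1) 0 w
  have h₂ := finsum_ydot (n := n) (pos := pos) (cnum kappa m) r 1 (-2) 1 w
  simp only [one_smul, neg_smul, zero_smul, add_zero, ← sub_eq_add_neg] at h₁ h₂
  have h₃ : constDer n N pos (phiCoeff pos kappa r m) =
      theta pos (-m) • constDer n N pos (fun i s => cnum kappa m s *
          (1 * (if i = r - 1 then 1 else 0) + -1 * (if i = r then 1 else 0)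
            + 0 * (if i = r + 1 then 1 else 0)))
      + theta pos m • constDer n N pos (fun i s => cnum kappa m s *
          (1 * (if i = r - 1 then 1 else 0) + -2 * (if i = r then 1 else 0)
            + 1 * (if i = r + 1 then 1 else 0))) := by
    refine MvPolynomial.derivation_ext ?_
    rintro (q | y)
    · simp
    · simp only [Derivation.smul_apply, Derivation.add_apply, constDer_inr,
        MvPolynomial.smul_eq_C_mul, ← map_mul, ← map_add]
      unfold phiCoeff
      congr 1
      ring
  rw [Phi, h₁, h₂, h₃]
  simp only [phiMul, Derivation.add_apply, Derivation.smul_apply,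
    MvPolynomial.smul_eq_C_mul]
  by_cases h : (1 ≤ r ∧ r ≤ n) ∧ pos (-m)
  · rw [dif_pos h, dif_pos h, yIdx]
    ring
  · rw [dif_neg h, dif_neg h]
    ring

theorem constDer_phiMul (c : ℕ → MM N → ℂ) (lam : ℕ → ℂ) {r : ℕ} (hr : 1 ≤ r ∧ r ≤ n)
    (m : MM N) :
    constDer n N pos c (phiMul n N pos lam r m) =
      MvPolynomial.C (theta pos (-m) * c r (-m)) := by
  unfold phiMul theta
  by_cases h : pos (-m) <;> simp [h, hr]

theorem shiftDer_phiMul (m' : MM N) (e : ℕ × ℕ → ℂ) (lam : ℕ → ℂ) (r : ℕ) (m : MM N) :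
    shiftDer n N pos m' e (phiMul n N pos lam r m) = 0 := by
  unfold phiMul
  split_ifs <;> simp

theorem exists_rhoHn_apply (kappa : MM N → Fin (N + 1) → ℂ) (lam : ℕ → ℂ) (r : ℕ) (m : MM N) :
    ∃ e : ℕ × ℕ → ℂ, ∀ w : Fock n N pos, rhoHn n N pos kappa lam r m w =
      (shiftDer n N pos m e + constDer n N pos (phiCoeff pos kappa r m)) w
        + phiMul n N pos lam r m * w := by
  let E : ℕ → ℕ → ℕ × ℕ → ℂ := fun i j => Pi.single (i, j) (-1)
  refine ⟨(2 : ℂ) • E r (r + 1) + ∑ i ∈ Finset.Ico 1 r, (E i (r + 1) - E i r)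
    + ∑ j ∈ Finset.Icc (r + 2) (n + 1), (E r j - E (r + 1) j), fun w => ?_⟩
  simp only [rhoHn, Pi.add_apply, Pi.smul_apply, Finset.sum_apply, Pi.sub_apply, fmul_aop_astar,
    Phi_apply, map_add, map_sum, map_sub, map_smul, Derivation.add_apply, Derivation.sub_apply,
    Derivation.smul_apply, derivation_sum_apply, E, add_assoc]

theorem exists_linearMap_rhoHn (kappa : MM N → Fin (N + 1) → ℂ) (lam : ℕ → ℂ) (r : ℕ)
    (m : MM N) :
    ∃ L : Module.End ℂ (Fock n N pos), rhoHn n N pos kappa lam r m = L := by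
  obtain ⟨e, he⟩ := exists_rhoHn_apply (n := n) (pos := pos) kappa lam r m
  refine ⟨(shiftDer n N pos m e + constDer n N pos (phiCoeff pos kappa r m)).toLinearMap
    + LinearMap.mulLeft ℂ (phiMul n N pos lam r m), funext fun w => ?_⟩
  simp [he]

theorem comm_rhoHn_apply (kappa : MM N → Fin (N + 1) → ℂ) (lam : ℕ → ℂ) {i j : ℕ}
    (hi : 1 ≤ i ∧ i ≤ n) (hj : 1 ≤ j ∧ j ≤ n) (m mm : MM N) (w : Fock n N pos) :
    comm (rhoHn n N pos kappa lam i m) (rhoHn n N pos kappa lam j mm) w =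
      (theta pos (-mm) * phiCoeff pos kappa i m j (-mm)
        - theta pos (-m) * phiCoeff pos kappa j mm i (-m)) • w := by
  obtain ⟨e, he⟩ := exists_rhoHn_apply (n := n) (pos := pos) kappa lam i m
  obtain ⟨e', he'⟩ := exists_rhoHn_apply (n := n) (pos := pos) kappa lam j mm
  have hc := shiftDer_add_constDer_comm m mm e e' (phiCoeff pos kappa i m)
    (phiCoeff pos kappa j mm) w
  have h₁ : (shiftDer n N pos m e + constDer n N pos (phiCoeff pos kappa i m))
      (phiMul n N pos lam j mm) =
        MvPolynomial.C (theta pos (-mm) * phiCoeff pos kappa i m j (-mm)) := by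
    rw [Derivation.add_apply, shiftDer_phiMul, constDer_phiMul _ _ hj, zero_add]
  have h₂ : (shiftDer n N pos mm e' + constDer n N pos (phiCoeff pos kappa j mm))
      (phiMul n N pos lam i m) =
        MvPolynomial.C (theta pos (-m) * phiCoeff pos kappa j mm i (-m)) := by
    rw [Derivation.add_apply, shiftDer_phiMul, constDer_phiMul _ _ hi, zero_add]
  simp only [comm, he, he', map_add (shiftDer n N pos m e + constDer n N pos _),
    map_add (shiftDer n N pos mm e' + constDer n N pos _), Derivation.leibniz, h₁, h₂, hc,
    MvPolynomial.smul_eq_C_mul, smul_eq_mul, map_sub]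
  ring

end

theorem Acar_symm (n i j : ℕ) : Acar n i j = Acar n j i := by
  unfold Acar AcarZ
  simp only [eq_comm (a := i) (b := j), or_comm]

theorem Acar_of_pos {n i j : ℕ} (hi : 1 ≤ i ∧ i ≤ n) (hj : 1 ≤ j ∧ j ≤ n) :
    Acar n i j = 2 * (if i = j then 1 else 0) - (if i = j - 1 then 1 else 0)
      - (if i = j + 1 then 1 else 0) := by
  have h₁ : ∀ {a b : ℕ}, a ≤ n → 1 ≤ b → b ≤ n →
      ((a + 1) % (n + 1) = b % (n + 1) ↔ a + 1 = b) := by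
    intro a b ha hb hb'
    rw [Nat.mod_eq_of_lt (a := b) (by omega)]
    obtain rfl | h := eq_or_lt_of_le ha
    · rw [Nat.mod_self]
      omega
    · rw [Nat.mod_eq_of_lt (by omega)]
  unfold Acar AcarZ
  simp only [h₁ hi.2 hj.1 hj.2, h₁ hj.2 hi.1 hi.2]
  split_ifs <;> first | omega | norm_num

theorem Acar_pos_zero {n i : ℕ} (hn : 2 ≤ n) (hi : 1 ≤ i ∧ i ≤ n) :
    Acar n i 0 = -(if i = 1 then 1 else 0) - (if i = n then 1 else 0) := by
  have h₁ : (i + 1) % (n + 1) = 0 ↔ i = n := by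
    obtain rfl | h := eq_or_lt_of_le hi.2
    · simp
    · rw [Nat.mod_eq_of_lt (by omega)]
      omega
  unfold Acar AcarZ
  simp only [Nat.zero_mod, h₁, zero_add, Nat.mod_eq_of_lt (show 1 < n + 1 by omega),
    Nat.mod_eq_of_lt (show i < n + 1 by omega)]
  split_ifs <;> first | omega | norm_num

/-- The columns of the affine Cartan matrix sum to zero. -/
theorem sum_Acar {n j : ℕ} (hn : 2 ≤ n) (hj : j ≤ n) :
    ∑ s ∈ Finset.Icc 1 n, Acar n s j = -Acar n 0 j := by
  obtain rfl | hj0 := Nat.eq_zero_or_pos j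
  · rw [Finset.sum_congr rfl fun s hs => Acar_pos_zero hn (Finset.mem_Icc.1 hs)]
    have : Acar n 0 0 = 2 := by simp [Acar, AcarZ]
    rw [this, Finset.sum_sub_distrib, Finset.sum_neg_distrib, Finset.sum_ite_eq',
      Finset.sum_ite_eq', if_pos (by simp; omega), if_pos (by simp; omega)]
    norm_num
  · rw [Finset.sum_congr rfl fun s hs => Acar_of_pos (Finset.mem_Icc.1 hs) ⟨hj0, hj⟩,
      Acar_symm, Acar_pos_zero hn ⟨hj0, hj⟩]
    simp only [Finset.sum_sub_distrib, ← Finset.mul_sum, Finset.sum_ite_eq', Finset.mem_Icc]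
    split_ifs <;> first | omega | norm_num

/-- The scalar by which `[ρ(H_i)_m, ρ(H_j)_{m'}]` acts, for `1 ≤ i, j ≤ n`. -/
theorem phiCoeff_commutator {n N : ℕ} {pos : MM N → Prop}
    (htri : ∀ a : MM N, pos a ∨ a = 0 ∨ pos (-a)) (hzero : ¬ pos (0 : MM N))
    (hdisj : ∀ a : MM N, pos a → ¬ pos (-a)) {kappa : MM N → Fin (N + 1) → ℂ}
    (hE1 : ∀ m : MM N, ∑ p : Fin (N + 1), (m p : ℂ) * kappa m p = 0)
    (hE2 : ∀ m k : MM N, pos m → pos k →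
      ∑ p : Fin (N + 1), (m p : ℂ) * kappa (-m - k) p = 0)
    {i j : ℕ} (hi : 1 ≤ i ∧ i ≤ n) (hj : 1 ≤ j ∧ j ≤ n) (m mm : MM N) :
    theta pos (-mm) * phiCoeff pos kappa i m j (-mm)
        - theta pos (-m) * phiCoeff pos kappa j mm i (-m) =
      -(Acar n i j) * ∑ l : Fin (N + 1), (m l : ℂ) * kappa (-m - mm) l := by
  set S := ∑ l : Fin (N + 1), (m l : ℂ) * kappa (-m - mm) l with hS
  have hc : cnum kappa m (-mm) = S := by
    simp only [cnum, hS, sub_eq_add_neg]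
  have hc' : cnum kappa mm (-m) = -S := by
    have h := hE1 (-m - mm)
    simp only [cnum, hS, neg_add_eq_sub, eq_neg_iff_add_eq_zero, ← Finset.sum_add_distrib]
    rw [← neg_eq_zero, ← h, ← Finset.sum_neg_distrib]
    refine Finset.sum_congr rfl fun p _ => ?_
    push_cast [Pi.sub_apply, Pi.neg_apply]
    ring
  have ht : ∀ a : MM N, (theta pos a = 1 ∧ theta pos (-a) = 0 ∧ pos a) ∨
      (theta pos a = 0 ∧ theta pos (-a) = 0 ∧ a = 0) ∨
      (theta pos a = 0 ∧ theta pos (-a) = 1) := by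
    intro a
    unfold theta
    rcases htri a with h | h | h
    · exact Or.inl ⟨if_pos h, if_neg (hdisj a h), h⟩
    · subst h
      exact Or.inr (Or.inl ⟨if_neg hzero, if_neg (by rwa [neg_zero]), rfl⟩)
    · exact Or.inr (Or.inr ⟨if_neg fun h' => hdisj a h' h, if_pos h⟩)
  have hm0 : m = 0 → S = 0 := by
    rintro rfl
    simp [hS]
  have hmm0 : mm = 0 → S = 0 := by
    rintro rfl
    have h := hE1 (-m)
    simp only [Pi.neg_apply, Int.cast_neg, neg_mul, Finset.sum_neg_distrib, neg_eq_zero] at h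
    simpa [hS] using h
  have e₁ : (if j = i then (1 : ℂ) else 0) = if i = j then 1 else 0 := by
    simp only [eq_comm]
  have e₂ : (if j = i - 1 then (1 : ℂ) else 0) = if i = j + 1 then 1 else 0 := by
    split_ifs <;> first | rfl | omega
  have e₃ : (if j = i + 1 then (1 : ℂ) else 0) = if i = j - 1 then 1 else 0 := by
    split_ifs <;> first | rfl | omega
  rw [phiCoeff, phiCoeff, hc, hc', Acar_of_pos hi hj, e₁, e₂, e₃]
  rcases ht m with ⟨h₁, h₂, h₃⟩ | ⟨h₁, h₂, h₃⟩ | ⟨h₁, h₂⟩ <;>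
    rcases ht mm with ⟨k₁, k₂, k₃⟩ | ⟨k₁, k₂, k₃⟩ | ⟨k₁, k₂⟩ <;>
    simp only [h₁, h₂, k₁, k₂]
  · rw [show S = 0 from hE2 m mm h₃ k₃]
    ring
  · rw [hmm0 k₃]
    ring
  · ring
  · rw [hm0 h₃]
    ring
  · rw [hm0 h₃]
    ring
  · rw [hm0 h₃]
    ring
  · ring
  · rw [hmm0 k₃]
    ring
  · ring

/-- The family `L_1, …, L_n` extended to the index `0` by `L_0 = -∑ L_s`. -/
def affExt {M : Type*} [AddCommGroup M] (n : ℕ) (L : ℕ → M) (r : ℕ) : M :=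
  if r = 0 then -∑ s ∈ Finset.Icc 1 n, L s else L r

/-- Commutation relations of finite type `A_n` extend to the affine type. -/
theorem affExt_commutator {A : Type*} [Ring A] [Algebra ℂ A] {n : ℕ} (hn : 2 ≤ n) {L L' : ℕ → A} {S : ℂ}
    (h : ∀ i j, 1 ≤ i ∧ i ≤ n → 1 ≤ j ∧ j ≤ n → L i * L' j - L' j * L i =
      (-Acar n i j * S) • (1 : A))
    {i j : ℕ} (hi : i ≤ n) (hj : j ≤ n) :
    affExt n L i * affExt n L' j - affExt n L' j * affExt n L i = (-Acar n i j * S) • (1 : A) := by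
  have h₁ : ∀ i j, i ≤ n → 1 ≤ j ∧ j ≤ n →
      affExt n L i * L' j - L' j * affExt n L i = (-Acar n i j * S) • (1 : A) := by
    intro i j hi hj
    obtain rfl | hi0 := Nat.eq_zero_or_pos i
    · rw [affExt, if_pos rfl, neg_mul, mul_neg, neg_sub_neg, ← neg_sub,
        Finset.sum_mul, Finset.mul_sum, ← Finset.sum_sub_distrib,
        Finset.sum_congr rfl fun s hs => h s j (Finset.mem_Icc.1 hs) hj, ← Finset.sum_smul,
        ← Finset.sum_mul, Finset.sum_neg_distrib, sum_Acar hn hj.2, ← neg_smul]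
      congr 1
      ring
    · rw [affExt, if_neg hi0.ne', h i j ⟨hi0, hi⟩ hj]
  obtain rfl | hj0 := Nat.eq_zero_or_pos j
  · rw [affExt.eq_def n L', if_pos rfl, mul_neg, neg_mul, neg_sub_neg, ← neg_sub,
      Finset.mul_sum, Finset.sum_mul, ← Finset.sum_sub_distrib,
      Finset.sum_congr rfl fun s hs => h₁ i s hi (Finset.mem_Icc.1 hs), ← Finset.sum_smul,
      ← Finset.sum_mul, Finset.sum_neg_distrib,
      Finset.sum_congr rfl fun s _ => Acar_symm n i s, sum_Acar hn hi, Acar_symm, ← neg_smul]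
    congr 1
    ring
  · rw [affExt.eq_def n L', if_neg hj0.ne', h₁ i j hi ⟨hj0, hj⟩]

/-- For all `0 ≤ i, j ≤ n` and `m, n ∈ ℤ^{N+1}`,
`[ρ(H_i)_m, ρ(H_j)_n] = -Â_{ij} (Σ_{l=0}^N m_l κ_{-m-n,l}) · id_V`. -/
theorem stmt10 (n N : ℕ) (hn : 2 ≤ n) (hN : 1 ≤ N)
    (pos : MM N → Prop)
    (hadd : ∀ a b : MM N, pos a → pos b → pos (a + b))
    (htri : ∀ a : MM N, pos a ∨ a = 0 ∨ pos (-a))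
    (hzero : ¬ pos (0 : MM N))
    (hdisj : ∀ a : MM N, pos a → ¬ pos (-a))
    (kappa : MM N → Fin (N + 1) → ℂ) (lam : ℕ → ℂ)
    (hE1 : ∀ m : MM N, ∑ p : Fin (N + 1), (m p : ℂ) * kappa m p = 0)
    (hE2 : ∀ m k : MM N, pos m → pos k →
      ∑ p : Fin (N + 1), (m p : ℂ) * kappa (-m - k) p = 0) :
    ∀ i j : ℕ, i ≤ n → j ≤ n → ∀ m mm : MM N,
      comm (rhoH n N pos kappa lam i m) (rhoH n N pos kappa lam j mm)
        = (-(Acar n i j) * ∑ l : Fin (N + 1), (m l : ℂ) * kappa (-m - mm) l)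
            • (id : Fock n N pos → Fock n N pos) := by
  intro i j hi hj m mm
  choose L hL using exists_linearMap_rhoHn (n := n) (pos := pos) kappa lam
  have hrho : ∀ r m, rhoH n N pos kappa lam r m = affExt n (fun s => L s m) r := by
    intro r m
    funext w
    unfold rhoH affExt
    split_ifs <;> simp [hL]
  have h := affExt_commutator hn (L := fun s => L s m) (L' := fun s => L s mm)
    (S := ∑ l : Fin (N + 1), (m l : ℂ) * kappa (-m - mm) l) (fun a b ha hb => by
      refine LinearMap.ext fun w => ?_
      have hc := comm_rhoHn_apply (pos := pos) kappa lam ha hb m mm w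
      rw [phiCoeff_commutator htri hzero hdisj hE1 hE2 ha hb, hL, hL] at hc
      exact hc) hi hj
  funext w
  have hw := congrArg (fun T : Module.End ℂ (Fock n N pos) => T w) h
  rw [hrho, hrho]
  exact hw

end Stmt10
end
end

section
/- For all 0 ≤ r,s ≤ n and all m, n ∈ ℤ^{N+1}, [ρ(H_r)_m, ρ(E_s)_n] = Â_{rs} ρ(E_s)_{m+n} as operators on V. -/
noncomputable section

namespace Stmt11

/-- Multi-indices `m ∈ ℤ^{N+1}`. -/
abbrev MM (N : ℕ) := Fin (N + 1) → ℤ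

/-- Index type for the polynomial variables `x_{ij}(m)`, `1 ≤ i < j ≤ n+1`. -/
def XIdx (n N : ℕ) := {ij : ℕ × ℕ // 1 ≤ ij.1 ∧ ij.1 < ij.2 ∧ ij.2 ≤ n + 1} × MM N

/-- Index type for the polynomial variables `y_i(k)`, `1 ≤ i ≤ n`, `k > 0`. -/
def YIdx (n N : ℕ) (pos : MM N → Prop) :=
  {i : ℕ // 1 ≤ i ∧ i ≤ n} × {k : MM N // pos k}

/-- The Fock space `V = ℂ[x] ⊗ ℂ[y]`, realized as the polynomial ring in the
two (disjoint) families of variables. -/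
abbrev Fock (n N : ℕ) (pos : MM N → Prop) :=
  MvPolynomial (XIdx n N ⊕ YIdx n N pos) ℂ

/-- `a_{ij,m}`: multiplication by `-x_{ij}(m)` (and `0` for out-of-range indices). -/
def aop (n N : ℕ) (pos : MM N → Prop) (i j : ℕ) (m : MM N) :
    Fock n N pos → Fock n N pos := fun w =>
  if h : 1 ≤ i ∧ i < j ∧ j ≤ n + 1 then
    -(MvPolynomial.X (Sum.inl ((⟨(i, j), h⟩, m) : XIdx n N)) : Fock n N pos) * w
  else 0

/-- `a*_{ij,m}`: the partial derivative `∂/∂x_{ij}(-m)` (and `0` for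
out-of-range indices). -/
def astar (n N : ℕ) (pos : MM N → Prop) (i j : ℕ) (m : MM N) :
    Fock n N pos → Fock n N pos := fun w =>
  if h : 1 ≤ i ∧ i < j ∧ j ≤ n + 1 then
    MvPolynomial.pderiv (Sum.inl ((⟨(i, j), h⟩, -m) : XIdx n N)) w
  else 0

/-- `(κ·D a*_{ij})_v := Σ_{q ∈ ℤ^{N+1}} Σ_{p=0}^N κ_{q-v,p}(-q_p) a*_{ij,q}`,
a pointwise locally finite sum of operators. -/
def kD (n N : ℕ) (pos : MM N → Prop) (kappa : MM N → Fin (N + 1) → ℂ)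
    (i j : ℕ) (v : MM N) : Fock n N pos → Fock n N pos := fun w =>
  ∑ᶠ q : MM N,
    (∑ p : Fin (N + 1), kappa (q - v) p * (-(q p : ℂ))) • astar n N pos i j q w

open Classical in
/-- `θ(m) = 1` if `m > 0` and `0` otherwise. -/
def theta {N : ℕ} (pos : MM N → Prop) (m : MM N) : ℂ := if pos m then 1 else 0

open Classical in
/-- `∂/∂y_i(s)`, with the convention that it is `0` unless `1 ≤ i ≤ n` and `s > 0`. -/
def ydot (n N : ℕ) (pos : MM N → Prop) (i : ℕ) (s : MM N) :
    Fock n N pos → Fock n N pos := fun w =>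
  if h : (1 ≤ i ∧ i ≤ n) ∧ pos s then
    MvPolynomial.pderiv (Sum.inr ((⟨i, h.1⟩, ⟨s, h.2⟩) : YIdx n N pos)) w
  else 0

/-- `Σ_{p=0}^N m_p κ_{-m+s,p}`. -/
def cnum {N : ℕ} (kappa : MM N → Fin (N + 1) → ℂ) (m s : MM N) : ℂ :=
  ∑ p : Fin (N + 1), (m p : ℂ) * kappa (-m + s) p

open Classical in
/-- The operator `Φ(b_i(m))` (for `1 ≤ i ≤ n`), acting on `V`. -/
def Phi (n N : ℕ) (pos : MM N → Prop) (kappa : MM N → Fin (N + 1) → ℂ)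
    (lam : ℕ → ℂ) (i : ℕ) (m : MM N) : Fock n N pos → Fock n N pos := fun w =>
  theta pos (-m) • (∑ᶠ s : MM N, cnum kappa m s •
      (ydot n N pos (i - 1) s w - ydot n N pos i s w))
  + theta pos m • (∑ᶠ s : MM N, cnum kappa m s •
      (ydot n N pos (i - 1) s w - (2 : ℂ) • ydot n N pos i s w
        + ydot n N pos (i + 1) s w))
  + (if h : (1 ≤ i ∧ i ≤ n) ∧ pos (-m) then
      (MvPolynomial.X (Sum.inr ((⟨i, h.1⟩, ⟨-m, h.2⟩) : YIdx n N pos)) :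
          Fock n N pos) * w
    else 0)
  - (if m = 0 then lam i else 0) • w

/-- `Φ(b_0(m)) := -Σ_{i=1}^n Φ(b_i(m))`, and `Φ(b_i(m))` for `1 ≤ i ≤ n`. -/
def PhiHat (n N : ℕ) (pos : MM N → Prop) (kappa : MM N → Fin (N + 1) → ℂ)
    (lam : ℕ → ℂ) (i : ℕ) (m : MM N) : Fock n N pos → Fock n N pos :=
  if i = 0 then -(∑ r ∈ Finset.Icc 1 n, Phi n N pos kappa lam r m)
  else Phi n N pos kappa lam i m

/-- The `m`-th mode of the product of two families of operators:
`(XY)_m := Σ_{k+l=m} X_k Y_l` (pointwise locally finite sum). -/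
def fmul (n N : ℕ) (pos : MM N → Prop)
    (X Y : MM N → Fock n N pos → Fock n N pos) :
    MM N → Fock n N pos → Fock n N pos :=
  fun m w => ∑ᶠ k : MM N, X k (Y (m - k) w)

/-- Modewise product of a finite list of families of operators; the empty
product is the identity family (the delta family supported at `0`). -/
def fprod (n N : ℕ) (pos : MM N → Prop) :
    List (MM N → Fock n N pos → Fock n N pos) →
      MM N → Fock n N pos → Fock n N pos
  | [] => fun m w => if m = 0 then w else 0
  | X :: L => fmul n N pos X (fprod n N pos L)

/-- The affine Cartan matrix of type `A_n^{(1)}` (indices `0 ≤ i, j ≤ n`), as an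
integer matrix. -/
def AcarZ (n i j : ℕ) : ℤ :=
  if i = j then 2
  else if (i + 1) % (n + 1) = j % (n + 1) ∨ (j + 1) % (n + 1) = i % (n + 1) then -1
  else 0

/-- The affine Cartan matrix of type `A_n^{(1)}`, with complex entries. -/
def Acar (n i j : ℕ) : ℂ := (AcarZ n i j : ℂ)

/-- `ρ(F_r)_m` for `1 ≤ r ≤ n`. -/
def rhoF (n N : ℕ) (pos : MM N → Prop) (r : ℕ) (m : MM N) :
    Fock n N pos → Fock n N pos :=
  aop n N pos r (r + 1) m
    - ∑ j ∈ Finset.Ico 1 r, fmul n N pos (aop n N pos j (r + 1)) (astar n N pos j r) m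

/-- `ρ(H_r)_m` for `1 ≤ r ≤ n`. -/
def rhoHn (n N : ℕ) (pos : MM N → Prop) (kappa : MM N → Fin (N + 1) → ℂ)
    (lam : ℕ → ℂ) (r : ℕ) (m : MM N) : Fock n N pos → Fock n N pos :=
  (2 : ℂ) • fmul n N pos (aop n N pos r (r + 1)) (astar n N pos r (r + 1)) m
  + ∑ i ∈ Finset.Ico 1 r,
      (fmul n N pos (aop n N pos i (r + 1)) (astar n N pos i (r + 1)) m
        - fmul n N pos (aop n N pos i r) (astar n N pos i r) m)
  + ∑ j ∈ Finset.Icc (r + 2) (n + 1),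
      (fmul n N pos (aop n N pos r j) (astar n N pos r j) m
        - fmul n N pos (aop n N pos (r + 1) j) (astar n N pos (r + 1) j) m)
  + Phi n N pos kappa lam r m

/-- `ρ(H_r)_m` for `0 ≤ r ≤ n`, with `ρ(H_0)_m := -Σ_{r=1}^n ρ(H_r)_m`. -/
def rhoH (n N : ℕ) (pos : MM N → Prop) (kappa : MM N → Fin (N + 1) → ℂ)
    (lam : ℕ → ℂ) (r : ℕ) (m : MM N) : Fock n N pos → Fock n N pos :=
  if r = 0 then -(∑ s ∈ Finset.Icc 1 n, rhoHn n N pos kappa lam s m)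
  else rhoHn n N pos kappa lam r m

/-- `ρ(E_r)_m` for `1 ≤ r ≤ n`. -/
def rhoEn (n N : ℕ) (pos : MM N → Prop) (kappa : MM N → Fin (N + 1) → ℂ)
    (lam : ℕ → ℂ) (r : ℕ) (m : MM N) : Fock n N pos → Fock n N pos :=
  fmul n N pos (aop n N pos r (r + 1))
      (fmul n N pos (astar n N pos r (r + 1)) (astar n N pos r (r + 1))) m
  - ∑ j ∈ Finset.Icc (r + 2) (n + 1),
      fmul n N pos (aop n N pos (r + 1) j) (astar n N pos r j) m
  + ∑ j ∈ Finset.Ico 1 r,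
      fmul n N pos (aop n N pos j r) (astar n N pos j (r + 1)) m
  + ∑ j ∈ Finset.Icc (r + 2) (n + 1),
      (fmul n N pos (fmul n N pos (aop n N pos r j) (astar n N pos r j))
          (astar n N pos r (r + 1)) m
        - fmul n N pos (fmul n N pos (aop n N pos (r + 1) j) (astar n N pos (r + 1) j))
            (astar n N pos r (r + 1)) m)
  + fmul n N pos (astar n N pos r (r + 1)) (Phi n N pos kappa lam r) m
  + kD n N pos kappa r (r + 1) m

/-- `ρ(E_r)_m` for `0 ≤ r ≤ n`, with `ρ(E_0)_m := -a_{1,n+1;m}`. -/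
def rhoE (n N : ℕ) (pos : MM N → Prop) (kappa : MM N → Fin (N + 1) → ℂ)
    (lam : ℕ → ℂ) (r : ℕ) (m : MM N) : Fock n N pos → Fock n N pos :=
  if r = 0 then -(aop n N pos 1 (n + 1) m) else rhoEn n N pos kappa lam r m

/-- The strictly increasing sequence `1 = q_1 < q_2 < ⋯ < q_i` encoded by a
subset `s ⊆ {2,…,n+1}`, as the sorted list `1 :: sort s`. -/
def ql (s : Finset ℕ) : List ℕ := 1 :: s.sort (· ≤ ·)

/-- The last entry `q_i` of the sequence encoded by `s`. -/
def qend (s : Finset ℕ) : ℕ := ((ql s).getLast?).getD 0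

/-- The second-to-last entry `q_{i-1}` of the sequence encoded by `s`
(`0` if the sequence has length `1`, so that the condition `q_{i-1} ≤ r` is
vacuous in that case). -/
def qpen (s : Finset ℕ) : ℕ := (((ql s).dropLast).getLast?).getD 0

/-- The list of adjacent pairs `(q_l, q_{l+1})` of a list. -/
def qpairs (l : List ℕ) : List (ℕ × ℕ) := l.zip l.tail

/-- `ρ(F_0)_m`. -/
def rhoF0 (n N : ℕ) (pos : MM N → Prop) (kappa : MM N → Fin (N + 1) → ℂ)
    (lam : ℕ → ℂ) (m : MM N) : Fock n N pos → Fock n N pos :=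
  -(∑ r ∈ Finset.Icc 1 (n + 1), ∑ j ∈ Finset.Icc 1 (n + 1),
      ∑ s ∈ (Finset.Icc 2 (n + 1)).powerset,
        if r < j ∧ qend s = j ∧ qpen s ≤ r then
          fprod n N pos
            (aop n N pos r j ::
              ((qpairs (ql s)).map fun p => astar n N pos p.1 p.2)
                ++ [astar n N pos r (n + 1)]) m
        else 0)
  - (∑ r ∈ Finset.Icc 1 n, ∑ s ∈ (Finset.Icc 2 (n + 1)).powerset,
      if qend s ≤ r then
        fprod n N pos
          (((qpairs (ql s ++ [n + 1])).map fun p => astar n N pos p.1 p.2)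
            ++ [Phi n N pos kappa lam r]) m
      else 0)
  - (∑ r ∈ Finset.Icc 1 n, ∑ s ∈ (Finset.Icc 2 (n + 1)).powerset,
      if qend s = r then
        fprod n N pos
          (((qpairs (ql s)).map fun p => astar n N pos p.1 p.2)
            ++ [kD n N pos kappa r (n + 1)]) m
      else 0)

/-- `ρ(F_r)_m` for `0 ≤ r ≤ n`. -/
def rhoFa (n N : ℕ) (pos : MM N → Prop) (kappa : MM N → Fin (N + 1) → ℂ)
    (lam : ℕ → ℂ) (r : ℕ) (m : MM N) : Fock n N pos → Fock n N pos :=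
  if r = 0 then rhoF0 n N pos kappa lam m else rhoF n N pos r m

/-- The commutator of two operators. -/
def comm {V : Type*} [AddCommGroup V] (f g : V → V) : V → V :=
  fun w => f (g w) - g (f w)

section Helpers

open MvPolynomial

variable {n N : ℕ} {pos : MM N → Prop}

section LocallyFinite

variable {σ ι : Type*}

/-- A family of derivations of a polynomial ring which is locally finite on every variable is
pointwise locally finite. -/
theorem finite_support_derivation
    (Δ : ι → Derivation ℂ (MvPolynomial σ ℂ) (MvPolynomial σ ℂ))
    (hfin : ∀ s, (Function.support fun k => Δ k (X s)).Finite) (w : MvPolynomial σ ℂ) :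
    (Function.support fun k => Δ k w).Finite := by
  refine (Set.Finite.biUnion w.vars.finite_toSet fun s _ => hfin s).subset fun k hk => ?_
  by_contra hcon
  simp only [Finset.mem_coe, Set.mem_iUnion, Function.mem_support, exists_prop, not_exists,
    not_and, not_not] at hcon
  exact hk (derivation_eq_zero_of_forall_mem_vars hcon)

theorem sum_derivation_apply
    (Δ : ι → Derivation ℂ (MvPolynomial σ ℂ) (MvPolynomial σ ℂ)) (S : Finset ι)
    (w : MvPolynomial σ ℂ) : (∑ k ∈ S, Δ k) w = ∑ k ∈ S, Δ k w := by
  rw [← Derivation.coeFnAddMonoidHom_apply, map_sum, Finset.sum_apply]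
  rfl

/-- A locally finite sum of derivations of a polynomial ring is determined by its values on the
variables. -/
theorem finsum_derivation_eq
    (Δ : ι → Derivation ℂ (MvPolynomial σ ℂ) (MvPolynomial σ ℂ))
    (D : Derivation ℂ (MvPolynomial σ ℂ) (MvPolynomial σ ℂ))
    (hfin : ∀ s, (Function.support fun k => Δ k (X s)).Finite)
    (hsum : ∀ s, ∑ᶠ k, Δ k (X s) = D (X s)) (w : MvPolynomial σ ℂ) :
    ∑ᶠ k, Δ k w = D w := by
  classical
  have hS : (⋃ s ∈ (w.vars : Set σ), Function.support fun k => Δ k (X s)).Finite :=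
    Set.Finite.biUnion w.vars.finite_toSet fun s _ => hfin s
  have hsub := finite_support_derivation Δ hfin w
  set S := hS.toFinset ∪ hsub.toFinset with hSdef
  rw [finsum_eq_sum_of_support_subset (s := S) _ (by intro k hk; simp [hSdef]; right; exact hk)]
  have key : (∑ k ∈ S, Δ k) w = D w := by
    refine derivation_eq_of_forall_mem_vars fun s hs => ?_
    rw [← hsum s, finsum_eq_sum_of_support_subset (s := S), sum_derivation_apply]
    intro k hk
    simp only [hSdef, Finset.coe_union, Set.Finite.coe_toFinset, Set.mem_union, Set.mem_iUnion]
    exact Or.inl ⟨s, hs, hk⟩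
  rw [← key, sum_derivation_apply]

end LocallyFinite

/-- The variable `x_{ij}(l)`. -/
def xV (n N : ℕ) (pos : MM N → Prop) (i j : ℕ) (h : 1 ≤ i ∧ i < j ∧ j ≤ n + 1) (l : MM N) :
    Fock n N pos :=
  X (Sum.inl ((⟨(i, j), h⟩, l) : XIdx n N))

/-- The variable `y_i(s)`. -/
def yV (n N : ℕ) (pos : MM N → Prop) (i : ℕ) (h : 1 ≤ i ∧ i ≤ n) (s : MM N) (hs : pos s) :
    Fock n N pos :=
  X (Sum.inr ((⟨i, h⟩, ⟨s, hs⟩) : YIdx n N pos))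

theorem derivation_ext_xV_yV {D₁ D₂ : Derivation ℂ (Fock n N pos) (Fock n N pos)}
    (hx : ∀ i j h l, D₁ (xV n N pos i j h l) = D₂ (xV n N pos i j h l))
    (hy : ∀ i h s hs, D₁ (yV n N pos i h s hs) = D₂ (yV n N pos i h s hs)) : D₁ = D₂ := by
  refine derivation_ext fun s => ?_
  rcases s with ⟨⟨⟨i, j⟩, h⟩, l⟩ | ⟨⟨i, h⟩, ⟨s, hs⟩⟩
  exacts [hx i j h l, hy i h s hs]

/-- `finsum_derivation_eq` for families in which at most one member acts nontrivially on each
variable `x_{ij}(l)` or `y_i(s)`. -/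
theorem finsum_derivation_eq_of_single
    (Δ : MM N → Derivation ℂ (Fock n N pos) (Fock n N pos))
    (D : Derivation ℂ (Fock n N pos) (Fock n N pos)) (κ κ' : MM N → MM N)
    (hx : ∀ i j h l, Δ (κ l) (xV n N pos i j h l) = D (xV n N pos i j h l))
    (hx0 : ∀ i j h l k, k ≠ κ l → Δ k (xV n N pos i j h l) = 0)
    (hy : ∀ i h s hs, Δ (κ' s) (yV n N pos i h s hs) = D (yV n N pos i h s hs))
    (hy0 : ∀ i h s hs k, k ≠ κ' s → Δ k (yV n N pos i h s hs) = 0)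
    (w : Fock n N pos) : ∑ᶠ k, Δ k w = D w := by
  have key : ∀ t, ∃ k₀, (∀ k, k ≠ k₀ → Δ k (X t) = 0) ∧ Δ k₀ (X t) = D (X t) := by
    rintro (⟨⟨⟨i, j⟩, h⟩, l⟩ | ⟨⟨i, h⟩, ⟨s, hs⟩⟩)
    · exact ⟨κ l, hx0 i j h l, hx i j h l⟩
    · exact ⟨κ' s, hy0 i h s hs, hy i h s hs⟩
  refine finsum_derivation_eq Δ D (fun t => ?_) (fun t => ?_) w <;>
    obtain ⟨k₀, h0, h1⟩ := key t
  · refine (Set.finite_singleton k₀).subset fun k hk => ?_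
    by_contra hne
    exact hk (h0 k hne)
  · rw [finsum_eq_single _ k₀ h0, h1]

/-- The derivation with prescribed values on the variables `x_{ij}(l)` and `y_i(s)`. -/
def mkD (n N : ℕ) (pos : MM N → Prop)
    (fx : ∀ i j : ℕ, (1 ≤ i ∧ i < j ∧ j ≤ n + 1) → MM N → Fock n N pos)
    (fy : ℕ → MM N → Fock n N pos) : Derivation ℂ (Fock n N pos) (Fock n N pos) :=
  mkDerivation ℂ (Sum.elim (fun v => fx v.1.1.1 v.1.1.2 v.1.2 v.2) (fun v => fy v.1.1 v.2.1))

@[simp]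
theorem mkD_xV (fx : ∀ i j : ℕ, (1 ≤ i ∧ i < j ∧ j ≤ n + 1) → MM N → Fock n N pos)
    (fy : ℕ → MM N → Fock n N pos) (i j h l) :
    mkD n N pos fx fy (xV n N pos i j h l) = fx i j h l :=
  mkDerivation_X ..

@[simp]
theorem mkD_yV (fx : ∀ i j : ℕ, (1 ≤ i ∧ i < j ∧ j ≤ n + 1) → MM N → Fock n N pos)
    (fy : ℕ → MM N → Fock n N pos) (i h s hs) :
    mkD n N pos fx fy (yV n N pos i h s hs) = fy i s :=
  mkDerivation_X ..

/-- The derivation `a*_{ij,m}`. -/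
def astarD (n N : ℕ) (pos : MM N → Prop) (i j : ℕ) (m : MM N) :
    Derivation ℂ (Fock n N pos) (Fock n N pos) :=
  mkD n N pos (fun a b _ l => if (a = i ∧ b = j) ∧ l = -m then 1 else 0) (fun _ _ => 0)

theorem astar_eq (i j : ℕ) (m : MM N) : astar n N pos i j m = astarD n N pos i j m := by
  classical
  funext w
  by_cases h : 1 ≤ i ∧ i < j ∧ j ≤ n + 1
  · refine (dif_pos h).trans (DFunLike.congr_fun (derivation_ext_xV_yV ?_ ?_) w)
    · intro a b hab l
      simp only [astarD, mkD_xV]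
      refine ((pderiv_X _ _).trans (Pi.single_apply _ _ _)).trans ?_
      refine @if_congr _ _ _ (_) (_) _ _ _ _ ?_ rfl rfl
      exact Sum.inl_injective.eq_iff.trans
        (Prod.mk_inj.trans (and_congr (Subtype.mk_eq_mk.trans Prod.mk_inj) Iff.rfl))
    · intro a ha s hs
      simp only [astarD, mkD_yV]
      exact ((pderiv_X _ _).trans (Pi.single_apply _ _ _)).trans (if_neg Sum.inr_ne_inl)
  · refine (dif_neg h).trans ?_
    have : astarD n N pos i j m = 0 := by
      refine derivation_ext_xV_yV ?_ ?_
      · intro a b hab l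
        simp only [astarD, mkD_xV, Derivation.zero_apply]
        rw [if_neg]
        rintro ⟨⟨rfl, rfl⟩, -⟩
        exact h hab
      · simp [astarD]
    simp [this]

open Classical in
/-- The derivation `∂/∂y_i(s)`. -/
def ydotD (n N : ℕ) (pos : MM N → Prop) (i : ℕ) (s : MM N) :
    Derivation ℂ (Fock n N pos) (Fock n N pos) :=
  mkD n N pos (fun _ _ _ _ => 0) (fun a t => if a = i ∧ t = s then 1 else 0)

theorem ydot_eq (i : ℕ) (s : MM N) : ydot n N pos i s = ydotD n N pos i s := by
  classical
  funext w
  by_cases h : (1 ≤ i ∧ i ≤ n) ∧ pos s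
  · refine (dif_pos h).trans (DFunLike.congr_fun (derivation_ext_xV_yV ?_ ?_) w)
    · intro a b hab l
      simp only [ydotD, mkD_xV]
      exact ((pderiv_X _ _).trans (Pi.single_apply _ _ _)).trans (if_neg Sum.inl_ne_inr)
    · intro a ha t ht
      simp only [ydotD, mkD_yV]
      refine ((pderiv_X _ _).trans (Pi.single_apply _ _ _)).trans ?_
      refine @if_congr _ _ _ (_) (_) _ _ _ _ ?_ rfl rfl
      exact Sum.inr_injective.eq_iff.trans
        (Prod.mk_inj.trans (and_congr Subtype.mk_eq_mk Subtype.mk_eq_mk))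
  · refine (dif_neg h).trans ?_
    have : ydotD n N pos i s = 0 := by
      refine derivation_ext_xV_yV ?_ ?_
      · simp [ydotD]
      · intro a ha t ht
        simp only [ydotD, mkD_yV, Derivation.zero_apply]
        rw [if_neg]
        rintro ⟨rfl, rfl⟩
        exact h ⟨ha, ht⟩
    simp [this]

/-- The polynomial by which `a_{ij,m}` multiplies. -/
def aE (n N : ℕ) (pos : MM N → Prop) (i j : ℕ) (m : MM N) : Fock n N pos :=
  if h : 1 ≤ i ∧ i < j ∧ j ≤ n + 1 then -xV n N pos i j h m else 0

theorem aop_apply (i j : ℕ) (m : MM N) (w : Fock n N pos) :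
    aop n N pos i j m w = aE n N pos i j m * w := by
  unfold aop aE
  split_ifs
  · rfl
  · rw [zero_mul]

/-- The derivation `x_{ij}(l) ↦ -c_{ij} x_{ij}(l+m)`, `y_i(s) ↦ g_i(s)`. -/
def cartanD (n N : ℕ) (pos : MM N → Prop) (c : ℕ → ℕ → ℂ) (m : MM N) (g : ℕ → MM N → ℂ) :
    Derivation ℂ (Fock n N pos) (Fock n N pos) :=
  mkD n N pos (fun i j h l => -(c i j • xV n N pos i j h (l + m))) (fun i s => C (g i s))

theorem fmul_aop_astar (i j : ℕ) (m : MM N) (w : Fock n N pos) :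
    fmul n N pos (aop n N pos i j) (astar n N pos i j) m w
      = cartanD n N pos (fun a b => if a = i ∧ b = j then 1 else 0) m 0 w := by
  unfold fmul
  simp only [aop_apply, astar_eq]
  refine finsum_derivation_eq_of_single
    (fun k => aE n N pos i j k • astarD n N pos i j (m - k)) _ (fun l => l + m) 0 ?_ ?_ ?_ ?_ w
  · intro a b hab l
    simp only [Derivation.smul_apply, astarD, cartanD, mkD_xV]
    by_cases h : a = i ∧ b = j
    · obtain ⟨rfl, rfl⟩ := h
      simp [aE, hab]
    · simp [h]
  · intro a b hab l k hk
    simp only [Derivation.smul_apply, astarD, mkD_xV]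
    rw [if_neg, smul_zero]
    rintro ⟨-, rfl⟩
    exact hk (by abel)
  · simp [astarD, cartanD]
  · simp [astarD]

/-- The derivation `x_{ij}(l) ↦ c(l)`. -/
def xconstD (n N : ℕ) (pos : MM N → Prop) (i j : ℕ) (c : MM N → ℂ) :
    Derivation ℂ (Fock n N pos) (Fock n N pos) :=
  mkD n N pos (fun a b _ l => if a = i ∧ b = j then C (c l) else 0) (fun _ _ => 0)

theorem finsum_smul_astar (i j : ℕ) (c : MM N → ℂ) (w : Fock n N pos) :
    ∑ᶠ q, c q • astar n N pos i j q w = xconstD n N pos i j (fun l => c (-l)) w := by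
  simp only [astar_eq]
  refine finsum_derivation_eq_of_single
    (fun q => c q • astarD n N pos i j q) _ (fun l => -l) 0 ?_ ?_ ?_ ?_ w
  · intro a b hab l
    simp only [Derivation.smul_apply, astarD, xconstD, mkD_xV, neg_neg, and_true]
    split_ifs <;> simp [smul_eq_C_mul]
  · intro a b hab l k hk
    simp only [Derivation.smul_apply, astarD, mkD_xV]
    rw [if_neg, smul_zero]
    rintro ⟨-, rfl⟩
    exact hk (by simp)
  · simp [astarD, xconstD]
  · simp [astarD]

/-- The coefficient of `Σ_p m_p κ_{-m+s,p} ∂/∂y_a(s)` in `Φ(b_r(m))`. -/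
def phiG (pos : MM N → Prop) (kappa : MM N → Fin (N + 1) → ℂ) (r : ℕ) (m : MM N)
    (a : ℕ) (s : MM N) : ℂ :=
  theta pos (-m) * (cnum kappa m s * ((if a + 1 = r then 1 else 0) - (if a = r then 1 else 0)))
  + theta pos m * (cnum kappa m s * ((if a + 1 = r then 1 else 0)
      - 2 * (if a = r then 1 else 0) + (if a = r + 1 then 1 else 0)))

open Classical in
/-- The polynomial `y_r(k)`, or `0` if there is no such variable. -/
def yE (n N : ℕ) (pos : MM N → Prop) (r : ℕ) (k : MM N) : Fock n N pos :=
  if h : (1 ≤ r ∧ r ≤ n) ∧ pos k then yV n N pos r h.1 k h.2 else 0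

/-- The multiplication part of `Φ(b_r(m))`. -/
def phiF (n N : ℕ) (pos : MM N → Prop) (lam : ℕ → ℂ) (r : ℕ) (m : MM N) : Fock n N pos :=
  yE n N pos r (-m) - C (if m = 0 then lam r else 0)

/-- The operator with derivation part `cartanD` and multiplication part `phiF`. -/
def cartanOp (n N : ℕ) (pos : MM N → Prop) (kappa : MM N → Fin (N + 1) → ℂ) (lam : ℕ → ℂ)
    (c : ℕ → ℕ → ℂ) (r : ℕ) (m : MM N) : Fock n N pos →ₗ[ℂ] Fock n N pos :=
  (cartanD n N pos c m (phiG pos kappa r m)).toLinearMap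
    + LinearMap.mulLeft ℂ (phiF n N pos lam r m)

theorem cartanOp_apply (kappa : MM N → Fin (N + 1) → ℂ) (lam : ℕ → ℂ)
    (c : ℕ → ℕ → ℂ) (r : ℕ) (m : MM N) (w : Fock n N pos) :
    cartanOp n N pos kappa lam c r m w
      = cartanD n N pos c m (phiG pos kappa r m) w + phiF n N pos lam r m * w := rfl

/-- The derivation `y_a(s) ↦ g_a(s)`, as a locally finite sum of derivations `Δ s` concentrated on
the variables `y_a(s)`. -/
theorem finsum_eq_cartanD (Δ : MM N → Derivation ℂ (Fock n N pos) (Fock n N pos))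
    (m : MM N) (g : ℕ → MM N → ℂ) (hx : ∀ s i j h l, Δ s (xV n N pos i j h l) = 0)
    (hy : ∀ s i h t ht, Δ s (yV n N pos i h t ht) = if t = s then C (g i s) else 0)
    (w : Fock n N pos) :
    ∑ᶠ s, Δ s w = cartanD n N pos 0 m g w := by
  refine finsum_derivation_eq_of_single Δ _ 0 id ?_ ?_ ?_ ?_ w
  · simp [hx, cartanD]
  · simp [hx]
  · simp [hy, cartanD]
  · intro i h t ht k hk
    exact (hy k i h t ht).trans (if_neg (Ne.symm hk))

theorem Phi_eq (kappa : MM N → Fin (N + 1) → ℂ) (lam : ℕ → ℂ) {r : ℕ} (hr : 1 ≤ r)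
    (m : MM N) : Phi n N pos kappa lam r m = cartanOp n N pos kappa lam 0 r m := by
  classical
  funext w
  have hr' : ∀ a, a = r - 1 ↔ a + 1 = r := fun a => by omega
  have h1 : ∑ᶠ s, cnum kappa m s • (ydot n N pos (r - 1) s w - ydot n N pos r s w)
      = cartanD n N pos 0 m (fun a s => cnum kappa m s *
        ((if a + 1 = r then 1 else 0) - (if a = r then 1 else 0))) w := by
    simp only [ydot_eq]
    refine finsum_eq_cartanD (fun s => cnum kappa m s •
      (ydotD n N pos (r - 1) s - ydotD n N pos r s)) m _ ?_ ?_ w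
    · simp [ydotD]
    · intro s a ha t ht
      simp only [Derivation.smul_apply, Derivation.sub_apply, ydotD, mkD_yV, hr']
      by_cases hs : t = s <;> simp [hs, smul_eq_C_mul, apply_ite (C : ℂ → Fock n N pos)]
  have h2 : ∑ᶠ s, cnum kappa m s • (ydot n N pos (r - 1) s w - (2 : ℂ) • ydot n N pos r s w
        + ydot n N pos (r + 1) s w)
      = cartanD n N pos 0 m (fun a s => cnum kappa m s *
        ((if a + 1 = r then 1 else 0) - 2 * (if a = r then 1 else 0)
          + (if a = r + 1 then 1 else 0))) w := by
    simp only [ydot_eq]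
    refine finsum_eq_cartanD (fun s => cnum kappa m s • (ydotD n N pos (r - 1) s
      - (2 : ℂ) • ydotD n N pos r s + ydotD n N pos (r + 1) s)) m _ ?_ ?_ w
    · simp [ydotD]
    · intro s a ha t ht
      simp only [Derivation.smul_apply, Derivation.sub_apply, Derivation.add_apply, ydotD,
        mkD_yV, hr']
      by_cases hs : t = s
      · simp only [hs, and_true, if_true, smul_eq_C_mul, C_mul, C_add, C_sub,
          apply_ite (C : ℂ → Fock n N pos), C_0, C_1]
      · simp [hs]
  have h3 : cartanD n N pos 0 m (phiG pos kappa r m)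
      = theta pos (-m) • cartanD n N pos 0 m (fun a s => cnum kappa m s *
        ((if a + 1 = r then 1 else 0) - (if a = r then 1 else 0)))
      + theta pos m • cartanD n N pos 0 m (fun a s => cnum kappa m s *
        ((if a + 1 = r then 1 else 0) - 2 * (if a = r then 1 else 0)
          + (if a = r + 1 then 1 else 0))) := by
    refine derivation_ext_xV_yV ?_ ?_
    · simp [cartanD]
    · intro i h s hs
      simp only [cartanD, mkD_yV, Derivation.add_apply, Derivation.smul_apply, phiG, C_add, C_mul,
        smul_eq_C_mul]
  rw [cartanOp_apply, h3, Phi, h1, h2, Derivation.add_apply, Derivation.smul_apply,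
    Derivation.smul_apply, phiF, sub_mul, ← smul_eq_C_mul, yE]
  by_cases h : (1 ≤ r ∧ r ≤ n) ∧ pos (-m)
  · rw [dif_pos h, dif_pos h, yV]
    abel
  · rw [dif_neg h, dif_neg h]
    ring

theorem astarD_phiF (lam : ℕ → ℂ) (i j : ℕ) (k : MM N) (r : ℕ) (m : MM N) :
    astarD n N pos i j k (phiF n N pos lam r m) = 0 := by
  unfold phiF yE
  split_ifs <;> simp [astarD]

theorem xconstD_phiF (lam : ℕ → ℂ) (i j : ℕ) (c : MM N → ℂ) (r : ℕ) (m : MM N) :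
    xconstD n N pos i j c (phiF n N pos lam r m) = 0 := by
  unfold phiF yE
  split_ifs <;> simp [xconstD]

theorem cartanD_phiF (lam : ℕ → ℂ) (c : ℕ → ℕ → ℂ) (m : MM N) (g : ℕ → MM N → ℂ) {s : ℕ}
    (hs : 1 ≤ s) (hsn : s ≤ n) (k : MM N) :
    cartanD n N pos c m g (phiF n N pos lam s k) = C (theta pos (-k) * g s (-k)) := by
  unfold phiF yE theta
  by_cases h : pos (-k)
  · simp [h, hs, hsn, cartanD]
  · simp [h]

theorem cartanOp_astarD (kappa : MM N → Fin (N + 1) → ℂ) (lam : ℕ → ℂ) (c : ℕ → ℕ → ℂ) (r : ℕ)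
    (m : MM N) (i j : ℕ) (k : MM N) (w : Fock n N pos) :
    cartanOp n N pos kappa lam c r m (astarD n N pos i j k w)
      = astarD n N pos i j k (cartanOp n N pos kappa lam c r m w)
        + c i j • astarD n N pos i j (m + k) w := by
  have h : ⁅cartanD n N pos c m (phiG pos kappa r m), astarD n N pos i j k⁆
      = c i j • astarD n N pos i j (m + k) := by
    refine derivation_ext_xV_yV ?_ ?_
    · intro a b hab l
      have hl : l + m = -k ↔ l = -(m + k) :=
        ⟨fun h => by rw [neg_add, ← h]; abel, fun h => by rw [h]; abel⟩
      simp only [Derivation.commutator_apply, cartanD, astarD, mkD_xV, Derivation.smul_apply,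
        map_neg]
      split_ifs with h1 h2 h2 <;> simp_all
    · simp [Derivation.commutator_apply, cartanD, astarD]
  have hw := DFunLike.congr_fun h w
  rw [Derivation.commutator_apply, Derivation.smul_apply] at hw
  rw [← hw, cartanOp_apply, cartanOp_apply, map_add, Derivation.leibniz, astarD_phiF]
  simp only [smul_eq_mul]
  ring

theorem cartanOp_aE (kappa : MM N → Fin (N + 1) → ℂ) (lam : ℕ → ℂ) (c : ℕ → ℕ → ℂ) (r : ℕ)
    (m : MM N) (i j : ℕ) (k : MM N) (w : Fock n N pos) :
    cartanOp n N pos kappa lam c r m (aE n N pos i j k * w)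
      = aE n N pos i j k * cartanOp n N pos kappa lam c r m w
        + (-c i j) • (aE n N pos i j (m + k) * w) := by
  have h : cartanD n N pos c m (phiG pos kappa r m) (aE n N pos i j k)
      = (-c i j) • aE n N pos i j (m + k) := by
    unfold aE
    split_ifs
    · simp [cartanD, add_comm]
    · simp
  rw [cartanOp_apply, cartanOp_apply, Derivation.leibniz, h]
  simp only [smul_eq_C_mul, smul_eq_mul]
  ring

/-- The finite Cartan matrix entry `A_{rs}` of type `A`. -/
def finCar (r s : ℕ) : ℂ :=
  2 * (if s = r then 1 else 0) - (if s + 1 = r then 1 else 0) - (if s = r + 1 then 1 else 0)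

theorem cartanOp_cartanOp_zero (hdisj : ∀ a : MM N, pos a → ¬ pos (-a))
    (htri : ∀ a : MM N, pos a ∨ a = 0 ∨ pos (-a))
    (kappa : MM N → Fin (N + 1) → ℂ) (lam : ℕ → ℂ)
    (hE1 : ∀ m : MM N, ∑ p : Fin (N + 1), (m p : ℂ) * kappa m p = 0)
    (hE2 : ∀ m k : MM N, pos m → pos k →
      ∑ p : Fin (N + 1), (m p : ℂ) * kappa (-m - k) p = 0)
    (c : ℕ → ℕ → ℂ) {r s : ℕ} (hr : 1 ≤ r) (hrn : r ≤ n) (hs : 1 ≤ s) (hsn : s ≤ n)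
    (m k : MM N) (w : Fock n N pos) :
    cartanOp n N pos kappa lam c r m (cartanOp n N pos kappa lam 0 s k w)
      = cartanOp n N pos kappa lam 0 s k (cartanOp n N pos kappa lam c r m w)
        + (-(finCar r s * cnum kappa m (-k))) • w := by
  have h : ⁅cartanD n N pos c m (phiG pos kappa r m),
      cartanD n N pos 0 k (phiG pos kappa s k)⁆ = 0 := by
    refine derivation_ext_xV_yV ?_ ?_
    · simp [Derivation.commutator_apply, cartanD]
    · simp [Derivation.commutator_apply, cartanD]
  have hw := DFunLike.congr_fun h w
  rw [Derivation.commutator_apply, Derivation.zero_apply, sub_eq_zero] at hw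
  have hanti : cnum kappa k (-m) = -cnum kappa m (-k) := by
    have := hE1 (-m + -k)
    simp only [cnum, add_comm (-k) (-m)]
    rw [← add_eq_zero_iff_eq_neg, ← Finset.sum_add_distrib, ← neg_eq_zero, ← this,
      ← Finset.sum_neg_distrib]
    refine Finset.sum_congr rfl fun p _ => ?_
    simp
    ring
  have hsc : theta pos (-k) * phiG pos kappa r m s (-k)
      - theta pos (-m) * phiG pos kappa s k r (-m) = -(finCar r s * cnum kappa m (-k)) := by
    have e1 : (if r + 1 = s then (1 : ℂ) else 0) = if s = r + 1 then 1 else 0 :=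
      if_congr eq_comm rfl rfl
    have e2 : (if r = s + 1 then (1 : ℂ) else 0) = if s + 1 = r then 1 else 0 :=
      if_congr eq_comm rfl rfl
    have e3 : (if r = s then (1 : ℂ) else 0) = if s = r then 1 else 0 :=
      if_congr eq_comm rfl rfl
    simp only [phiG, finCar, hanti, e1, e2, e3]
    rcases htri m with hm | rfl | hm
    · have hm' := hdisj m hm
      rcases htri k with hk | rfl | hk
      · have hk' := hdisj k hk
        have : cnum kappa m (-k) = 0 := by
          rw [cnum, ← hE2 m k hm hk, sub_eq_add_neg]
        simp [theta, hm, hm', hk, hk', this]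
      · have : cnum kappa m 0 = 0 := by
          have := hE1 (-m)
          simpa [cnum] using this
        simp [theta, this]
      · have hk' : ¬ pos k := fun h => hdisj _ h hk
        simp only [theta, hm, hm', hk, hk', if_true, if_false]
        ring
    · have : cnum kappa 0 (-k) = 0 := by simp [cnum]
      simp [theta, this]
    · have hm' : ¬ pos m := fun h => hdisj _ h hm
      rcases htri k with hk | rfl | hk
      · have hk' := hdisj k hk
        simp only [theta, hm, hm', hk, hk', if_true, if_false]
        ring
      · have : cnum kappa m 0 = 0 := by
          have := hE1 (-m)
          simpa [cnum] using this
        simp [theta, this]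
      · have hk' : ¬ pos k := fun h => hdisj _ h hk
        simp only [theta, hm, hm', hk, hk', if_true, if_false]
        ring
  simp only [cartanOp_apply, map_add, Derivation.leibniz, hw, smul_eq_mul,
    cartanD_phiF _ _ _ _ hs hsn, cartanD_phiF _ _ _ _ hr hrn, smul_eq_C_mul, ← hsc, map_sub]
  ring

theorem kD_eq (kappa : MM N → Fin (N + 1) → ℂ) (i j : ℕ) (v : MM N) (w : Fock n N pos) :
    kD n N pos kappa i j v w
      = xconstD n N pos i j (fun l => ∑ p, kappa (-l - v) p * (l p : ℂ)) w := by
  unfold kD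
  rw [finsum_smul_astar]
  simp

theorem cartanOp_xconstD (kappa : MM N → Fin (N + 1) → ℂ) (lam : ℕ → ℂ) (c : ℕ → ℕ → ℂ) (r : ℕ)
    (m : MM N) (i j : ℕ) (e : MM N → ℂ) (w : Fock n N pos) :
    cartanOp n N pos kappa lam c r m (xconstD n N pos i j e w)
      = xconstD n N pos i j e (cartanOp n N pos kappa lam c r m w)
        + c i j • xconstD n N pos i j (fun l => e (l + m)) w := by
  have h : ⁅cartanD n N pos c m (phiG pos kappa r m), xconstD n N pos i j e⁆
      = c i j • xconstD n N pos i j (fun l => e (l + m)) := by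
    refine derivation_ext_xV_yV ?_ ?_
    · intro a b hab l
      simp only [Derivation.commutator_apply, cartanD, xconstD, mkD_xV, Derivation.smul_apply,
        map_neg]
      split_ifs with h1 <;> simp_all
    · simp [Derivation.commutator_apply, cartanD, xconstD]
  have hw := DFunLike.congr_fun h w
  rw [Derivation.commutator_apply, Derivation.smul_apply] at hw
  rw [← hw, cartanOp_apply, cartanOp_apply, map_add, Derivation.leibniz, xconstD_phiF]
  simp only [smul_eq_mul]
  ring

/-- The commutation relation `[H, X_k] = c X_{m+k}` for a family `X`. -/
def Shifts (H : Fock n N pos →ₗ[ℂ] Fock n N pos) (m : MM N) (c : ℂ)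
    (X : MM N → Fock n N pos → Fock n N pos) : Prop :=
  ∀ k w, H (X k w) = X k (H w) + c • X (m + k) w

theorem Shifts.add {H : Fock n N pos →ₗ[ℂ] Fock n N pos} {m : MM N} {c : ℂ}
    {X Y : MM N → Fock n N pos → Fock n N pos} (hX : Shifts H m c X) (hY : Shifts H m c Y) :
    Shifts H m c (X + Y) := by
  intro k w
  simp only [Pi.add_apply, map_add, hX k w, hY k w, smul_add]
  abel

theorem Shifts.neg {H : Fock n N pos →ₗ[ℂ] Fock n N pos} {m : MM N} {c : ℂ}
    {X : MM N → Fock n N pos → Fock n N pos} (hX : Shifts H m c X) : Shifts H m c (-X) := by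
  intro k w
  simp only [Pi.neg_apply, map_neg, hX k w, smul_neg, neg_add]

theorem Shifts.sub {H : Fock n N pos →ₗ[ℂ] Fock n N pos} {m : MM N} {c : ℂ}
    {X Y : MM N → Fock n N pos → Fock n N pos} (hX : Shifts H m c X) (hY : Shifts H m c Y) :
    Shifts H m c (X - Y) :=
  sub_eq_add_neg X Y ▸ hX.add hY.neg

theorem Shifts.sum {ι : Type*} {H : Fock n N pos →ₗ[ℂ] Fock n N pos} {m : MM N} {c : ℂ}
    {X : ι → MM N → Fock n N pos → Fock n N pos} (S : Finset ι)
    (hX : ∀ i ∈ S, Shifts H m c (X i)) : Shifts H m c (∑ i ∈ S, X i) := by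
  intro k w
  simp only [Finset.sum_apply, map_sum, Finset.smul_sum, ← Finset.sum_add_distrib]
  exact Finset.sum_congr rfl fun i hi => hX i hi k w

/-- Pointwise local finiteness of a family of operators. -/
def LocFin (Y : MM N → Fock n N pos → Fock n N pos) : Prop :=
  ∀ w, (Function.support fun k => Y k w).Finite

/-- Pointwise local finiteness of the sums defining the modes of a product. -/
def LocFinPair (X Y : MM N → Fock n N pos → Fock n N pos) : Prop :=
  ∀ m w, (Function.support fun k => X k (Y (m - k) w)).Finite

/-- Each member of the family is a linear operator. -/
def LinFam (X : MM N → Fock n N pos → Fock n N pos) : Prop := ∀ k, IsLinearMap ℂ (X k)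

theorem LocFin.pair {X Y : MM N → Fock n N pos → Fock n N pos} (hX : LinFam X)
    (hY : LocFin Y) : LocFinPair X Y := by
  intro m w
  refine ((hY w).image fun k => m - k).subset fun k hk => ⟨m - k, fun h0 => hk ?_, by simp⟩
  change Y (m - k) w = 0 at h0
  simp [h0, (hX k).map_zero]

theorem LocFin.fmul {X Y : MM N → Fock n N pos → Fock n N pos} (hX : LinFam X)
    (hXf : LocFin X) (hY : LocFin Y) : LocFin (fmul n N pos X Y) := by
  intro w
  refine ((hY w).biUnion fun l _ => (hXf (Y l w)).image fun k => k + l).subset fun m hm => ?_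
  have : ∃ k, X k (Y (m - k) w) ≠ 0 := by
    by_contra hcon
    push Not at hcon
    exact hm (by simp [Stmt11.fmul, hcon])
  obtain ⟨k, hk⟩ := this
  refine Set.mem_biUnion (x := m - k) (fun h0 => hk ?_) ⟨k, hk, by simp⟩
  change Y (m - k) w = 0 at h0
  rw [h0, (hX k).map_zero]

theorem LinFam.fmul {X Y : MM N → Fock n N pos → Fock n N pos} (hX : LinFam X)
    (hY : LinFam Y) (hf : LocFinPair X Y) : LinFam (fmul n N pos X Y) := by
  intro m
  constructor
  · intro v w
    simp only [Stmt11.fmul, (hY _).map_add, (hX _).map_add]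
    exact finsum_add_distrib (hf m v) (hf m w)
  · intro c w
    simp only [Stmt11.fmul, (hY _).map_smul, (hX _).map_smul]
    exact (smul_finsum c _).symm

/-- The commutator with `H` acts on products of families as a derivation, up to a central term
in the second factor. -/
theorem fmul_commutation {H : Fock n N pos →ₗ[ℂ] Fock n N pos} {m : MM N} {c d : ℂ}
    {X Y : MM N → Fock n N pos → Fock n N pos} (κ : MM N → ℂ) (hXl : LinFam X)
    (hf : LocFinPair X Y) (hX : Shifts H m c X)
    (hY : ∀ k w, H (Y k w) = Y k (H w) + d • Y (m + k) w + κ k • w)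
    (hκ : ∀ l w, (Function.support fun k => κ (l - k) • X k w).Finite) (l : MM N)
    (w : Fock n N pos) :
    H (fmul n N pos X Y l w) = fmul n N pos X Y l (H w) + (c + d) • fmul n N pos X Y (m + l) w
      + ∑ᶠ k, κ (l - k) • X k w := by
  have hmap : H (fmul n N pos X Y l w) = ∑ᶠ k, H (X k (Y (l - k) w)) :=
    H.toAddMonoidHom.map_finsum (hf l w)
  have e1 : fmul n N pos X Y (m + l) w = ∑ᶠ k, X (m + k) (Y (l - k) w) := by
    rw [fmul, ← finsum_comp_equiv (Equiv.addLeft m)]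
    simp
  have f1 : (Function.support fun k => X (m + k) (Y (l - k) w)).Finite := by
    refine ((hf (m + l) w).preimage (f := fun k => m + k)
      (add_right_injective m).injOn).subset fun k hk => ?_
    simpa using hk
  have f2 : (Function.support fun k => X k (Y (m + (l - k)) w)).Finite := by
    simpa only [add_sub_assoc] using hf (m + l) w
  have e2 : fmul n N pos X Y (m + l) w = ∑ᶠ k, X k (Y (m + (l - k)) w) := by
    simp only [fmul, add_sub_assoc]
  have smulfin : ∀ (a : ℂ) {g : MM N → Fock n N pos}, (Function.support g).Finite →
      (Function.support fun k => a • g k).Finite := fun a g hg =>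
    hg.subset (Function.support_const_smul_subset a g)
  rw [hmap, add_smul]
  nth_rewrite 1 [e1]
  rw [e2, smul_finsum, smul_finsum, fmul,
    ← finsum_add_distrib (smulfin c f1) (smulfin d f2),
    ← finsum_add_distrib (hf l (H w)) (((smulfin c f1).union (smulfin d f2)).subset
      (Function.support_add _ _)),
    ← finsum_add_distrib (((hf l (H w)).union (((smulfin c f1).union (smulfin d f2)).subset
      (Function.support_add _ _))).subset (Function.support_add _ _)) (hκ l w)]
  refine finsum_congr fun k => ?_
  rw [hX, hY, (hXl k).map_add, (hXl k).map_add, (hXl k).map_smul, (hXl k).map_smul]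
  abel

theorem Shifts.fmul {H : Fock n N pos →ₗ[ℂ] Fock n N pos} {m : MM N} {c d e : ℂ}
    {X Y : MM N → Fock n N pos → Fock n N pos} (hX : Shifts H m c X) (hY : Shifts H m d Y)
    (hXl : LinFam X) (hf : LocFinPair X Y) (he : c + d = e) :
    Shifts H m e (fmul n N pos X Y) := by
  intro l w
  have := fmul_commutation (d := d) 0 hXl hf hX (fun k w => by simpa using hY k w) (by simp) l w
  simpa [he] using this
theorem linFam_aop (i j : ℕ) : LinFam (aop n N pos i j) := fun k =>
  ⟨fun v w => by simp only [aop_apply, mul_add], fun c w => by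
    simp only [aop_apply, mul_smul_comm]⟩

theorem linFam_astar (i j : ℕ) : LinFam (astar n N pos i j) := fun k => by
  rw [astar_eq]
  exact (astarD n N pos i j k).toLinearMap.isLinear

theorem linFam_Phi (kappa : MM N → Fin (N + 1) → ℂ) (lam : ℕ → ℂ) {s : ℕ} (hs : 1 ≤ s) :
    LinFam (Phi n N pos kappa lam s) := fun k => by
  rw [Phi_eq kappa lam hs]
  exact (cartanOp n N pos kappa lam 0 s k).isLinear

theorem linFam_kD (kappa : MM N → Fin (N + 1) → ℂ) (i j : ℕ) :
    LinFam (kD n N pos kappa i j) := fun k => by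
  rw [funext (kD_eq kappa i j k)]
  exact (xconstD n N pos i j _).toLinearMap.isLinear

theorem LinFam.add {X Y : MM N → Fock n N pos → Fock n N pos} (hX : LinFam X) (hY : LinFam Y) :
    LinFam (X + Y) := fun k =>
  ⟨fun v w => by simp only [Pi.add_apply, (hX k).map_add, (hY k).map_add]; abel,
    fun c w => by simp only [Pi.add_apply, (hX k).map_smul, (hY k).map_smul, smul_add]⟩

theorem LinFam.neg {X : MM N → Fock n N pos → Fock n N pos} (hX : LinFam X) :
    LinFam (-X) := fun k =>
  ⟨fun v w => by simp only [Pi.neg_apply, (hX k).map_add, neg_add],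
    fun c w => by simp only [Pi.neg_apply, (hX k).map_smul, smul_neg]⟩

theorem LinFam.sub {X Y : MM N → Fock n N pos → Fock n N pos} (hX : LinFam X) (hY : LinFam Y) :
    LinFam (X - Y) := sub_eq_add_neg X Y ▸ hX.add hY.neg

theorem LinFam.sum {ι : Type*} {X : ι → MM N → Fock n N pos → Fock n N pos} (S : Finset ι)
    (hX : ∀ i ∈ S, LinFam (X i)) : LinFam (∑ i ∈ S, X i) := fun k => by
  constructor
  · intro v w
    simp only [Finset.sum_apply, ← Finset.sum_add_distrib]
    exact Finset.sum_congr rfl fun i hi => (hX i hi k).map_add v w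
  · intro c w
    simp only [Finset.sum_apply, Finset.smul_sum]
    exact Finset.sum_congr rfl fun i hi => (hX i hi k).map_smul c w

theorem locFin_astar (i j : ℕ) : LocFin (astar n N pos i j) := by
  intro w
  simp only [astar_eq]
  refine finite_support_derivation (fun k => astarD n N pos i j k) (fun t => ?_) w
  have key : ∃ k₀, ∀ k, k ≠ k₀ → astarD n N pos i j k (X t) = 0 := by
    rcases t with ⟨⟨⟨a, b⟩, h⟩, l⟩ | ⟨⟨a, h⟩, ⟨s, hs⟩⟩
    · refine ⟨-l, fun k hk => (mkD_xV _ _ a b h l).trans (if_neg ?_)⟩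
      rintro ⟨-, rfl⟩
      exact hk (by simp)
    · exact ⟨0, fun k _ => mkD_yV _ _ a h s hs⟩
  obtain ⟨k₀, h0⟩ := key
  refine (Set.finite_singleton k₀).subset fun k hk => ?_
  by_contra hne
  exact hk (h0 k hne)

theorem locFinPair_astar_Phi (kappa : MM N → Fin (N + 1) → ℂ) (lam : ℕ → ℂ) (i j : ℕ) {s : ℕ}
    (hs : 1 ≤ s) : LocFinPair (astar n N pos i j) (Phi n N pos kappa lam s) := by
  intro m w
  refine (locFin_astar i j w).subset fun k hk h0 => hk ?_
  have := cartanOp_astarD kappa lam 0 s (m - k) i j k w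
  change astar n N pos i j k w = 0 at h0
  rw [← Phi_eq kappa lam hs, ← astar_eq] at this
  simp only [Pi.zero_apply, zero_smul, add_zero] at this
  simp only [← this, h0, (linFam_Phi kappa lam hs _).map_zero]

/-- The weight of `a*_{ij}` under `H_r`. -/
def wt (r i j : ℕ) : ℂ :=
  ((if i = r then 1 else 0) - (if i = r + 1 then 1 else 0))
    - ((if j = r then 1 else 0) - (if j = r + 1 then 1 else 0))

theorem wt_succ (r s : ℕ) : wt r s (s + 1) = finCar r s := by
  simp only [wt, finCar, add_left_inj]
  ring

theorem rhoHn_eq (kappa : MM N → Fin (N + 1) → ℂ) (lam : ℕ → ℂ) {r : ℕ} (hr : 1 ≤ r)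
    (hrn : r ≤ n) (m : MM N) :
    rhoHn n N pos kappa lam r m = cartanOp n N pos kappa lam (wt r) r m := by
  funext w
  have hD : cartanD n N pos (wt r) m (phiG pos kappa r m)
      = (2 : ℂ) • cartanD n N pos (fun a b => if a = r ∧ b = r + 1 then 1 else 0) m 0
      + ∑ i ∈ Finset.Ico 1 r,
        (cartanD n N pos (fun a b => if a = i ∧ b = r + 1 then 1 else 0) m 0
          - cartanD n N pos (fun a b => if a = i ∧ b = r then 1 else 0) m 0)
      + ∑ j ∈ Finset.Icc (r + 2) (n + 1),
        (cartanD n N pos (fun a b => if a = r ∧ b = j then 1 else 0) m 0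
          - cartanD n N pos (fun a b => if a = r + 1 ∧ b = j then 1 else 0) m 0)
      + cartanD n N pos 0 m (phiG pos kappa r m) := by
    refine derivation_ext_xV_yV ?_ ?_
    · intro a b hab l
      simp only [Derivation.add_apply, Derivation.smul_apply, sum_derivation_apply,
        Derivation.sub_apply, cartanD, mkD_xV, ← neg_smul, ← sub_smul, ← Finset.sum_smul,
        smul_smul, ← add_smul, Pi.zero_apply]
      congr 1
      have e1 : ∀ c d : ℕ, ∑ i ∈ Finset.Ico c d, (if a = i then (1 : ℂ) else 0)
          = if c ≤ a ∧ a < d then 1 else 0 := fun c d => by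
        simp [Finset.sum_ite_eq]
      have e2 : ∀ c d : ℕ, ∑ i ∈ Finset.Icc c d, (if b = i then (1 : ℂ) else 0)
          = if c ≤ b ∧ b ≤ d then 1 else 0 := fun c d => by
        simp [Finset.sum_ite_eq]
      have e : ∀ c d : ℕ, (if a = c ∧ b = d then (1 : ℂ) else 0)
          = (if a = c then 1 else 0) * (if b = d then 1 else 0) := fun c d => by
        rw [ite_and, ite_mul, one_mul, zero_mul]
      simp only [e, Finset.sum_sub_distrib, Finset.sum_neg_distrib, ← Finset.sum_mul,
        ← Finset.mul_sum, e1, e2, wt]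
      split_ifs <;> first | omega | norm_num
    · simp [cartanD, sum_derivation_apply]
  rw [cartanOp_apply, hD]
  simp only [rhoHn, Pi.add_apply, Pi.smul_apply, Finset.sum_apply, Pi.sub_apply, fmul_aop_astar,
    Phi_eq kappa lam hr, cartanOp_apply, Derivation.add_apply, Derivation.smul_apply,
    sum_derivation_apply, Derivation.sub_apply, add_assoc]

theorem rhoEn_eq (kappa : MM N → Fin (N + 1) → ℂ) (lam : ℕ → ℂ) (r : ℕ) :
    rhoEn n N pos kappa lam r =
      fmul n N pos (aop n N pos r (r + 1))
        (fmul n N pos (astar n N pos r (r + 1)) (astar n N pos r (r + 1)))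
      - ∑ j ∈ Finset.Icc (r + 2) (n + 1),
        fmul n N pos (aop n N pos (r + 1) j) (astar n N pos r j)
      + ∑ j ∈ Finset.Ico 1 r,
        fmul n N pos (aop n N pos j r) (astar n N pos j (r + 1))
      + ∑ j ∈ Finset.Icc (r + 2) (n + 1),
        (fmul n N pos (fmul n N pos (aop n N pos r j) (astar n N pos r j))
            (astar n N pos r (r + 1))
          - fmul n N pos (fmul n N pos (aop n N pos (r + 1) j) (astar n N pos (r + 1) j))
            (astar n N pos r (r + 1)))
      + (fmul n N pos (astar n N pos r (r + 1)) (Phi n N pos kappa lam r)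
        + kD n N pos kappa r (r + 1)) := by
  funext m
  simp only [rhoEn, Pi.add_apply, Pi.sub_apply, Finset.sum_apply, add_assoc]

theorem linFam_rhoE (kappa : MM N → Fin (N + 1) → ℂ) (lam : ℕ → ℂ) (s : ℕ) :
    LinFam (rhoE n N pos kappa lam s) := by
  intro k
  unfold rhoE
  split_ifs with h0
  · exact (linFam_aop 1 (n + 1)).neg k
  · have hs : 1 ≤ s := Nat.one_le_iff_ne_zero.mpr h0
    rw [rhoEn_eq]
    have hnum : ∀ i j a b, LinFam (fmul n N pos (aop n N pos i j) (astar n N pos a b)) :=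
      fun i j a b => (linFam_aop i j).fmul (linFam_astar a b) ((locFin_astar a b).pair
        (linFam_aop i j))
    refine (((((LinFam.fmul (linFam_aop _ _) (LinFam.fmul (linFam_astar _ _) (linFam_astar _ _)
      ((locFin_astar _ _).pair (linFam_astar _ _))) (((locFin_astar _ _).fmul (linFam_astar _ _)
      (locFin_astar _ _)).pair (linFam_aop _ _))).sub (LinFam.sum _ fun j _ => hnum _ _ _ _)).add
      (LinFam.sum _ fun j _ => hnum _ _ _ _)).add (LinFam.sum _ fun j _ => LinFam.sub ?_ ?_)).add
      (LinFam.add ((linFam_astar _ _).fmul (linFam_Phi kappa lam hs)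
        (locFinPair_astar_Phi kappa lam _ _ hs)) (linFam_kD kappa _ _))) k
    · exact (hnum _ _ _ _).fmul (linFam_astar _ _) ((locFin_astar _ _).pair (hnum _ _ _ _))
    · exact (hnum _ _ _ _).fmul (linFam_astar _ _) ((locFin_astar _ _).pair (hnum _ _ _ _))

theorem shifts_aop (kappa : MM N → Fin (N + 1) → ℂ) (lam : ℕ → ℂ) (c : ℕ → ℕ → ℂ) (r : ℕ)
    (m : MM N) (i j : ℕ) :
    Shifts (cartanOp n N pos kappa lam c r m) m (-c i j) (aop n N pos i j) := by
  intro k w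
  simp only [aop_apply, cartanOp_aE]

theorem shifts_astar (kappa : MM N → Fin (N + 1) → ℂ) (lam : ℕ → ℂ) (c : ℕ → ℕ → ℂ) (r : ℕ)
    (m : MM N) (i j : ℕ) :
    Shifts (cartanOp n N pos kappa lam c r m) m (c i j) (astar n N pos i j) := by
  intro k w
  simp only [astar_eq, cartanOp_astarD]

theorem shifts_astar_Phi_add_kD (hdisj : ∀ a : MM N, pos a → ¬ pos (-a))
    (htri : ∀ a : MM N, pos a ∨ a = 0 ∨ pos (-a))
    (kappa : MM N → Fin (N + 1) → ℂ) (lam : ℕ → ℂ)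
    (hE1 : ∀ m : MM N, ∑ p : Fin (N + 1), (m p : ℂ) * kappa m p = 0)
    (hE2 : ∀ m k : MM N, pos m → pos k →
      ∑ p : Fin (N + 1), (m p : ℂ) * kappa (-m - k) p = 0)
    {r s : ℕ} (hr : 1 ≤ r) (hrn : r ≤ n) (hs : 1 ≤ s) (hsn : s ≤ n) (m : MM N) :
    Shifts (cartanOp n N pos kappa lam (wt r) r m) m (finCar r s)
      (fmul n N pos (astar n N pos s (s + 1)) (Phi n N pos kappa lam s)
        + kD n N pos kappa s (s + 1)) := by
  intro l w
  have hfin : ∀ l w, (Function.support fun k => (-(finCar r s * cnum kappa m (-(l - k)))) •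
      astar n N pos s (s + 1) k w).Finite := fun l w =>
    (locFin_astar s (s + 1) w).subset fun k hk h0 => hk (by
      change astar n N pos s (s + 1) k w = 0 at h0
      simp only [h0, smul_zero])
  have hΦ := fmul_commutation (d := 0) (H := cartanOp n N pos kappa lam (wt r) r m)
    (fun k => -(finCar r s * cnum kappa m (-k)))
    (linFam_astar s (s + 1)) (locFinPair_astar_Phi kappa lam s (s + 1) hs)
    (shifts_astar kappa lam (wt r) r m s (s + 1))
    (fun k w => by
      rw [Phi_eq kappa lam hs, cartanOp_cartanOp_zero hdisj htri kappa lam hE1 hE2 (wt r)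
        hr hrn hs hsn, zero_smul, add_zero]) hfin l w
  simp only [Pi.add_apply, map_add, hΦ, kD_eq, cartanOp_xconstD, wt_succ, add_zero,
    finsum_smul_astar]
  have hanom : finCar r s • xconstD n N pos s (s + 1)
        (fun l' => ∑ p, kappa (-(l' + m) - l) p * ((l' + m) p : ℂ))
      = finCar r s • xconstD n N pos s (s + 1)
        (fun l' => ∑ p, kappa (-l' - (m + l)) p * (l' p : ℂ))
      - xconstD n N pos s (s + 1) (fun l' => -(finCar r s * cnum kappa m (-(l - -l')))) := by
    refine derivation_ext_xV_yV ?_ ?_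
    · intro a b hab l'
      simp only [Derivation.smul_apply, Derivation.sub_apply, xconstD, mkD_xV]
      split_ifs
      · simp only [smul_eq_C_mul, ← C_mul, ← C_sub]
        congr 1
        simp only [cnum, sub_neg_eq_add, ← mul_add, ← Finset.sum_add_distrib]
        congr 1
        refine Finset.sum_congr rfl fun p _ => ?_
        have h1 : -(l' + m) - l = -l' - (m + l) := by abel
        have h2 : -m + -(l + l') = -l' - (m + l) := by abel
        rw [h1, h2]
        simp
        ring
      · simp
    · simp [xconstD]
  have hw := DFunLike.congr_fun hanom w
  simp only [Derivation.smul_apply, Derivation.sub_apply, Pi.add_apply] at hw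
  rw [hw, smul_add]
  abel

theorem rhoHn_rhoE (hdisj : ∀ a : MM N, pos a → ¬ pos (-a))
    (htri : ∀ a : MM N, pos a ∨ a = 0 ∨ pos (-a))
    (kappa : MM N → Fin (N + 1) → ℂ) (lam : ℕ → ℂ)
    (hE1 : ∀ m : MM N, ∑ p : Fin (N + 1), (m p : ℂ) * kappa m p = 0)
    (hE2 : ∀ m k : MM N, pos m → pos k →
      ∑ p : Fin (N + 1), (m p : ℂ) * kappa (-m - k) p = 0)
    {r s : ℕ} (hr : 1 ≤ r) (hrn : r ≤ n) (hsn : s ≤ n) (m : MM N) :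
    Shifts (cartanOp n N pos kappa lam (wt r) r m) m
      (if s = 0 then -wt r 1 (n + 1) else finCar r s) (rhoE n N pos kappa lam s) := by
  by_cases h0 : s = 0
  · rw [if_pos h0]
    have : rhoE n N pos kappa lam s = -aop n N pos 1 (n + 1) := by
      funext k
      simp [rhoE, h0]
    rw [this]
    exact (shifts_aop kappa lam (wt r) r m 1 (n + 1)).neg
  have hs : 1 ≤ s := Nat.one_le_iff_ne_zero.mpr h0
  rw [if_neg h0]
  have : rhoE n N pos kappa lam s = rhoEn n N pos kappa lam s := by
    funext k
    simp [rhoE, h0]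
  rw [this, rhoEn_eq]
  have ha := shifts_aop (n := n) (pos := pos) kappa lam (wt r) r m
  have hb := shifts_astar (n := n) (pos := pos) kappa lam (wt r) r m
  have hab : ∀ i j a b {e : ℂ}, -wt r i j + wt r a b = e →
      Shifts (cartanOp n N pos kappa lam (wt r) r m) m e
        (fmul n N pos (aop n N pos i j) (astar n N pos a b)) := fun i j a b e he =>
    (ha i j).fmul (hb a b) (linFam_aop i j) ((locFin_astar a b).pair (linFam_aop i j)) he
  have hnum : ∀ i j a b, LinFam (fmul n N pos (aop n N pos i j) (astar n N pos a b)) :=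
    fun i j a b => (linFam_aop i j).fmul (linFam_astar a b) ((locFin_astar a b).pair
      (linFam_aop i j))
  have hcubic : ∀ i j, Shifts (cartanOp n N pos kappa lam (wt r) r m) m (finCar r s)
      (fmul n N pos (fmul n N pos (aop n N pos i j) (astar n N pos i j))
        (astar n N pos s (s + 1))) := fun i j =>
    (hab i j i j (neg_add_cancel _)).fmul (hb s (s + 1)) (hnum _ _ _ _)
      ((locFin_astar _ _).pair (hnum _ _ _ _)) (by rw [wt_succ, zero_add])
  refine ((((Shifts.fmul (ha _ _) (Shifts.fmul (hb _ _) (hb _ _) (linFam_astar _ _)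
    ((locFin_astar _ _).pair (linFam_astar _ _)) rfl) (linFam_aop _ _)
    (((locFin_astar _ _).fmul (linFam_astar _ _) (locFin_astar _ _)).pair (linFam_aop _ _))
    ?_).sub (Shifts.sum _ fun j _ => hab _ _ _ _ ?_)).add
    (Shifts.sum _ fun j _ => hab _ _ _ _ ?_)).add
    (Shifts.sum _ fun j _ => (hcubic _ _).sub (hcubic _ _))).add
    (shifts_astar_Phi_add_kD hdisj htri kappa lam hE1 hE2 hr hrn hs hsn m)
  · rw [neg_add_cancel_left, wt_succ]
  · rw [← wt_succ]
    simp only [wt]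
    ring
  · rw [← wt_succ]
    simp only [wt]
    ring

theorem Acar_of_pos {r s : ℕ} (hr : 1 ≤ r) (hrn : r ≤ n) (hsn : s ≤ n) (hn : 2 ≤ n) :
    Acar n r s = if s = 0 then -wt r 1 (n + 1) else finCar r s := by
  have h1 : (r + 1) % (n + 1) = s % (n + 1) ↔ s = r + 1 ∨ (s = 0 ∧ r = n) := by
    rw [Nat.mod_eq_of_lt (show s < n + 1 by omega)]
    rcases Nat.lt_or_ge (r + 1) (n + 1) with h | h
    · rw [Nat.mod_eq_of_lt h]
      omega
    · have : r = n := by omega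
      subst this
      rw [Nat.mod_self]
      omega
  have h2 : (s + 1) % (n + 1) = r % (n + 1) ↔ s + 1 = r := by
    rw [Nat.mod_eq_of_lt (show r < n + 1 by omega)]
    rcases Nat.lt_or_ge (s + 1) (n + 1) with h | h
    · rw [Nat.mod_eq_of_lt h]
    · have : s = n := by omega
      subst this
      rw [Nat.mod_self]
      omega
  simp only [Acar, AcarZ, h1, h2, wt, finCar]
  split_ifs <;> first | omega | norm_num

theorem Acar_zero {s : ℕ} (hsn : s ≤ n) (hn : 2 ≤ n) :
    Acar n 0 s = -∑ r ∈ Finset.Icc 1 n, if s = 0 then -wt r 1 (n + 1) else finCar r s := by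
  by_cases h0 : s = 0
  · subst h0
    have hsum : ∑ r ∈ Finset.Icc 1 n, -wt r 1 (n + 1)
        = -∑ r ∈ Finset.Icc 1 n, ((if r = 1 then 1 else 0) + (if r = n then 1 else 0)) := by
      rw [← Finset.sum_neg_distrib]
      refine Finset.sum_congr rfl fun r hr => ?_
      have := Finset.mem_Icc.mp hr
      simp only [wt]
      split_ifs <;> first | omega | norm_num
    simp only [if_true, hsum, Finset.sum_add_distrib, Finset.sum_ite_eq', Finset.mem_Icc]
    rw [if_pos (by omega), if_pos (by omega)]
    norm_num [Acar, AcarZ]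
  · have h1 : (0 + 1) % (n + 1) = s % (n + 1) ↔ s = 1 := by
      rw [Nat.mod_eq_of_lt (by omega), Nat.mod_eq_of_lt (by omega)]
      omega
    have h2 : (s + 1) % (n + 1) = 0 % (n + 1) ↔ s = n := by
      rw [Nat.zero_mod, ← Nat.dvd_iff_mod_eq_zero]
      exact ⟨fun h => by have := Nat.le_of_dvd (by omega) h; omega, fun h => by rw [h]⟩
    have hsum : ∑ r ∈ Finset.Icc 1 n, finCar r s = ∑ r ∈ Finset.Icc 1 n,
        (2 * (if r = s then 1 else 0) - (if r = s + 1 then 1 else 0)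
          - (if r = s - 1 then 1 else 0)) := by
      refine Finset.sum_congr rfl fun r hr => ?_
      have := Finset.mem_Icc.mp hr
      simp only [finCar]
      split_ifs <;> first | omega | norm_num
    simp only [if_neg h0, hsum, Finset.sum_sub_distrib, ← Finset.mul_sum, Finset.sum_ite_eq',
      Finset.mem_Icc, Acar, AcarZ, h1, h2]
    split_ifs <;> first | omega | norm_num

end Helpers

/-- For all `0 ≤ r, s ≤ n` and `m, n ∈ ℤ^{N+1}`,
`[ρ(H_r)_m, ρ(E_s)_n] = Â_{rs} ρ(E_s)_{m+n}` as operators on `V`. -/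
theorem stmt11 (n N : ℕ) (hn : 2 ≤ n) (hN : 1 ≤ N)
    (pos : MM N → Prop)
    (hadd : ∀ a b : MM N, pos a → pos b → pos (a + b))
    (htri : ∀ a : MM N, pos a ∨ a = 0 ∨ pos (-a))
    (hzero : ¬ pos (0 : MM N))
    (hdisj : ∀ a : MM N, pos a → ¬ pos (-a))
    (kappa : MM N → Fin (N + 1) → ℂ) (lam : ℕ → ℂ)
    (hE1 : ∀ m : MM N, ∑ p : Fin (N + 1), (m p : ℂ) * kappa m p = 0)
    (hE2 : ∀ m k : MM N, pos m → pos k →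
      ∑ p : Fin (N + 1), (m p : ℂ) * kappa (-m - k) p = 0) :
    ∀ r s : ℕ, r ≤ n → s ≤ n → ∀ m mm : MM N,
      comm (rhoH n N pos kappa lam r m) (rhoE n N pos kappa lam s mm)
        = Acar n r s • rhoE n N pos kappa lam s (m + mm) := by
  intro r s hr hs m mm
  have hpos : ∀ r, 1 ≤ r → r ≤ n → ∀ w,
      rhoHn n N pos kappa lam r m (rhoE n N pos kappa lam s mm w)
        = rhoE n N pos kappa lam s mm (rhoHn n N pos kappa lam r m w)
          + (if s = 0 then -wt r 1 (n + 1) else finCar r s) •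
            rhoE n N pos kappa lam s (m + mm) w := by
    intro r h1 hrn w
    rw [rhoHn_eq kappa lam h1 hrn]
    exact rhoHn_rhoE hdisj htri kappa lam hE1 hE2 h1 hrn hs m mm w
  funext w
  by_cases h0 : r = 0
  · subst h0
    have hE := linFam_rhoE (n := n) (pos := pos) kappa lam s mm
    have hsum : rhoE n N pos kappa lam s mm
          (∑ r ∈ Finset.Icc 1 n, rhoHn n N pos kappa lam r m w)
        = ∑ r ∈ Finset.Icc 1 n,
          rhoE n N pos kappa lam s mm (rhoHn n N pos kappa lam r m w) :=
      map_sum hE.mk' _ _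
    simp only [comm, rhoH, if_true, Pi.neg_apply, Finset.sum_apply, Pi.smul_apply, hE.map_neg,
      hsum, Acar_zero hs hn, neg_smul, Finset.sum_smul]
    rw [Finset.sum_congr rfl fun r hr => hpos r (Finset.mem_Icc.mp hr).1
      (Finset.mem_Icc.mp hr).2 w, Finset.sum_add_distrib]
    abel
  · have h1 : 1 ≤ r := Nat.one_le_iff_ne_zero.mpr h0
    simp only [comm, rhoH, if_neg h0, hpos r h1 hr, Pi.smul_apply, Acar_of_pos h1 hr hs hn,
      add_sub_cancel_left]

end Stmt11
end
end
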